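/- arXiv:2110.01149 — 7 statements merged into one kernel-verified Lean document; each statement's English description precedes it below -/
import Mathlib

section
/- Let 1 ≤ p < ∞ and 1 < ρ ≤ r < ∞ be fixed. There is NO constant C > 0 such that the estimate sup_{λ > 0} ‖λ · N_λ(f(·,t) : t ∈ ℕ)^{1/r}‖_{ℓ^{p,∞}(ℤ)} ≤ C · sup_{I ∈ 𝔖_∞(ℕ)} ‖O^ρ_{I,∞}(f(·,t) : t ∈ ℕ)‖_{ℓ^p(ℤ)} holds uniformly for every measurable function f : ℤ × ℕ → ℝ; that is, for every C > 0 there exists a measurable f : ℤ × ℕ → ℝ for which the inequality fails. -/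
open MeasureTheory ENNReal

/-- The oscillation seminorm `O^ρ_{I,∞}(a_t : t ∈ ℕ)` along an infinite
strictly increasing sequence `I`. -/
noncomputable def oscInf (ρ : ℝ) (I : ℕ → ℕ) (a : ℕ → ℝ) : ℝ≥0∞ :=
  (∑' j : ℕ, (⨆ t ∈ Set.Ico (I j) (I (j+1)), ENNReal.ofReal |a t - a (I j)|) ^ ρ) ^ (1/ρ)

/-- The `λ`-jump counting function `N_λ(a_t : t ∈ ℕ)`. -/
noncomputable def jumpCount (lam : ℝ) (a : ℕ → ℝ) : ℝ≥0∞ :=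
  ⨆ (J : ℕ) (_ : ∃ t : ℕ → ℕ, StrictMonoOn t (Set.Iic J) ∧
      ∀ j < J, lam ≤ |a (t (j+1)) - a (t j)|), (J : ℝ≥0∞)

/-- The sequential `λ`-jump counting function `N_{λ,I}(a_t : t ∈ ℕ)`. -/
noncomputable def seqJumpCount (lam : ℝ) (I : ℕ → ℕ) (a : ℕ → ℝ) : ℝ≥0∞ :=
  Measure.count {k : ℕ |
    ENNReal.ofReal lam ≤ ⨆ t ∈ Set.Ico (I k) (I (k+1)), ENNReal.ofReal |a t - a (I k)|}

/-- The `r`-variation seminorm `V^r(a_t : t ∈ ℕ)`. -/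
noncomputable def varSeminorm (r : ℝ) (a : ℕ → ℝ) : ℝ≥0∞ :=
  ⨆ (J : ℕ) (_ : 0 < J) (t : ℕ → ℕ) (_ : StrictMonoOn t (Set.Iic J)),
    (∑ j ∈ Finset.range J, ENNReal.ofReal |a (t (j+1)) - a (t j)| ^ r) ^ (1/r)

/-- The weak `ℓ^{p,∞}(ℤ)` quasi-norm of an `ℝ≥0∞`-valued function. -/
noncomputable def weakLpZ (p : ℝ) (g : ℤ → ℝ≥0∞) : ℝ≥0∞ :=
  ⨆ (α : ℝ) (_ : 0 < α),
    ENNReal.ofReal α * (Measure.count {x : ℤ | ENNReal.ofReal α < g x}) ^ (1/p)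

/-- The `ℓ^p(ℤ)` norm of an `ℝ≥0∞`-valued function. -/
noncomputable def lpZ (p : ℝ) (g : ℤ → ℝ≥0∞) : ℝ≥0∞ :=
  (∑' x : ℤ, g x ^ p) ^ (1/p)


/-- zero set of the zigzag function, in rescaled time. -/
def zset (N l : ℕ) : Set ℝ :=
  {u : ℝ | (∃ k : ℤ, u = 2 * k) ∨ u ≤ (N * l : ℕ) ∨ ((N * (l + 1) : ℕ) : ℝ) ≤ u}

/-- zigzag function at scale `2^s`, supported in the `l`-th interval of length `N 2^s`. -/
noncomputable def zig (N s l t : ℕ) : ℝ := Metric.infDist ((t : ℝ) / 2 ^ s) (zset N l)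

lemma zig_nonneg (N s l t : ℕ) : 0 ≤ zig N s l t := Metric.infDist_nonneg

lemma zig_le_one (N s l t : ℕ) : zig N s l t ≤ 1 := by
  unfold zig
  set u : ℝ := (t : ℝ) / 2 ^ s
  have h1 : (2 * (round (u / 2) : ℤ) : ℝ) ∈ zset N l := Or.inl ⟨_, rfl⟩
  refine (Metric.infDist_le_dist_of_mem h1).trans ?_
  have := abs_sub_round (u / 2)
  rw [Real.dist_eq]
  rw [abs_le] at *
  constructor <;> linarith [this.1, this.2]

lemma zig_lip (N s l t t' : ℕ) :
    |zig N s l t - zig N s l t'| ≤ |(t : ℝ) - t'| / 2 ^ s := by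
  have h := (Metric.lipschitz_infDist_pt (zset N l)).dist_le_mul ((t : ℝ) / 2 ^ s) ((t' : ℝ) / 2 ^ s)
  rw [Real.dist_eq, Real.dist_eq, ← sub_div, abs_div, abs_of_pos (by positivity : (0:ℝ) < 2 ^ s)] at h
  simpa [zig] using h

lemma zig_abs_le_one (N s l t t' : ℕ) : |zig N s l t - zig N s l t'| ≤ 1 := by
  have := zig_nonneg N s l t
  have := zig_nonneg N s l t'
  have := zig_le_one N s l t
  have := zig_le_one N s l t'
  rw [abs_le]; constructor <;> linarith

lemma zig_zero_left (N s l t : ℕ) (h : t ≤ N * l * 2 ^ s) : zig N s l t = 0 := by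
  apply Metric.infDist_zero_of_mem
  refine Or.inr (Or.inl ?_)
  rw [div_le_iff₀ (by positivity)]
  exact_mod_cast h

lemma zig_zero_right (N s l t : ℕ) (h : N * (l + 1) * 2 ^ s ≤ t) : zig N s l t = 0 := by
  apply Metric.infDist_zero_of_mem
  refine Or.inr (Or.inr ?_)
  rw [le_div_iff₀ (by positivity)]
  exact_mod_cast h

lemma zig_even (N s l m : ℕ) (h : Even m) : zig N s l (m * 2 ^ s) = 0 := by
  apply Metric.infDist_zero_of_mem
  obtain ⟨k, rfl⟩ := h
  refine Or.inl ⟨k, ?_⟩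
  push_cast
  field_simp
  ring

lemma zig_odd (N s l m : ℕ) (h : Odd m) (h1 : N * l < m) (h2 : m < N * (l + 1)) :
    zig N s l (m * 2 ^ s) = 1 := by
  apply le_antisymm (zig_le_one _ _ _ _)
  unfold zig
  have e : ((m * 2 ^ s : ℕ) : ℝ) / 2 ^ s = m := by push_cast; field_simp
  rw [e]
  refine (Metric.le_infDist (s := zset N l) ⟨(0:ℝ), Or.inl ⟨0, by simp⟩⟩).2 ?_
  rintro u (⟨k, rfl⟩ | hu | hu)
  · rw [Real.dist_eq]
    obtain ⟨c, rfl⟩ := h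
    have h3 : (1 : ℤ) ≤ |(2 * c + 1 : ℤ) - 2 * k| := Int.one_le_abs (by omega)
    exact_mod_cast h3
  · rw [Real.dist_eq]
    have : ((N * l : ℕ) : ℝ) + 1 ≤ m := by exact_mod_cast h1
    exact le_trans (by linarith) (le_abs_self _)
  · rw [Real.dist_eq]
    have : (m : ℝ) + 1 ≤ ((N * (l + 1) : ℕ) : ℝ) := by exact_mod_cast h2
    exact le_trans (by linarith) (neg_le_abs _)

lemma jumpCount_zig (n s l : ℕ) : ((2 * n : ℕ) : ℝ≥0∞) ≤ jumpCount 1 (zig (2 * n) s l) := by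
  unfold jumpCount
  refine le_iSup₂_of_le (2 * n) ⟨fun j => (2 * n * l + j) * 2 ^ s, ?_, ?_⟩ le_rfl
  · intro a _ b _ hab
    have : 0 < 2 ^ s := by positivity
    show (2 * n * l + a) * 2 ^ s < (2 * n * l + b) * 2 ^ s
    exact Nat.mul_lt_mul_of_pos_right (by omega) this
  · intro j hj
    have e2 : 2 * n * (l + 1) = 2 * n * l + 2 * n := by ring
    have e3 : Even (2 * n * l) := by rw [mul_assoc]; exact even_two_mul _
    rcases Nat.even_or_odd j with h | h
    · rw [zig_even _ _ _ (2 * n * l + j) (e3.add h),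
        zig_odd _ _ _ (2 * n * l + (j + 1)) (e3.add_odd h.add_one) (by omega)
          (by obtain ⟨c, rfl⟩ := h; omega)]
      simp
    · rw [zig_even _ _ _ (2 * n * l + (j + 1)) (e3.add h.add_one),
        zig_odd _ _ _ (2 * n * l + j) (e3.add_odd h) (by obtain ⟨c, rfl⟩ := h; omega)
          (by omega)]
      simp

/-- The intervals of a strictly increasing sequence are disjoint. -/
lemma tsum_mem_Ico (I : ℕ → ℕ) (hI : StrictMono I) (a : ℕ) :
    ∑' j : ℕ, (if a ∈ Set.Ico (I j) (I (j+1)) then (1 : ℝ≥0∞) else 0) ≤ 1 := by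
  classical
  by_cases h : ∃ k, a ∈ Set.Ico (I k) (I (k+1))
  · obtain ⟨k, hk⟩ := h
    rw [tsum_eq_single k]
    · split_ifs <;> simp
    · intro j hj
      rw [if_neg]
      intro hj'
      rcases lt_or_gt_of_ne hj with h | h
      · have := hI.monotone (show j + 1 ≤ k from h)
        have := hk.1; have := hj'.2; omega
      · have := hI.monotone (show k + 1 ≤ j from h)
        have := hk.2; have := hj'.1; omega
  · push Not at h
    rw [ENNReal.tsum_eq_zero.2]
    · simp
    · intro j; rw [if_neg (h j)]

lemma tsum_len (I : ℕ → ℕ) (hI : StrictMono I) (a b : ℕ) :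
    ∑' j : ℕ, (if a ≤ I j ∧ I (j+1) ≤ b then ((I (j+1) - I j : ℕ) : ℝ≥0∞) else 0)
      ≤ ((b - a : ℕ) : ℝ≥0∞) := by
  classical
  calc _ ≤ ∑' j : ℕ, ∑ t ∈ Finset.Ico a b,
          (if t ∈ Set.Ico (I j) (I (j+1)) then (1 : ℝ≥0∞) else 0) := by
        refine ENNReal.tsum_le_tsum fun j => ?_
        split_ifs with h
        · rw [← Finset.sum_filter, Finset.sum_const, nsmul_eq_mul, mul_one, ← Nat.card_Ico]
          refine Nat.cast_le.2 (Finset.card_le_card ?_)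
          intro t ht
          simp only [Finset.mem_Ico, Finset.mem_filter, Set.mem_Ico] at *
          omega
        · exact zero_le
    _ = ∑ t ∈ Finset.Ico a b, ∑' j : ℕ,
          (if t ∈ Set.Ico (I j) (I (j+1)) then (1 : ℝ≥0∞) else 0) :=
        Summable.tsum_finsetSum fun _ _ => ENNReal.summable
    _ ≤ ∑ t ∈ Finset.Ico a b, 1 := Finset.sum_le_sum fun t _ => tsum_mem_Ico I hI t
    _ = _ := by simp

/-- size of the oscillation on an interval of length `g` at scale `2^s`. -/
noncomputable def wt (ρ : ℝ) (g s : ℕ) : ℝ≥0∞ := (min 1 ((g : ℝ≥0∞) / 2 ^ s)) ^ ρ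

/-- interior part of the oscillation. -/
noncomputable def inner' (ρ : ℝ) (N s l : ℕ) (I : ℕ → ℕ) : ℝ≥0∞ :=
  ∑' j : ℕ, (if N * l * 2 ^ s ≤ I j ∧ I (j+1) ≤ N * (l + 1) * 2 ^ s
    then wt ρ (I (j+1) - I j) s else 0)

lemma osc_le (ρ : ℝ) (hρ : 1 < ρ) (N s l : ℕ) (I : ℕ → ℕ) (hI : StrictMono I) :
    ∑' j : ℕ, (⨆ t ∈ Set.Ico (I j) (I (j+1)),
      ENNReal.ofReal |zig N s l t - zig N s l (I j)|) ^ ρ ≤ 2 + inner' ρ N s l I := by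
  have hρ0 : 0 < ρ := by linarith
  set a := N * l * 2 ^ s with ha
  set b := N * (l + 1) * 2 ^ s with hb
  have key : ∀ j, (⨆ t ∈ Set.Ico (I j) (I (j+1)),
      ENNReal.ofReal |zig N s l t - zig N s l (I j)|) ^ ρ ≤
      ((if a ∈ Set.Ico (I j) (I (j+1)) then (1 : ℝ≥0∞) else 0) +
      (if b ∈ Set.Ico (I j) (I (j+1)) then (1 : ℝ≥0∞) else 0)) +
      (if a ≤ I j ∧ I (j+1) ≤ b then wt ρ (I (j+1) - I j) s else 0) := by
    intro j
    have hlt : I j < I (j+1) := hI (Nat.lt_succ_self j)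
    have h1 : (⨆ t ∈ Set.Ico (I j) (I (j+1)),
      ENNReal.ofReal |zig N s l t - zig N s l (I j)|) ≤ 1 := by
      refine iSup₂_le fun t _ => ?_
      exact ENNReal.ofReal_le_one.2 (zig_abs_le_one _ _ _ _ _)
    by_cases hA : a ∈ Set.Ico (I j) (I (j+1))
    · rw [if_pos hA]
      refine le_trans (ENNReal.rpow_le_one h1 hρ0.le) ?_
      rw [add_assoc]; exact le_self_add
    by_cases hB : b ∈ Set.Ico (I j) (I (j+1))
    · rw [if_pos hB]
      refine le_trans (ENNReal.rpow_le_one h1 hρ0.le) ?_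
      rw [add_comm (ite _ _ _), add_assoc]; exact le_self_add
    simp only [Set.mem_Ico, not_and, not_lt] at hA hB
    by_cases hz : I (j+1) ≤ a ∨ b ≤ I j
    · have : (⨆ t ∈ Set.Ico (I j) (I (j+1)),
        ENNReal.ofReal |zig N s l t - zig N s l (I j)|) = 0 := by
        simp only [ENNReal.iSup_eq_zero]
        intro t ht
        rcases hz with hz | hz
        · rw [zig_zero_left N s l t (by have := ht.2; omega), zig_zero_left N s l (I j) (by omega)]
          simp
        · rw [zig_zero_right N s l t (by have := ht.1; omega), zig_zero_right N s l (I j) (by omega)]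
          simp
      rw [this, ENNReal.zero_rpow_of_pos hρ0]
      exact zero_le
    · push Not at hz
      have hc : a ≤ I j ∧ I (j+1) ≤ b := by
        constructor
        · by_contra hh; have := hA; omega
        · exact hB hz.2.le
      rw [if_pos hc]
      refine le_trans ?_ le_add_self
      refine ENNReal.rpow_le_rpow (le_min h1 ?_) hρ0.le
      refine iSup₂_le fun t ht => ?_
      have h3 := zig_lip N s l t (I j)
      have h4 : |(t : ℝ) - I j| / 2 ^ s ≤ ((I (j+1) - I j : ℕ) : ℝ) / 2 ^ s := by
        gcongr
        have h5 : (I j : ℝ) ≤ t := by exact_mod_cast ht.1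
        rw [abs_of_nonneg (by linarith), Nat.cast_sub hlt.le]
        have h6 : (t : ℝ) ≤ I (j+1) := by exact_mod_cast ht.2.le
        linarith
      refine (ENNReal.ofReal_le_ofReal (h3.trans h4)).trans ?_
      rw [ENNReal.ofReal_div_of_pos (by positivity), ENNReal.ofReal_natCast,
        ENNReal.ofReal_pow (by norm_num)]
      simp
  refine (ENNReal.tsum_le_tsum key).trans ?_
  rw [ENNReal.tsum_add, ENNReal.tsum_add]
  refine add_le_add ?_ le_rfl
  rw [← one_add_one_eq_two]
  exact add_le_add (tsum_mem_Ico I hI a) (tsum_mem_Ico I hI b)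

lemma wt_le (ρ : ℝ) (hρ : 1 < ρ) (g s : ℕ) : wt ρ g s ≤ (g : ℝ≥0∞) / 2 ^ s := by
  unfold wt
  refine le_trans ?_ (min_le_right 1 _)
  exact ENNReal.rpow_le_self_of_le_one (min_le_left _ _) hρ.le

lemma inner_le (ρ : ℝ) (hρ : 1 < ρ) (N s l : ℕ) (I : ℕ → ℕ) (hI : StrictMono I) :
    inner' ρ N s l I ≤ N := by
  have h := tsum_len I hI (N * l * 2 ^ s) (N * (l + 1) * 2 ^ s)
  have e : N * (l + 1) * 2 ^ s - N * l * 2 ^ s = N * 2 ^ s := by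
    rw [mul_add, add_mul, Nat.add_sub_cancel_left, mul_one]
  rw [e] at h
  calc inner' ρ N s l I ≤ ∑' j : ℕ, (if N * l * 2 ^ s ≤ I j ∧ I (j+1) ≤ N * (l + 1) * 2 ^ s
        then ((I (j+1) - I j : ℕ) : ℝ≥0∞) else 0) * (2 ^ s)⁻¹ := by
        refine ENNReal.tsum_le_tsum fun j => ?_
        split_ifs
        · rw [← div_eq_mul_inv]; exact wt_le ρ hρ _ _
        · simp
    _ ≤ ((N * 2 ^ s : ℕ) : ℝ≥0∞) * (2 ^ s)⁻¹ := by
        rw [ENNReal.tsum_mul_right]; gcongr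
    _ = N := by
        push_cast
        rw [mul_assoc, ENNReal.mul_inv_cancel (by simp) (by simp), mul_one]

/-- geometric constant. -/
noncomputable def Kc (ρ : ℝ) : ℝ≥0∞ := 2 + (1 - (2⁻¹ : ℝ≥0∞) ^ (ρ - 1))⁻¹

lemma Kc_ne_top (ρ : ℝ) (hρ : 1 < ρ) : Kc ρ ≠ ∞ := by
  unfold Kc
  have h : (2⁻¹ : ℝ≥0∞) ^ (ρ - 1) < 1 :=
    ENNReal.rpow_lt_one (by simp) (by linarith)
  refine ENNReal.add_ne_top.2 ⟨by simp, ?_⟩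
  rw [ENNReal.inv_ne_top]
  exact (tsub_pos_of_lt h).ne'

lemma scale_sum_low (ρ : ℝ) (hρ : 1 < ρ) (g k : ℕ) (hk1 : 2 ^ k ≤ g) :
    ∑ s ∈ Finset.range (k+1), (2 : ℝ≥0∞) ^ s * wt ρ g s ≤ 2 * g := by
  calc _ ≤ ∑ s ∈ Finset.range (k+1), (2 : ℝ≥0∞) ^ s := by
        refine Finset.sum_le_sum fun s _ => ?_
        refine mul_le_of_le_one_right' ?_
        exact ENNReal.rpow_le_one (min_le_left _ _) (by linarith)
    _ = ((∑ s ∈ Finset.range (k+1), 2 ^ s : ℕ) : ℝ≥0∞) := by push_cast; rfl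
    _ ≤ ((2 * g : ℕ) : ℝ≥0∞) := by
        refine Nat.cast_le.2 ?_
        rw [Nat.geomSum_eq le_rfl]
        simp only [Nat.add_one_sub_one, Nat.div_one]
        rw [pow_succ]; omega
    _ = _ := by push_cast; rfl

lemma scale_sum_high (ρ : ℝ) (hρ : 1 < ρ) (g k : ℕ) (hg : 0 < g) (hk2 : g < 2 ^ (k + 1)) :
    ∑' i : ℕ, (2 : ℝ≥0∞) ^ (i + (k+1)) * wt ρ g (i + (k+1)) ≤
      (1 - (2⁻¹ : ℝ≥0∞) ^ (ρ - 1))⁻¹ * g := by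
  rw [← ENNReal.tsum_geometric, ← ENNReal.tsum_mul_right]
  refine ENNReal.tsum_le_tsum fun i => ?_
  have h2 : (g : ℝ≥0∞) / 2 ^ (i + (k+1)) ≤ 2⁻¹ ^ i := by
    rw [← ENNReal.inv_pow]
    refine ENNReal.div_le_of_le_mul ?_
    rw [pow_add, ← mul_assoc, ENNReal.inv_mul_cancel (by simp) (by simp), one_mul]
    exact_mod_cast hk2.le
  have h3 : wt ρ g (i + (k+1)) ≤ (g : ℝ≥0∞) / 2 ^ (i + (k+1)) * (2⁻¹ ^ i) ^ (ρ - 1) := by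
    unfold wt
    set z := (g : ℝ≥0∞) / 2 ^ (i + (k+1)) with hz
    have hz0 : z ≠ 0 := by
      rw [hz]; simp [ENNReal.div_eq_zero_iff, hg.ne']
    have hzt : z ≠ ∞ := ne_top_of_le_ne_top (by simp) h2
    calc _ ≤ z ^ ρ := ENNReal.rpow_le_rpow (min_le_right _ _) (by linarith)
      _ = z * z ^ (ρ - 1) := by
          conv_lhs => rw [show ρ = 1 + (ρ - 1) by ring]
          rw [ENNReal.rpow_add _ _ hz0 hzt, ENNReal.rpow_one]
      _ ≤ _ := by gcongr
  calc _ ≤ (2 : ℝ≥0∞) ^ (i + (k+1)) *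
        ((g : ℝ≥0∞) / 2 ^ (i + (k+1)) * (2⁻¹ ^ i) ^ (ρ - 1)) := by gcongr
    _ = g * (2⁻¹ ^ i) ^ (ρ - 1) := by
        rw [← mul_assoc, ENNReal.mul_div_cancel (by simp) (by simp)]
    _ = _ := by
        rw [mul_comm, ← ENNReal.rpow_natCast, ← ENNReal.rpow_natCast,
          ← ENNReal.rpow_mul, ← ENNReal.rpow_mul, mul_comm (i : ℝ)]

lemma exists_pow_two (g : ℕ) (hg : 0 < g) : ∃ k : ℕ, 2 ^ k ≤ g ∧ g < 2 ^ (k + 1) :=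
  ⟨Nat.log 2 g, Nat.pow_log_le_self 2 hg.ne', Nat.lt_pow_succ_log_self (by norm_num) g⟩

lemma scale_sum (ρ : ℝ) (hρ : 1 < ρ) (g M : ℕ) (hg : 0 < g) :
    ∑ s ∈ Finset.range M, (2 : ℝ≥0∞) ^ s * wt ρ g s ≤ Kc ρ * g := by
  have hk := exists_pow_two g hg
  obtain ⟨k, hk1, hk2⟩ := hk
  have h1 := scale_sum_low ρ hρ g k hk1
  have h2 := scale_sum_high ρ hρ g k hg hk2
  have h3 := Summable.sum_add_tsum_nat_add' (f := fun s : ℕ => (2 : ℝ≥0∞) ^ s * wt ρ g s)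
    (k := k+1) ENNReal.summable
  refine (ENNReal.sum_le_tsum _).trans ?_
  rw [← h3]
  refine (add_le_add h1 h2).trans (le_of_eq ?_)
  rw [← add_mul, Kc]

lemma total_inner (ρ : ℝ) (hρ : 1 < ρ) (N M : ℕ) (hN : 0 < N) (I : ℕ → ℕ) (hI : StrictMono I) :
    ∑ s ∈ Finset.range M, ∑ y ∈ Finset.range (N * 2 ^ M), inner' ρ N s (y / (N * 2 ^ s)) I
      ≤ N * Kc ρ * ((N * 2 ^ M : ℕ) : ℝ≥0∞) := by
  set T := N * 2 ^ M with hT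
  unfold inner'
  have : ∀ s ∈ Finset.range M, ∀ j : ℕ, ∑ y ∈ Finset.range T,
      (if N * (y / (N * 2 ^ s)) * 2 ^ s ≤ I j ∧ I (j+1) ≤ N * (y / (N * 2 ^ s) + 1) * 2 ^ s
        then wt ρ (I (j+1) - I j) s else 0) ≤
      if 0 ≤ I j ∧ I (j+1) ≤ T then N * (2 ^ s * wt ρ (I (j+1) - I j) s) else 0 := by
    intro s hs j
    have hs' : s < M := Finset.mem_range.1 hs
    have hlt : I j < I (j+1) := hI (Nat.lt_succ_self j)
    set P := N * 2 ^ s with hP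
    have hP0 : 0 < P := by positivity
    have hdvd : P ∣ T := Nat.mul_dvd_mul_left N (pow_dvd_pow 2 hs'.le)
    have e1 : ∀ c, N * c * 2 ^ s = P * c := fun c => by rw [hP]; ring
    simp only [e1]
    -- such `y` all lie in the period of `I j`
    have hmem : ∀ y ∈ Finset.range T, (P * (y / P) ≤ I j ∧ I (j+1) ≤ P * (y / P + 1)) →
        I (j+1) ≤ T ∧ y ∈ Finset.Ico (P * (I j / P)) (P * (I j / P) + P) := by
      intro y hy ⟨h1, h2⟩
      have hyT : y < T := Finset.mem_range.1 hy
      have hdiv : I j / P = y / P := by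
        apply Nat.div_eq_of_lt_le
        · rw [mul_comm]; exact h1
        · rw [mul_comm]; omega
      constructor
      · obtain ⟨c, hc⟩ := hdvd
        have : y / P < c := by
          rw [Nat.div_lt_iff_lt_mul hP0, mul_comm, ← hc]; exact hyT
        calc I (j+1) ≤ P * (y / P + 1) := h2
          _ ≤ P * c := Nat.mul_le_mul_left P this
          _ = T := hc.symm
      · rw [hdiv, Finset.mem_Ico]
        have := Nat.div_add_mod y P
        have := Nat.mod_lt y hP0
        omega
    split_ifs with hc
    · rw [← Finset.sum_filter, Finset.sum_const, nsmul_eq_mul, ← mul_assoc]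
      gcongr
      have hcard : (Finset.filter (fun y => P * (y / P) ≤ I j ∧ I (j+1) ≤ P * (y / P + 1))
          (Finset.range T)).card ≤ P := by
        calc _ ≤ (Finset.Ico (P * (I j / P)) (P * (I j / P) + P)).card := by
              refine Finset.card_le_card fun y hy => ?_
              rw [Finset.mem_filter] at hy
              exact (hmem y hy.1 hy.2).2
          _ = P := by simp
      calc _ ≤ (P : ℝ≥0∞) := Nat.cast_le.2 hcard
        _ = _ := by rw [hP]; push_cast; rfl
    · refine le_of_eq (Finset.sum_eq_zero fun y hy => ?_)
      rw [if_neg]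
      intro h
      exact hc ⟨Nat.zero_le _, (hmem y hy h).1⟩
  calc _ = ∑ s ∈ Finset.range M, ∑' j : ℕ, ∑ y ∈ Finset.range T,
      (if N * (y / (N * 2 ^ s)) * 2 ^ s ≤ I j ∧ I (j+1) ≤ N * (y / (N * 2 ^ s) + 1) * 2 ^ s
        then wt ρ (I (j+1) - I j) s else 0) := by
        refine Finset.sum_congr rfl fun s _ => ?_
        exact (Summable.tsum_finsetSum fun _ _ => ENNReal.summable).symm
    _ ≤ ∑ s ∈ Finset.range M, ∑' j : ℕ,
        (if 0 ≤ I j ∧ I (j+1) ≤ T then N * (2 ^ s * wt ρ (I (j+1) - I j) s) else 0) :=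
        Finset.sum_le_sum fun s hs => ENNReal.tsum_le_tsum fun j => this s hs j
    _ = ∑' j : ℕ, ∑ s ∈ Finset.range M,
        (if 0 ≤ I j ∧ I (j+1) ≤ T then N * (2 ^ s * wt ρ (I (j+1) - I j) s) else 0) :=
        (Summable.tsum_finsetSum fun _ _ => ENNReal.summable).symm
    _ ≤ ∑' j : ℕ, N * Kc ρ *
        (if 0 ≤ I j ∧ I (j+1) ≤ T then ((I (j+1) - I j : ℕ) : ℝ≥0∞) else 0) := by
        refine ENNReal.tsum_le_tsum fun j => ?_
        split_ifs with hc
        · rw [← Finset.mul_sum, mul_assoc]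
          gcongr
          exact scale_sum ρ hρ _ M (Nat.sub_pos_of_lt (hI (Nat.lt_succ_self j)))
        · simp
    _ ≤ _ := by
        rw [ENNReal.tsum_mul_left]
        gcongr
        simpa using tsum_len I hI 0 T

lemma pow_bound (q : ℝ) (hq : 0 < q) (N : ℕ) (hN : 0 < N) (X : ℝ≥0∞) (hX : X ≤ N) :
    (2 + X) ^ q ≤ 3 ^ q + (3 * N) ^ q * X := by
  rcases le_total X 1 with h | h
  · refine le_trans (ENNReal.rpow_le_rpow ?_ hq.le) le_self_add
    calc 2 + X ≤ 2 + 1 := by gcongr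
      _ = 3 := by norm_num
  · refine le_trans ?_ le_add_self
    have h1 : (1 : ℝ≥0∞) ≤ N := by exact_mod_cast hN
    calc (2 + X) ^ q ≤ (3 * N) ^ q := by
          refine ENNReal.rpow_le_rpow ?_ hq.le
          calc 2 + X ≤ 2 * N + N := add_le_add (le_mul_of_one_le_right' h1) hX
            _ = 3 * N := by ring
      _ ≤ _ := le_mul_of_one_le_right' h

/-- The counterexample family, on a finite index type. -/
noncomputable def fam (N M : ℕ) (z : Fin M × Fin (N * 2 ^ M)) : ℕ → ℝ :=
  zig N z.1 (z.2 / (N * 2 ^ (z.1 : ℕ)))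

lemma fam_osc (p ρ : ℝ) (hp : 1 ≤ p) (hρ : 1 < ρ) (N M : ℕ) (hN : 0 < N)
    (I : ℕ → ℕ) (hI : StrictMono I) :
    ∑ z : Fin M × Fin (N * 2 ^ M), oscInf ρ I (fam N M z) ^ p ≤
      (M * 3 ^ (p / ρ) + (3 * N) ^ (p / ρ) * (N * Kc ρ)) * ((N * 2 ^ M : ℕ) : ℝ≥0∞) := by
  have hq : 0 < p / ρ := by apply div_pos <;> linarith
  have h1 : ∀ z : Fin M × Fin (N * 2 ^ M), oscInf ρ I (fam N M z) ^ p ≤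
      3 ^ (p / ρ) + (3 * N) ^ (p / ρ) * inner' ρ N z.1 (z.2 / (N * 2 ^ (z.1 : ℕ))) I := by
    intro z
    unfold oscInf
    rw [← ENNReal.rpow_mul, one_div, inv_mul_eq_div]
    exact (ENNReal.rpow_le_rpow (osc_le ρ hρ _ _ _ I hI) hq.le).trans
      (pow_bound _ hq N hN _ (inner_le ρ hρ _ _ _ I hI))
  refine (Finset.sum_le_sum fun z _ => h1 z).trans ?_
  rw [Finset.sum_add_distrib, ← Finset.mul_sum]
  have h2 := total_inner ρ hρ N M hN I hI
  rw [← Fin.sum_univ_eq_sum_range (fun s => ∑ y ∈ Finset.range (N * 2 ^ M),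
    inner' ρ N s (y / (N * 2 ^ s)) I)] at h2
  simp_rw [← Fin.sum_univ_eq_sum_range (fun y => inner' ρ N _ (y / (N * 2 ^ _)) I)] at h2
  rw [add_mul]
  refine add_le_add (le_of_eq ?_) ?_
  · simp only [Finset.sum_const, Finset.card_univ, Fintype.card_prod, Fintype.card_fin,
      nsmul_eq_mul, Nat.cast_mul]
    ring
  · rw [mul_assoc, Fintype.sum_prod_type]
    gcongr

/-- Jump estimates cannot be dominated by oscillation estimates uniformly
(Theorem 1.2, inequality (1.7), of Mirek–Słomian–Szarek). -/
theorem stmt4 (p ρ r : ℝ) (hp : 1 ≤ p) (hρ : 1 < ρ) (hρr : ρ ≤ r) :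
    ¬ ∃ C : ℝ, 0 < C ∧ ∀ f : ℤ → ℕ → ℝ,
      (⨆ (lam : ℝ) (_ : 0 < lam),
        weakLpZ p (fun x => ENNReal.ofReal lam * jumpCount lam (f x) ^ (1/r)))
      ≤ ENNReal.ofReal C *
        ⨆ (I : ℕ → ℕ) (_ : StrictMono I), lpZ p (fun x => oscInf ρ I (f x)) := by
  rintro ⟨C, hC, hf⟩
  have hp0 : 0 < p := by linarith
  have hr0 : 0 < r := by linarith
  have hρ0 : 0 < ρ := by linarith
  -- choice of the level `A`
  set A : ℝ≥0∞ := ENNReal.ofReal C ^ p * 3 ^ (p / ρ) with hA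
  have hAtop : A ≠ ∞ := ENNReal.mul_ne_top
    (ENNReal.rpow_ne_top_of_nonneg hp0.le ENNReal.ofReal_ne_top)
    (ENNReal.rpow_ne_top_of_nonneg (by positivity) (by simp))
  obtain ⟨α, hα0, hα⟩ : ∃ α : ℝ, 0 < α ∧ A + 1 ≤ ENNReal.ofReal α ^ p := by
    refine ⟨(A + 1).toReal ^ (1 / p), ?_, ?_⟩
    · apply Real.rpow_pos_of_pos
      exact ENNReal.toReal_pos (by simp) (by simp [hAtop])
    · rw [← ENNReal.ofReal_rpow_of_nonneg ENNReal.toReal_nonneg (by positivity),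
        ENNReal.ofReal_toReal (by simp [hAtop]), ← ENNReal.rpow_mul, one_div,
        inv_mul_cancel₀ hp0.ne', ENNReal.rpow_one]
  obtain ⟨n, hn⟩ := exists_nat_gt (α ^ r)
  have hn0 : 0 < n := by
    have : (0 : ℝ) < n := (Real.rpow_pos_of_pos hα0 r).trans hn
    exact_mod_cast this
  set N := 2 * n with hN
  have hN0 : 0 < N := by omega
  have hαN : ENNReal.ofReal α < (N : ℝ≥0∞) ^ (1 / r) := by
    rw [one_div, ENNReal.lt_rpow_inv_iff hr0, ENNReal.ofReal_rpow_of_pos hα0,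
      ← ENNReal.ofReal_natCast, ENNReal.ofReal_lt_ofReal_iff (by positivity), hN]
    push_cast
    have : (0 : ℝ) < n := by exact_mod_cast hn0
    linarith
  set B : ℝ≥0∞ := ENNReal.ofReal C ^ p * ((3 * N) ^ (p / ρ) * (N * Kc ρ)) with hB
  have hBtop : B ≠ ∞ := by
    refine ENNReal.mul_ne_top (ENNReal.rpow_ne_top_of_nonneg hp0.le ENNReal.ofReal_ne_top)
      (ENNReal.mul_ne_top (ENNReal.rpow_ne_top_of_nonneg (by positivity)
        (ENNReal.mul_ne_top (by simp) (by simp))) (ENNReal.mul_ne_top (by simp) (Kc_ne_top ρ hρ)))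
  obtain ⟨M, hM⟩ := ENNReal.exists_nat_gt hBtop
  set T := N * 2 ^ M with hT
  have hT0 : 0 < T := by positivity
  -- the function
  let e : Fin M × Fin T → ℤ := fun z => ((Encodable.encode z : ℕ) : ℤ)
  have he : Function.Injective e := fun a b h => Encodable.encode_injective (Int.natCast_inj.1 h)
  let f : ℤ → ℕ → ℝ := Function.extend e (fam N M) 0
  have hfe : ∀ z, f (e z) = fam N M z := fun z => he.extend_apply _ _ z
  have hf0 : ∀ x, x ∉ Set.range e → f x = 0 := fun x hx =>
    Function.extend_apply' _ _ x (fun ⟨a, ha⟩ => hx ⟨a, ha⟩)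
  have main := hf f
  -- right side
  have hR : (⨆ (I : ℕ → ℕ) (_ : StrictMono I), lpZ p (fun x => oscInf ρ I (f x))) ≤
      ((M * 3 ^ (p / ρ) + (3 * N) ^ (p / ρ) * (N * Kc ρ)) * (T : ℝ≥0∞)) ^ (1 / p) := by
    refine iSup₂_le fun I hI => ?_
    unfold lpZ
    refine ENNReal.rpow_le_rpow ?_ (by positivity)
    have hsupp : Function.support (fun x => oscInf ρ I (f x) ^ p) ⊆ Set.range e := by
      intro x hx
      by_contra hxe
      apply hx
      show oscInf ρ I (f x) ^ p = 0
      rw [hf0 x hxe]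
      simp [oscInf, ENNReal.zero_rpow_of_pos, hρ0, hp0]
    rw [← he.tsum_eq hsupp, tsum_fintype]
    simp only [hfe]
    exact fam_osc p ρ hp hρ N M hN0 I hI
  -- left side
  have hL : ENNReal.ofReal α * ((M * T : ℕ) : ℝ≥0∞) ^ (1 / p) ≤
      ⨆ (lam : ℝ) (_ : 0 < lam),
        weakLpZ p (fun x => ENNReal.ofReal lam * jumpCount lam (f x) ^ (1/r)) := by
    refine le_iSup₂_of_le 1 one_pos ?_
    unfold weakLpZ
    refine le_iSup₂_of_le α hα0 ?_
    gcongr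
    calc ((M * T : ℕ) : ℝ≥0∞) = Measure.count (Set.univ : Set (Fin M × Fin T)) := by
          rw [Measure.count_univ]; simp
      _ = Measure.count (e '' Set.univ) := (Measure.count_injective_image he _).symm
      _ ≤ _ := by
          refine measure_mono ?_
          rintro _ ⟨z, -, rfl⟩
          show ENNReal.ofReal α < ENNReal.ofReal 1 * jumpCount 1 (f (e z)) ^ (1 / r)
          rw [hfe, ENNReal.ofReal_one, one_mul]
          refine hαN.trans_le (ENNReal.rpow_le_rpow ?_ (by positivity))
          exact jumpCount_zig n _ _
  have h1 := hL.trans (main.trans (mul_le_mul_right hR (ENNReal.ofReal C)))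
  have h2 := ENNReal.rpow_le_rpow h1 hp0.le
  rw [ENNReal.mul_rpow_of_nonneg _ _ hp0.le, ENNReal.mul_rpow_of_nonneg _ _ hp0.le,
    ← ENNReal.rpow_mul, ← ENNReal.rpow_mul, one_div, inv_mul_cancel₀ hp0.ne',
    ENNReal.rpow_one, ENNReal.rpow_one] at h2
  have h3 : (A + 1) * M * T ≤ (M * A + B) * T := by
    calc (A + 1) * M * T ≤ ENNReal.ofReal α ^ p * ((M * T : ℕ) : ℝ≥0∞) := by
          push_cast; rw [← mul_assoc]; gcongr
      _ ≤ _ := h2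
      _ = _ := by rw [hA, hB]; ring
  have h4 : (A + 1) * M ≤ M * A + B := by
    rwa [ENNReal.mul_le_mul_iff_left (by exact_mod_cast hT0.ne') (by simp)] at h3
  have h5 : (M : ℝ≥0∞) * A + M ≤ M * A + B := by
    calc _ = (A + 1) * M := by ring
      _ ≤ _ := h4
  have h6 := (ENNReal.add_le_add_iff_left (ENNReal.mul_ne_top (by simp) hAtop)).1 h5
  exact absurd hM (not_lt.2 h6)
end

section
/- Let 1 ≤ p < ∞ and 1 < ρ ≤ r < ∞ be fixed. There is NO constant C > 0 such that the estimate ‖V^r(f(·,t) : t ∈ ℕ)‖_{ℓ^{p,∞}(ℤ)} ≤ C · sup_{I ∈ 𝔖_∞(ℕ)} ‖O^ρ_{I,∞}(f(·,t) : t ∈ ℕ)‖_{ℓ^p(ℤ)} holds uniformly for all measurable functions f : ℤ × ℕ → ℝ. In particular, ρ-oscillation inequalities cannot serve as endpoint estimates for r-variations. -/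
open MeasureTheory ENNReal

lemma geom_bound (ρ : ℝ) (hρ : 1 < ρ) : ∃ C : ℝ, 0 < C ∧ ∀ N n : ℕ,
    ∑ k ∈ Finset.range N, (2:ℝ)^k * (min 1 ((n:ℝ)/2^k))^ρ ≤ C * n := by
  set q : ℝ := (1/2:ℝ)^(ρ-1) with hq
  have hq0 : 0 < q := by positivity
  have hq1 : q < 1 := Real.rpow_lt_one (by norm_num) (by norm_num) (by linarith)
  refine ⟨2 + (1-q)⁻¹, by have : 0 < 1 - q := by linarith
                          positivity, ?_⟩
  intro N n
  rcases Nat.eq_zero_or_pos n with h0 | hn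
  · subst h0
    simp [Real.zero_rpow (by linarith : ρ ≠ 0)]
  set m := Nat.log 2 n
  have hm1 : 2^m ≤ n := Nat.pow_log_le_self 2 hn.ne'
  have hm2 : n < 2^(m+1) := Nat.lt_pow_succ_log_self (by norm_num) n
  have hm1' : (2:ℝ)^m ≤ n := by exact_mod_cast hm1
  have hm2' : (n:ℝ) < 2^(m+1) := by exact_mod_cast hm2
  have hnpos : (0:ℝ) < n := by exact_mod_cast hn
  have hnn : ∀ k : ℕ, 0 ≤ (2:ℝ)^k * (min 1 ((n:ℝ)/2^k))^ρ := fun k => by positivity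
  calc _ ≤ ∑ k ∈ Finset.range ((m+1)+N), (2:ℝ)^k * (min 1 ((n:ℝ)/2^k))^ρ :=
        Finset.sum_le_sum_of_subset_of_nonneg (by intro x; simp; omega) (fun k _ _ => hnn k)
    _ = ∑ k ∈ Finset.range (m+1), (2:ℝ)^k * (min 1 ((n:ℝ)/2^k))^ρ +
        ∑ i ∈ Finset.range N, (2:ℝ)^(m+1+i) * (min 1 ((n:ℝ)/2^(m+1+i)))^ρ :=
        Finset.sum_range_add _ _ _
    _ ≤ ∑ k ∈ Finset.range (m+1), (2:ℝ)^k + ∑ i ∈ Finset.range N, n * q^i := by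
        refine add_le_add (Finset.sum_le_sum fun k _ => ?_) (Finset.sum_le_sum fun i _ => ?_)
        · have : (min 1 ((n:ℝ)/2^k))^ρ ≤ 1 :=
            Real.rpow_le_one (by positivity) (min_le_left _ _) (by linarith)
          have h2 : (0:ℝ) < 2^k := by positivity
          nlinarith
        · have h2 : (0:ℝ) < 2^(m+1+i) := by positivity
          have hv : 0 < (n:ℝ)/2^(m+1+i) := by positivity
          have hv2 : (n:ℝ)/2^(m+1+i) ≤ (1/2)^i := by
            rw [div_le_iff₀ h2, pow_add, mul_comm, mul_assoc, ← mul_pow]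
            norm_num
            exact hm2'.le
          calc (2:ℝ)^(m+1+i) * (min 1 ((n:ℝ)/2^(m+1+i)))^ρ
              ≤ (2:ℝ)^(m+1+i) * ((n:ℝ)/2^(m+1+i))^ρ := by
                gcongr
                exact min_le_right _ _
            _ = (2:ℝ)^(m+1+i) * (((n:ℝ)/2^(m+1+i)) * ((n:ℝ)/2^(m+1+i))^(ρ-1)) := by
                congr 1
                rw [← Real.rpow_one_add' hv.le (by linarith)]
                congr 1; ring
            _ = n * ((n:ℝ)/2^(m+1+i))^(ρ-1) := by field_simp
            _ ≤ n * ((1/2:ℝ)^i)^(ρ-1) := by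
                gcongr
            _ = n * q^i := by
                rw [hq, ← Real.rpow_natCast, ← Real.rpow_natCast, ← Real.rpow_mul (by norm_num),
                  ← Real.rpow_mul (by norm_num), mul_comm (i:ℝ)]
    _ ≤ 2 * n + n * (1-q)⁻¹ := by
        gcongr
        · have := geom_sum_eq (by norm_num : (2:ℝ) ≠ 1) (m+1)
          rw [this, pow_succ]; linarith
        · rw [← Finset.mul_sum]
          gcongr
          exact (Summable.sum_le_tsum _ (fun i _ => by positivity)
            (summable_geometric_of_lt_one hq0.le hq1)).trans_eq
            (tsum_geometric_of_lt_one hq0.le hq1)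
    _ = _ := by ring

lemma len_sum (I : ℕ → ℕ) (hI : StrictMono I) (s e : ℕ) (hse : s ≤ e) :
    ∑' j : ℕ, (if s ≤ I j ∧ I (j+1) ≤ e then (((I (j+1) - I j : ℕ) : ℝ≥0∞)) else 0)
      ≤ ((e - s : ℕ) : ℝ≥0∞) := by
  apply ENNReal.tsum_le_of_sum_range_le
  intro n
  have key : ∀ n, ∑ j ∈ Finset.range n, (if s ≤ I j ∧ I (j+1) ≤ e then I (j+1) - I j else 0) + s
      ≤ max s (min (I n) e) := by
    intro n
    induction n with
    | zero => simp
    | succ n ih =>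
      rw [Finset.sum_range_succ]
      have := hI (Nat.lt_succ_self n)
      simp only [Nat.succ_eq_add_one] at this
      split_ifs <;> omega
  have := key n
  have h2 : ∑ j ∈ Finset.range n, (if s ≤ I j ∧ I (j+1) ≤ e then I (j+1) - I j else 0) ≤ e - s := by
    omega
  exact_mod_cast h2

lemma point_sum (I : ℕ → ℕ) (hI : StrictMono I) (s : ℕ) :
    ∑' j : ℕ, (if I j ≤ s ∧ s < I (j+1) then (1 : ℝ≥0∞) else 0) ≤ 1 := by
  by_cases h : ∃ j0, I j0 ≤ s ∧ s < I (j0+1)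
  · obtain ⟨j0, h0⟩ := h
    rw [tsum_eq_single j0]
    · split_ifs <;> simp
    · intro j hj
      rw [if_neg]
      rintro ⟨h1, h2⟩
      apply hj
      have a := hI.lt_iff_lt.1 (h1.trans_lt h0.2)
      have b := hI.lt_iff_lt.1 (h0.1.trans_lt h2)
      omega
  · push Not at h
    have : ∀ j, (if I j ≤ s ∧ s < I (j+1) then (1 : ℝ≥0∞) else 0) = 0 := by
      intro j
      rw [if_neg]
      rintro ⟨h1, h2⟩
      exact absurd h2 (not_lt.2 (h j h1))
    simp [this]

/-- triangular wave -/
noncomputable def tri (x : ℝ) : ℝ := ‖(x : AddCircle (2:ℝ))‖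

lemma tri_nonneg (x : ℝ) : 0 ≤ tri x := norm_nonneg _
lemma tri_le_one (x : ℝ) : tri x ≤ 1 := by
  have := AddCircle.norm_le_half_period (2:ℝ) (x := (x : AddCircle (2:ℝ))) (by norm_num)
  simpa [tri] using this
lemma tri_lip (x y : ℝ) : |tri x - tri y| ≤ |x - y| := by
  unfold tri
  refine (abs_norm_sub_norm_le _ _).trans ?_
  rw [← AddCircle.coe_sub]
  exact QuotientAddGroup.norm_mk_le_norm
lemma tri_even (n : ℕ) : tri (2 * n) = 0 := by
  unfold tri
  rw [norm_eq_zero, AddCircle.coe_eq_zero_iff]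
  exact ⟨n, by simp [mul_comm]⟩
lemma tri_odd (n : ℕ) : tri (2 * n + 1) = 1 := by
  have h : ((2 * n + 1 : ℝ) : AddCircle (2:ℝ)) = ((2/2 : ℝ) : AddCircle (2:ℝ)) := by
    rw [AddCircle.coe_add]
    have : ((2 * n : ℝ) : AddCircle (2:ℝ)) = 0 := by
      rw [AddCircle.coe_eq_zero_iff]; exact ⟨n, by simp [mul_comm]⟩
    rw [this]; simp
  unfold tri
  rw [h, AddCircle.norm_half_period_eq]; norm_num
lemma tri_step (n : ℕ) : |tri ((n:ℝ) + 1) - tri n| = 1 := by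
  rcases Nat.even_or_odd' n with ⟨c, h | h⟩
  · subst h
    push_cast
    rw [tri_even, tri_odd]; norm_num
  · subst h
    have := tri_even (c+1)
    push_cast at this ⊢
    rw [tri_odd, show (2:ℝ) * c + 1 + 1 = 2 * (c+1) by ring, this]; norm_num

/-- left end of the block -/
def blk (M k u : ℕ) : ℕ := M * 2^k * (u/2^k)

/-- the example functions -/
noncomputable def gfun (M k u t : ℕ) : ℝ :=
  if blk M k u ≤ t ∧ t < blk M k u + M * 2^k then tri ((t:ℝ)/2^k) else 0

lemma gfun_mem (M k u t : ℕ) : 0 ≤ gfun M k u t ∧ gfun M k u t ≤ 1 := by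
  unfold gfun
  split_ifs
  · exact ⟨tri_nonneg _, tri_le_one _⟩
  · simp

/-- inside contributions -/
noncomputable def Qterm (ρ : ℝ) (I : ℕ → ℕ) (M k u j : ℕ) : ℝ≥0∞ :=
  if blk M k u ≤ I j ∧ I (j+1) ≤ blk M k u + M * 2^k then
    ENNReal.ofReal ((min 1 (((I (j+1) - I j : ℕ) : ℝ)/2^k))^ρ) else 0

lemma osc_bound (ρ : ℝ) (hρ : 1 < ρ) (I : ℕ → ℕ) (hI : StrictMono I) (M k u : ℕ) :
    ∑' j : ℕ, (⨆ t ∈ Set.Ico (I j) (I (j+1)),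
      ENNReal.ofReal |gfun M k u t - gfun M k u (I j)|) ^ ρ
    ≤ 2 + ∑' j, Qterm ρ I M k u j := by
  set s := blk M k u with hs
  set e := s + M * 2^k with he
  have hρ0 : 0 < ρ := by linarith
  have h1 : ∀ a b, |gfun M k u a - gfun M k u b| ≤ 1 := by
    intro a b
    have := gfun_mem M k u a
    have := gfun_mem M k u b
    rw [abs_le]; constructor <;> linarith
  have pt : ∀ j : ℕ, (⨆ t ∈ Set.Ico (I j) (I (j+1)),
      ENNReal.ofReal |gfun M k u t - gfun M k u (I j)|) ^ ρ ≤
      ((if I j ≤ s ∧ s < I (j+1) then (1 : ℝ≥0∞) else 0) +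
      (if I j ≤ e ∧ e < I (j+1) then (1 : ℝ≥0∞) else 0)) + Qterm ρ I M k u j := by
    intro j
    have one : (⨆ t ∈ Set.Ico (I j) (I (j+1)),
      ENNReal.ofReal |gfun M k u t - gfun M k u (I j)|) ^ ρ ≤ 1 := by
      apply ENNReal.rpow_le_one _ hρ0.le
      refine iSup₂_le fun t _ => ?_
      rw [ENNReal.ofReal_le_one]; exact h1 _ _
    by_cases c1 : I j ≤ s ∧ s < I (j+1)
    · rw [if_pos c1]
      refine one.trans ?_
      rw [add_assoc]; exact le_self_add
    by_cases c2 : I j ≤ e ∧ e < I (j+1)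
    · rw [if_pos c2]
      refine one.trans ?_
      rw [add_right_comm, add_comm]; exact le_self_add
    refine le_trans ?_ le_add_self
    have hj := hI (Nat.lt_succ_self j)
    simp only [Nat.succ_eq_add_one] at hj
    by_cases c3 : s ≤ I j ∧ I (j+1) ≤ e
    · unfold Qterm
      rw [if_pos c3, ← ENNReal.ofReal_rpow_of_nonneg (by positivity) hρ0.le]
      gcongr
      refine iSup₂_le fun t ht => ?_
      apply ENNReal.ofReal_le_ofReal
      refine le_min (h1 _ _) ?_
      unfold gfun
      rw [if_pos (by constructor <;> [(have := ht.1; omega); (have := ht.2; omega)]),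
        if_pos (by constructor <;> omega)]
      refine (tri_lip _ _).trans ?_
      rw [← sub_div, abs_div, abs_of_pos (by positivity : (0:ℝ) < 2^k)]
      gcongr
      have a1 : (I j : ℝ) ≤ t := by exact_mod_cast ht.1
      have a2 : (t : ℝ) ≤ I (j+1) := by exact_mod_cast ht.2.le
      rw [abs_of_nonneg (by linarith), Nat.cast_sub hj.le]
      linarith
    · have : (⨆ t ∈ Set.Ico (I j) (I (j+1)),
        ENNReal.ofReal |gfun M k u t - gfun M k u (I j)|) = 0 := by
        simp only [ENNReal.iSup_eq_zero]
        intro t ht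
        have ht1 := ht.1
        have ht2 := ht.2
        unfold gfun
        rw [if_neg (by omega), if_neg (by omega)]
        simp
      rw [this, ENNReal.zero_rpow_of_pos hρ0]
      exact zero_le
  calc _ ≤ _ := ENNReal.tsum_le_tsum pt
    _ ≤ (1 + 1) + ∑' j, Qterm ρ I M k u j := by
      rw [ENNReal.tsum_add, ENNReal.tsum_add]
      gcongr
      · exact point_sum I hI s
      · exact point_sum I hI e
    _ = _ := by norm_num

lemma Q_le (ρ : ℝ) (hρ : 1 < ρ) (I : ℕ → ℕ) (hI : StrictMono I) (M k u : ℕ) :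
    ∑' j, Qterm ρ I M k u j ≤ M := by
  have hk : (2:ℝ≥0∞)^k ≠ 0 := by positivity
  have hk' : (2:ℝ≥0∞)^k ≠ ∞ := by simp
  calc ∑' j, Qterm ρ I M k u j ≤ ∑' j, (if blk M k u ≤ I j ∧ I (j+1) ≤ blk M k u + M * 2^k
        then (((I (j+1) - I j : ℕ) : ℝ≥0∞)) else 0) * ((2:ℝ≥0∞)^k)⁻¹ := by
        refine ENNReal.tsum_le_tsum fun j => ?_
        unfold Qterm
        split_ifs
        · have : (((I (j+1) - I j : ℕ) : ℝ≥0∞)) * ((2:ℝ≥0∞)^k)⁻¹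
              = ENNReal.ofReal (((I (j+1) - I j : ℕ) : ℝ)/2^k) := by
            rw [ENNReal.ofReal_div_of_pos (by positivity), div_eq_mul_inv, ENNReal.ofReal_natCast,
              ENNReal.ofReal_pow (by norm_num)]
            simp
          rw [this]
          apply ENNReal.ofReal_le_ofReal
          refine (Real.rpow_le_self_of_le_one (by positivity) (min_le_left _ _) hρ.le).trans
            (min_le_right _ _)
        · simp
    _ ≤ ((M * 2^k : ℕ) : ℝ≥0∞) * ((2:ℝ≥0∞)^k)⁻¹ := by
        rw [ENNReal.tsum_mul_right]
        gcongr
        have := len_sum I hI (blk M k u) (blk M k u + M * 2^k) (by omega)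
        rwa [Nat.add_sub_cancel_left] at this
    _ = M := by
        push_cast
        rw [mul_assoc, ENNReal.mul_inv_cancel hk hk', mul_one]

lemma Q_total (ρ : ℝ) (C : ℝ) (hC0 : 0 < C)
    (hC : ∀ N n : ℕ, ∑ k ∈ Finset.range N, (2:ℝ)^k * (min 1 ((n:ℝ)/2^k))^ρ ≤ C * n)
    (I : ℕ → ℕ) (hI : StrictMono I) (M N : ℕ) (hM : 0 < M) :
    ∑ k ∈ Finset.range N, ∑ u ∈ Finset.range (2^N), ∑' j, Qterm ρ I M k u j
      ≤ ENNReal.ofReal C * ((2 * M * 2^N : ℕ) : ℝ≥0∞) := by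
  have step : ∀ k ∈ Finset.range N, ∀ j, ∑ u ∈ Finset.range (2^N), Qterm ρ I M k u j ≤
      if 0 ≤ I j ∧ I (j+1) ≤ 2 * M * 2^N then
        ENNReal.ofReal ((2:ℝ)^k * (min 1 (((I (j+1) - I j : ℕ) : ℝ)/2^k))^ρ) else 0 := by
    intro k hk j
    have hkN : 2^k ≤ 2^N := Nat.pow_le_pow_right (by norm_num) (Finset.mem_range.1 hk).le
    have hj := hI (Nat.lt_succ_self j)
    simp only [Nat.succ_eq_add_one] at hj
    have hpk : 0 < 2^k := by positivity
    split_ifs with hc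
    · set y := I j / (M * 2^k) with hy
      calc _ ≤ ∑ u ∈ Finset.Ico (y * 2^k) (y * 2^k + 2^k),
            ENNReal.ofReal ((min 1 (((I (j+1) - I j : ℕ) : ℝ)/2^k))^ρ) := by
            refine (Finset.sum_le_sum_of_ne_zero
              (t := Finset.Ico (y * 2^k) (y * 2^k + 2^k)) ?_).trans ?_
            rotate_left
            · refine Finset.sum_le_sum fun u _ => ?_
              show Qterm ρ I M k u j ≤ _
              unfold Qterm
              split_ifs
              · exact le_rfl
              · exact zero_le
            · intro u _ hne
              unfold Qterm at hne
              have hh : blk M k u ≤ I j ∧ I (j+1) ≤ blk M k u + M * 2^k := by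
                by_contra h
                rw [if_neg h] at hne
                exact hne rfl
              unfold blk at hh
              have hyu : y = u / 2^k := by
                rw [hy]
                apply Nat.div_eq_of_lt_le
                · rw [mul_comm]; exact hh.1
                · rw [add_mul, one_mul, mul_comm]; omega
              rw [Finset.mem_Ico, hyu]
              have a1 := Nat.div_add_mod u (2^k)
              have a2 := Nat.mod_lt u hpk
              rw [mul_comm] at a1
              omega
        _ = _ := by
            rw [Finset.sum_const, Nat.card_Ico, Nat.add_sub_cancel_left, nsmul_eq_mul,
              ENNReal.ofReal_mul (by positivity), ENNReal.ofReal_pow (by norm_num)]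
            simp
    · rw [Finset.sum_eq_zero]
      intro u hu
      unfold Qterm
      rw [if_neg]
      rintro ⟨h1, h2⟩
      apply hc
      refine ⟨Nat.zero_le _, h2.trans ?_⟩
      unfold blk
      have hu' := Finset.mem_range.1 hu
      have := Nat.mul_div_le u (2^k)
      calc M * 2^k * (u/2^k) + M * 2^k = M * (2^k * (u/2^k) + 2^k) := by ring
        _ ≤ M * (2^N + 2^N) := by gcongr; omega
        _ = _ := by ring
  calc _ = ∑ k ∈ Finset.range N, ∑' j, ∑ u ∈ Finset.range (2^N), Qterm ρ I M k u j := by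
        refine Finset.sum_congr rfl fun k _ => ?_
        rw [Summable.tsum_finsetSum (fun _ _ => ENNReal.summable)]
    _ ≤ ∑ k ∈ Finset.range N, ∑' j, if 0 ≤ I j ∧ I (j+1) ≤ 2 * M * 2^N then
        ENNReal.ofReal ((2:ℝ)^k * (min 1 (((I (j+1) - I j : ℕ) : ℝ)/2^k))^ρ) else 0 :=
        Finset.sum_le_sum fun k hk => ENNReal.tsum_le_tsum (step k hk)
    _ = ∑' j, ∑ k ∈ Finset.range N, if 0 ≤ I j ∧ I (j+1) ≤ 2 * M * 2^N then
        ENNReal.ofReal ((2:ℝ)^k * (min 1 (((I (j+1) - I j : ℕ) : ℝ)/2^k))^ρ) else 0 := by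
        rw [Summable.tsum_finsetSum (fun _ _ => ENNReal.summable)]
    _ ≤ ∑' j, ENNReal.ofReal C * (if 0 ≤ I j ∧ I (j+1) ≤ 2 * M * 2^N then
        (((I (j+1) - I j : ℕ) : ℝ≥0∞)) else 0) := by
        refine ENNReal.tsum_le_tsum fun j => ?_
        split_ifs
        · rw [← ENNReal.ofReal_sum_of_nonneg (fun i _ => by positivity), ← ENNReal.ofReal_natCast,
            ← ENNReal.ofReal_mul hC0.le]
          exact ENNReal.ofReal_le_ofReal (hC _ _)
        · simp
    _ ≤ _ := by
        rw [ENNReal.tsum_mul_left]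
        gcongr
        exact len_sum I hI 0 _ (Nat.zero_le _)

lemma lp_total (p ρ : ℝ) (hp : 1 ≤ p) (hρ : 1 < ρ) : ∃ K : ℝ, 0 < K ∧ ∀ M : ℕ, 0 < M →
    ∃ N : ℕ, 0 < N ∧ ∀ I : ℕ → ℕ, StrictMono I →
    ∑ k ∈ Finset.range N, ∑ u ∈ Finset.range (2^N), oscInf ρ I (gfun M k u) ^ p
      ≤ ENNReal.ofReal K * ((N * 2^N : ℕ) : ℝ≥0∞) := by
  obtain ⟨C, hC0, hC⟩ := geom_bound ρ hρ
  set q : ℝ := 1/ρ * p with hq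
  have hq0 : 0 < q := by positivity
  refine ⟨3^q + 1, by positivity, fun M hM => ?_⟩
  obtain ⟨N, hN⟩ := exists_nat_ge (((M:ℝ)+2)^q * (C * (2 * M)))
  have hN0 : 0 < N := by
    have : 0 < ((M:ℝ)+2)^q * (C * (2 * M)) := by positivity
    exact_mod_cast this.trans_le hN
  refine ⟨N, hN0, fun I hI => ?_⟩
  have pt : ∀ k u, oscInf ρ I (gfun M k u) ^ p ≤
      ENNReal.ofReal (3^q) + ENNReal.ofReal (((M:ℝ)+2)^q) * ∑' j, Qterm ρ I M k u j := by
    intro k u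
    unfold oscInf
    rw [← ENNReal.rpow_mul, ← hq]
    set Q := ∑' j, Qterm ρ I M k u j with hQ
    have hb := osc_bound ρ hρ I hI M k u
    have hQM : Q ≤ M := Q_le ρ hρ I hI M k u
    refine (ENNReal.rpow_le_rpow hb hq0.le).trans ?_
    rw [← hQ]
    rcases le_total Q 1 with h | h
    · refine le_trans ?_ le_self_add
      rw [← ENNReal.ofReal_rpow_of_nonneg (by norm_num) hq0.le]
      gcongr
      calc 2 + Q ≤ 2 + 1 := by gcongr
        _ = _ := by norm_num
    · refine le_trans ?_ le_add_self
      rw [← ENNReal.ofReal_rpow_of_nonneg (by positivity) hq0.le]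
      calc (2+Q)^q ≤ ENNReal.ofReal ((M:ℝ)+2)^q * 1 := by
            rw [mul_one]
            gcongr
            rw [ENNReal.ofReal_add (by positivity) (by norm_num), add_comm]
            simpa using hQM
        _ ≤ _ := by gcongr
  calc _ ≤ ∑ k ∈ Finset.range N, ∑ u ∈ Finset.range (2^N), (ENNReal.ofReal (3^q) +
        ENNReal.ofReal (((M:ℝ)+2)^q) * ∑' j, Qterm ρ I M k u j) :=
        Finset.sum_le_sum fun k _ => Finset.sum_le_sum fun u _ => pt k u
    _ = ENNReal.ofReal (3^q) * ((N * 2^N : ℕ) : ℝ≥0∞) + ENNReal.ofReal (((M:ℝ)+2)^q) *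
        ∑ k ∈ Finset.range N, ∑ u ∈ Finset.range (2^N), ∑' j, Qterm ρ I M k u j := by
        simp only [Finset.sum_add_distrib, Finset.mul_sum]
        simp
        ring
    _ ≤ ENNReal.ofReal (3^q) * ((N * 2^N : ℕ) : ℝ≥0∞) + ENNReal.ofReal (((M:ℝ)+2)^q) *
        (ENNReal.ofReal C * ((2 * M * 2^N : ℕ) : ℝ≥0∞)) := by
        gcongr
        exact Q_total ρ C hC0 hC I hI M N hM
    _ ≤ ENNReal.ofReal (3^q) * ((N * 2^N : ℕ) : ℝ≥0∞) + ((N * 2^N : ℕ) : ℝ≥0∞) := by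
        gcongr
        rw [← ENNReal.ofReal_natCast, ← ENNReal.ofReal_natCast, ← ENNReal.ofReal_mul hC0.le,
          ← ENNReal.ofReal_mul (by positivity)]
        apply ENNReal.ofReal_le_ofReal
        push_cast
        have : (0:ℝ) < 2^N := by positivity
        nlinarith
    _ = _ := by
        rw [ENNReal.ofReal_add (by positivity) (by norm_num), add_mul]; simp

lemma var_lower (r : ℝ) (hr : 0 < r) (m k u : ℕ) (hm : 0 < m) :
    ENNReal.ofReal ((m:ℝ)^(1/r)) ≤ varSeminorm r (gfun (m+1) k u) := by
  unfold varSeminorm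
  have hpk : 0 < 2^k := by positivity
  set s := blk (m+1) k u with hs
  refine le_iSup_of_le m (le_iSup_of_le hm (le_iSup_of_le (fun j => s + j * 2^k)
    (le_iSup_of_le ?_ ?_)))
  · intro a _ b _ hab
    have : a * 2^k < b * 2^k := Nat.mul_lt_mul_of_pos_right hab hpk
    show s + a * 2^k < s + b * 2^k
    omega
  · rw [← ENNReal.ofReal_rpow_of_nonneg (by positivity) (by positivity)]
    gcongr
    have val : ∀ j ≤ m, gfun (m+1) k u (s + j * 2^k) =
        tri ((((m+1) * (u/2^k) + j : ℕ)) : ℝ) := by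
      intro j hj
      unfold gfun
      have : j * 2^k < (m+1) * 2^k := Nat.mul_lt_mul_of_pos_right (by omega) hpk
      rw [if_pos (by constructor <;> omega), hs]
      congr 1
      unfold blk
      have : ((m+1) * 2^k * (u/2^k) + j * 2^k : ℕ) = ((m+1) * (u/2^k) + j) * 2^k := by ring
      rw [this]
      rw [Nat.cast_mul, Nat.cast_pow, Nat.cast_ofNat]
      field_simp
    have : ∀ j ∈ Finset.range m, ENNReal.ofReal |gfun (m+1) k u (s + (j+1) * 2^k) -
        gfun (m+1) k u (s + j * 2^k)| ^ r = 1 := by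
      intro j hj
      have hj := Finset.mem_range.1 hj
      rw [val j hj.le, val (j+1) hj, ← add_assoc, Nat.cast_add_one, tri_step]
      simp
    rw [Finset.sum_congr rfl this]
    simp

lemma osc_zero (ρ : ℝ) (hρ : 1 < ρ) (I : ℕ → ℕ) : oscInf ρ I 0 = 0 := by
  have h : 0 < ρ := by linarith
  simp [oscInf, h]

/-- Variational estimates cannot be dominated by oscillation estimates uniformly
(Theorem 1.2, inequality (1.8), of Mirek–Słomian–Szarek). -/
theorem stmt5 (p ρ r : ℝ) (hp : 1 ≤ p) (hρ : 1 < ρ) (hρr : ρ ≤ r) :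
    ¬ ∃ C : ℝ, 0 < C ∧ ∀ f : ℤ → ℕ → ℝ,
      weakLpZ p (fun x => varSeminorm r (f x))
      ≤ ENNReal.ofReal C *
        ⨆ (I : ℕ → ℕ) (_ : StrictMono I), lpZ p (fun x => oscInf ρ I (f x)) := by
  rintro ⟨C, hC, H⟩
  have hr : 0 < r := by linarith
  have hp0 : 0 < p := by linarith
  obtain ⟨K, hK0, hK⟩ := lp_total p ρ hp hρ
  obtain ⟨m, hm⟩ : ∃ m : ℕ, 2 * (C * K^(1/p)) < (m:ℝ)^(1/r) := by
    have := (tendsto_rpow_atTop (by positivity : 0 < 1/r)).comp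
      (tendsto_natCast_atTop_atTop (R := ℝ))
    exact (this.eventually_gt_atTop _).exists
  have hpos : 0 < (m:ℝ)^(1/r) := lt_trans (by positivity) hm
  have hm0 : 0 < m := by
    rcases Nat.eq_zero_or_pos m with h | h
    · subst h
      rw [Nat.cast_zero, Real.zero_rpow (by positivity)] at hpos
      exact absurd hpos (lt_irrefl _)
    · exact h
  obtain ⟨N, hN0, hN⟩ := hK (m+1) (by omega)
  let ι := Fin N × Fin (2^N)
  let emb : ι → ℤ := fun i => ((Fintype.equivFin ι i : ℕ) : ℤ)
  have hemb : Function.Injective emb := by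
    intro a b hab
    apply (Fintype.equivFin ι).injective
    apply Fin.ext
    exact Int.ofNat.inj hab
  let G : ι → ℕ → ℝ := fun i => gfun (m+1) i.1 i.2
  let f : ℤ → ℕ → ℝ := Function.extend emb G 0
  have hfG : ∀ i, f (emb i) = G i := fun i => hemb.extend_apply G 0 i
  have hf0 : ∀ x, x ∉ Set.range emb → f x = 0 := fun x hx => by
    show Function.extend emb G 0 x = 0
    rw [Function.extend_apply' _ _ _ (by simpa using hx)]; rfl
  have hcard : Fintype.card ι = N * 2^N := by simp [ι]
  set D : ℝ≥0∞ := ((N * 2^N : ℕ) : ℝ≥0∞) with hD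
  have hD0 : D ≠ 0 := by
    rw [hD, Nat.cast_ne_zero]; positivity
  have hDt : D ≠ ∞ := ENNReal.natCast_ne_top _
  have lower : ENNReal.ofReal ((m:ℝ)^(1/r)/2) * D^(1/p) ≤
      weakLpZ p (fun x => varSeminorm r (f x)) := by
    unfold weakLpZ
    refine le_iSup_of_le ((m:ℝ)^(1/r)/2) (le_iSup_of_le (by positivity) ?_)
    gcongr
    have hsub : ((Finset.univ.image emb : Finset ℤ) : Set ℤ) ⊆
        {x : ℤ | ENNReal.ofReal ((m:ℝ)^(1/r)/2) < varSeminorm r (f x)} := by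
      intro x hx
      simp only [Finset.coe_image, Finset.coe_univ, Set.image_univ, Set.mem_range] at hx
      obtain ⟨i, rfl⟩ := hx
      show _ < varSeminorm r (f (emb i))
      rw [hfG]
      refine lt_of_lt_of_le ?_ (var_lower r hr m i.1 i.2 hm0)
      rw [ENNReal.ofReal_lt_ofReal_iff hpos]
      linarith
    refine le_trans ?_ (measure_mono hsub)
    rw [Measure.count_apply_finset, Finset.card_image_of_injective _ hemb, Finset.card_univ, hcard]
  have upper : (⨆ (I : ℕ → ℕ) (_ : StrictMono I), lpZ p (fun x => oscInf ρ I (f x))) ≤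
      ENNReal.ofReal (K^(1/p)) * D^(1/p) := by
    refine iSup₂_le fun I hI => ?_
    unfold lpZ
    rw [← ENNReal.ofReal_rpow_of_nonneg hK0.le (by positivity),
      ← ENNReal.mul_rpow_of_nonneg _ _ (by positivity)]
    gcongr
    refine le_trans (le_of_eq ?_) (hN I hI)
    have hsupp : Function.support (fun x => oscInf ρ I (f x) ^ p) ⊆ Set.range emb := by
      intro x hx
      by_contra h
      apply hx
      show oscInf ρ I (f x) ^ p = 0
      rw [hf0 x h, osc_zero ρ hρ, ENNReal.zero_rpow_of_pos hp0]
    rw [← hemb.tsum_eq hsupp, tsum_fintype]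
    simp only [hfG]
    rw [Fintype.sum_prod_type, Finset.sum_range]
    refine Finset.sum_congr rfl fun k _ => ?_
    rw [Finset.sum_range]
  have := lower.trans ((H f).trans (mul_le_mul_right upper _))
  rw [← mul_assoc, ← ENNReal.ofReal_mul hC.le] at this
  rw [ENNReal.mul_le_mul_iff_left (by simp [hD0, hDt]) (by simp [hD0, hDt]),
    ENNReal.ofReal_le_ofReal_iff (by positivity)] at this
  linarith
end

section
/- Let 1 ≤ p < ∞ and 1 < ρ ≤ r < ∞ be fixed. There is NO constant C > 0 such that the estimate ‖V^r(f(·,t) : t ∈ ℕ)‖_{ℓ^{p,∞}(ℤ)} ≤ C · sup_{I ∈ 𝔖_∞(ℕ)} sup_{λ > 0} ‖λ · N_{λ,I}(f(·,t) : t ∈ ℕ)^{1/ρ}‖_{ℓ^p(ℤ)} holds uniformly for all measurable functions f : ℤ × ℕ → ℝ. -/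
open MeasureTheory ENNReal

def cutAt (I : ℕ → ℕ) (D a : ℕ) : Prop := ∃ n, a * D < I n ∧ I n < (a + 1) * D

def goodAt (I : ℕ → ℕ) (B s a : ℕ) : Prop :=
  cutAt I (B ^ (s+1)) a ∧ ∃ b, b / B = a ∧ ¬ cutAt I (B ^ s) b

open Classical in
lemma good_step (I : ℕ → ℕ) (B M s : ℕ) (hB : 0 < B) (hs : s < M) :
    ((Finset.range (B^M)).filter (fun u => goodAt I B s (u / B^(s+1)))).card
      + B * ((Finset.range (B^M)).filter (fun u => cutAt I (B^s) (u / B^s))).card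
      ≤ B * ((Finset.range (B^M)).filter (fun u => cutAt I (B^(s+1)) (u / B^(s+1)))).card := by
  have hBs : 0 < B ^ s := pow_pos hB s
  set G := (Finset.range (B^M)).filter (fun u => goodAt I B s (u / B^(s+1))) with hG
  set P := (Finset.range (B^M)).filter (fun u => cutAt I (B^s) (u / B^s)) with hP
  set Q := (Finset.range (B^M)).filter (fun u => cutAt I (B^(s+1)) (u / B^(s+1))) with hQ
  have hdiv : ∀ u, u / B^(s+1) = u / B^s / B := by
    intro u; rw [Nat.div_div_eq_div_mul, pow_succ]
  have hsub : P ⊆ Q := by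
    intro u hu
    simp only [hP, hQ, Finset.mem_filter] at hu ⊢
    refine ⟨hu.1, ?_⟩
    obtain ⟨n, h1, h2⟩ := hu.2
    rw [hdiv]
    refine ⟨n, lt_of_le_of_lt ?_ h1, lt_of_lt_of_le h2 ?_⟩
    · calc u / B^s / B * B^(s+1) = (u / B^s / B * B) * B^s := by ring
        _ ≤ _ := Nat.mul_le_mul_right _ (Nat.div_mul_le_self _ _)
    · calc (u / B^s + 1) * B^s ≤ ((u / B^s / B + 1) * B) * B^s := by
            apply Nat.mul_le_mul_right
            have := Nat.lt_div_mul_add (a := u / B^s) hB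
            nlinarith
        _ = _ := by ring
  have hPQ : P.card + (Q \ P).card = Q.card := by
    have := Finset.card_sdiff_add_card_eq_card hsub
    omega
  have hch : ∀ a, ∃ b, goodAt I B s a → (b / B = a ∧ ¬ cutAt I (B ^ s) b) := by
    intro a
    by_cases h : goodAt I B s a
    · obtain ⟨b, hb⟩ := h.2
      exact ⟨b, fun _ => hb⟩
    · exact ⟨0, fun h' => absurd h' h⟩
  choose β hβ using hch
  have hG' : G.card ≤ (Finset.range B ×ˢ (Q \ P)).card := by
    apply Finset.card_le_card_of_injOn
      (fun u => ((u / B^s) % B, β (u / B^(s+1)) * B^s + u % B^s))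
    · intro u hu
      have hu' : u ∈ G := hu
      simp only [hG, Finset.mem_filter, Finset.mem_range] at hu'
      obtain ⟨hu1, hu2⟩ := hu'
      obtain ⟨hb1, hb2⟩ := hβ _ hu2
      have e1 : (β (u / B^(s+1)) * B^s + u % B^s) / B^s = β (u / B^(s+1)) := by
        rw [mul_comm, Nat.mul_add_div hBs, Nat.div_eq_of_lt (Nat.mod_lt _ hBs)]; simp
      have e2 : (β (u / B^(s+1)) * B^s + u % B^s) / B^(s+1) = u / B^(s+1) := by
        rw [hdiv, e1, hb1]
      have e3 : β (u / B^(s+1)) * B^s + u % B^s < B^M := by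
        have hM : B^M = B^(M-(s+1)) * B^(s+1) := by rw [← pow_add]; congr 1; omega
        rw [hM] at hu1 ⊢
        rw [← Nat.div_lt_iff_lt_mul (pow_pos hB _)] at hu1 ⊢
        rwa [e2]
      have hmem : β (u / B^(s+1)) * B^s + u % B^s ∈ Q \ P := by
        simp only [hQ, hP, Finset.mem_sdiff, Finset.mem_filter, Finset.mem_range]
        refine ⟨⟨e3, ?_⟩, ?_⟩
        · rw [e2]; exact hu2.1
        · rintro ⟨-, h⟩
          rw [e1] at h
          exact hb2 h
      simp only [Finset.coe_product, Set.mem_prod, Finset.mem_coe, Finset.mem_range]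
      exact ⟨Nat.mod_lt _ hB, hmem⟩
    · intro u hu v hv huv
      have hu' : u ∈ G := hu
      have hv' : v ∈ G := hv
      simp only [hG, Finset.mem_filter, Finset.mem_range] at hu' hv'
      simp only [Prod.mk.injEq] at huv
      obtain ⟨h1, h2⟩ := huv
      have e1 : ∀ u, (β (u / B^(s+1)) * B^s + u % B^s) / B^s = β (u / B^(s+1)) := by
        intro u
        rw [mul_comm, Nat.mul_add_div hBs, Nat.div_eq_of_lt (Nat.mod_lt _ hBs)]; simp
      have e2 : ∀ u, (β (u / B^(s+1)) * B^s + u % B^s) % B^s = u % B^s := by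
        intro u
        rw [mul_comm, Nat.mul_add_mod, Nat.mod_mod]
      have h3 : β (u / B^(s+1)) = β (v / B^(s+1)) := by rw [← e1 u, h2, e1 v]
      have h4 : u % B^s = v % B^s := by rw [← e2 u, h2, e2 v]
      have h5 : u / B^(s+1) = v / B^(s+1) := by
        rw [← (hβ _ hu'.2).1, h3, (hβ _ hv'.2).1]
      rw [hdiv, hdiv] at h5
      have h6 : u / B^s = v / B^s := by
        rw [← Nat.div_add_mod (u / B^s) B, ← Nat.div_add_mod (v / B^s) B, h5, h1]
      rw [← Nat.div_add_mod u (B^s), ← Nat.div_add_mod v (B^s), h6, h4]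
  rw [Finset.card_product, Finset.card_range] at hG'
  rw [← hPQ]
  nlinarith

open Classical in
lemma good_sum (I : ℕ → ℕ) (B M : ℕ) (hB : 0 < B) :
    ∑ s ∈ Finset.range M,
      ((Finset.range (B^M)).filter (fun u => goodAt I B s (u / B^(s+1)))).card ≤ B * B^M := by
  have key : ∀ m ≤ M, ∑ s ∈ Finset.range m,
      ((Finset.range (B^M)).filter (fun u => goodAt I B s (u / B^(s+1)))).card
      ≤ B * ((Finset.range (B^M)).filter (fun u => cutAt I (B^m) (u / B^m))).card := by
    intro m
    induction m with
    | zero => intro _; simp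
    | succ m ih =>
      intro hm
      rw [Finset.sum_range_succ]
      have h1 := ih (by omega)
      have h2 := good_step I B M m hB (by omega)
      omega
  refine (key M le_rfl).trans (Nat.mul_le_mul_left _ ?_)
  exact (Finset.card_filter_le _ _).trans (by simp)

/-- clamp -/
noncomputable def cl (D a : ℕ) (t : ℕ) : ℝ := max 0 (min 1 (((t : ℝ) - a * D) / D))

lemma cl_mono (D a : ℕ) : Monotone (cl D a) := by
  intro s t h
  unfold cl
  have : (s : ℝ) ≤ t := by exact_mod_cast h
  gcongr

lemma cl_nonneg (D a t : ℕ) : 0 ≤ cl D a t := le_max_left _ _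
lemma cl_le_one (D a t : ℕ) : cl D a t ≤ 1 := max_le zero_le_one (min_le_left _ _)

noncomputable def wav (δ : ℝ) (L D a : ℕ) (t : ℕ) : ℝ := δ * Real.cos (Real.pi * L * cl D a t)

lemma wav_lip (δ : ℝ) (hδ : 0 ≤ δ) (L D a s t : ℕ) (h : s ≤ t) :
    |wav δ L D a t - wav δ L D a s| ≤ δ * Real.pi * L * (cl D a t - cl D a s) := by
  have h1 : |Real.cos (Real.pi * L * cl D a t) - Real.cos (Real.pi * L * cl D a s)|
      ≤ |Real.pi * L * cl D a t - Real.pi * L * cl D a s| := by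
    have := Real.lipschitzWith_cos.dist_le_mul (Real.pi * L * cl D a t) (Real.pi * L * cl D a s)
    simpa [Real.dist_eq] using this
  have h2 := cl_mono D a h
  have h3 : |Real.pi * L * cl D a t - Real.pi * L * cl D a s|
      = Real.pi * L * (cl D a t - cl D a s) := by
    rw [← mul_sub, abs_of_nonneg]
    have := sub_nonneg.2 h2
    positivity
  unfold wav
  rw [← mul_sub, abs_mul, abs_of_nonneg hδ]
  rw [h3] at h1
  have := mul_le_mul_of_nonneg_left h1 hδ
  linarith

lemma wav_bdd (δ : ℝ) (hδ : 0 ≤ δ) (L D a s t : ℕ) :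
    |wav δ L D a t - wav δ L D a s| ≤ 2 * δ := by
  unfold wav
  rw [← mul_sub, abs_mul, abs_of_nonneg hδ, mul_comm]
  gcongr
  rw [abs_le]
  constructor <;> linarith [Real.cos_le_one (Real.pi * L * cl D a t),
    Real.neg_one_le_cos (Real.pi * L * cl D a t), Real.cos_le_one (Real.pi * L * cl D a s),
    Real.neg_one_le_cos (Real.pi * L * cl D a s)]

lemma caught (δ : ℝ) (hδ : 0 ≤ δ) (L D a : ℕ) (I : ℕ → ℕ) (lam : ℝ) (k : ℕ)
    (h : ENNReal.ofReal lam ≤ ⨆ t ∈ Set.Ico (I k) (I (k+1)),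
      ENNReal.ofReal |wav δ L D a t - wav δ L D a (I k)|) (hI : StrictMono I) :
    lam ≤ δ * Real.pi * L * (cl D a (I (k+1)) - cl D a (I k)) := by
  have h0 : 0 ≤ δ * Real.pi * L * (cl D a (I (k+1)) - cl D a (I k)) := by
    have := sub_nonneg.2 (cl_mono D a (hI (Nat.lt_succ_self k)).le)
    simp only [Nat.succ_eq_add_one] at this
    have := Real.pi_pos
    positivity
  rw [← ENNReal.ofReal_le_ofReal_iff h0]
  refine h.trans (iSup₂_le fun t ht => ENNReal.ofReal_le_ofReal ?_)
  refine (wav_lip δ hδ L D a _ t ht.1).trans ?_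
  have := cl_mono D a ht.2.le
  gcongr

lemma caught_zero (δ : ℝ) (hδ : 0 ≤ δ) (L D a : ℕ) (I : ℕ → ℕ) (lam : ℝ) (hl : 2 * δ < lam) :
    seqJumpCount lam I (wav δ L D a) = 0 := by
  unfold seqJumpCount
  convert measure_empty (μ := Measure.count)
  rw [Set.eq_empty_iff_forall_notMem]
  intro k hk
  have : ENNReal.ofReal lam ≤ ENNReal.ofReal (2 * δ) :=
    le_trans hk (iSup₂_le fun t _ => ENNReal.ofReal_le_ofReal (wav_bdd δ hδ L D a _ _))
  rw [ENNReal.ofReal_le_ofReal_iff (by positivity)] at this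
  linarith

lemma count_bound (δ : ℝ) (hδ : 0 ≤ δ) (L D a : ℕ) (I : ℕ → ℕ) (hI : StrictMono I)
    (lam : ℝ) (hl : 0 < lam) :
    seqJumpCount lam I (wav δ L D a) ≤ ENNReal.ofReal (δ * Real.pi * L / lam) := by
  unfold seqJumpCount
  set S := {k : ℕ | ENNReal.ofReal lam ≤ ⨆ t ∈ Set.Ico (I k) (I (k+1)),
      ENNReal.ofReal |wav δ L D a t - wav δ L D a (I k)|} with hS
  set Λ := δ * Real.pi * L with hΛ
  have hΛ0 : 0 ≤ Λ := by have := Real.pi_pos; positivity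
  have e : Measure.count S = ∑' k, S.indicator (1 : ℕ → ℝ≥0∞) k := by
    rw [← lintegral_count, lintegral_indicator_one (MeasurableSet.of_discrete)]
  rw [e, ENNReal.tsum_eq_iSup_nat]
  refine iSup_le fun n => ?_
  have hk : ∀ k, S.indicator (1 : ℕ → ℝ≥0∞) k
      ≤ ENNReal.ofReal (Λ / lam * (cl D a (I (k+1)) - cl D a (I k))) := by
    intro k
    by_cases hk : k ∈ S
    · rw [Set.indicator_of_mem hk]
      have := caught δ hδ L D a I lam k hk hI
      simp only [Pi.one_apply]
      rw [ENNReal.one_le_ofReal, div_mul_eq_mul_div, le_div_iff₀ hl]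
      linarith
    · rw [Set.indicator_of_notMem hk]; exact zero_le
  refine (Finset.sum_le_sum fun k _ => hk k).trans ?_
  rw [← ENNReal.ofReal_sum_of_nonneg]
  · apply ENNReal.ofReal_le_ofReal
    rw [← Finset.mul_sum, Finset.sum_range_sub (fun k => cl D a (I k))]
    have h1 := cl_le_one D a (I n)
    have h2 := cl_nonneg D a (I 0)
    have : 0 ≤ Λ / lam := by positivity
    nlinarith
  · intro k _
    have := sub_nonneg.2 (cl_mono D a (hI (Nat.lt_succ_self k)).le)
    simp only [Nat.succ_eq_add_one] at this
    positivity

lemma good_of_count (δ : ℝ) (hδ : 0 < δ) (L B s a : ℕ) (hL : 0 < L) (hB : 0 < B)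
    (I : ℕ → ℕ) (hI : StrictMono I)
    (lam lam0 : ℝ) (hl0 : 0 < lam0) (hl : lam0 ≤ lam)
    (hBig : 2 * (δ * Real.pi * L) ≤ lam0 * B)
    (h : ¬ seqJumpCount lam I (wav δ L (B^(s+1)) a) ≤ 1) : goodAt I B s a := by
  unfold seqJumpCount at h
  rw [Measure.count_apply MeasurableSet.of_discrete] at h
  have h' := not_le.1 h
  have h'' : 1 < Set.encard {k : ℕ | ENNReal.ofReal lam ≤ ⨆ t ∈ Set.Ico (I k) (I (k+1)),
      ENNReal.ofReal |wav δ L (B^(s+1)) a t - wav δ L (B^(s+1)) a (I k)|} := by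
    exact_mod_cast h'
  rw [Set.one_lt_encard_iff] at h''
  have hD : 0 < B^(s+1) := pow_pos hB _
  have hDr : (0:ℝ) < (B:ℝ)^(s+1) := by exact_mod_cast hD
  have hBr : (0:ℝ) < B := by exact_mod_cast hB
  have hΛ : 0 < δ * Real.pi * L := by
    have := Real.pi_pos
    have : (0:ℝ) < L := by exact_mod_cast hL
    positivity
  set Λ := δ * Real.pi * L with hΛd
  set c := cl (B^(s+1)) a with hc
  obtain ⟨k1, k2, hlt, hk1, hk2⟩ : ∃ k1 k2, k1 < k2 ∧
      lam ≤ Λ * (c (I (k1+1)) - c (I k1)) ∧ lam ≤ Λ * (c (I (k2+1)) - c (I k2)) := by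
    obtain ⟨x, y, hx, hy, hxy⟩ := h''
    have hx := caught δ hδ.le L _ a I lam x hx hI
    have hy := caught δ hδ.le L _ a I lam y hy hI
    rcases lt_or_gt_of_ne hxy with h | h
    · exact ⟨x, y, h, hx, hy⟩
    · exact ⟨y, x, h, hy, hx⟩
  have hp1 : 0 < c (I (k1+1)) - c (I k1) := by
    by_contra hh; nlinarith
  have hp2 : 0 < c (I (k2+1)) - c (I k2) := by
    by_contra hh; nlinarith
  have hm : c (I (k1+1)) ≤ c (I k2) := cl_mono _ _ (hI.monotone hlt)
  have hc0 : 0 < c (I k2) := by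
    have := cl_nonneg (B^(s+1)) a (I k1)
    simp only [← hc] at this
    linarith
  have hc1 : c (I k2) < 1 := by
    have := cl_le_one (B^(s+1)) a (I (k2+1))
    simp only [← hc] at this
    linarith
  have hA : a * B^(s+1) < I k2 := by
    by_contra hh
    have hh' : (I k2 : ℝ) ≤ a * B^(s+1) := by exact_mod_cast not_lt.1 hh
    have : c (I k2) ≤ 0 := by
      simp only [hc, cl]
      refine max_le le_rfl ((min_le_right _ _).trans ?_)
      apply div_nonpos_of_nonpos_of_nonneg
      · push_cast; linarith
      · positivity
    linarith
  have hA2 : I k2 < (a + 1) * B^(s+1) := by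
    by_contra hh
    have hh' : ((a:ℝ) + 1) * B^(s+1) ≤ I k2 := by exact_mod_cast not_lt.1 hh
    have : 1 ≤ c (I k2) := by
      simp only [hc, cl]
      refine le_max_of_le_right (le_min le_rfl ?_)
      rw [le_div_iff₀ (by exact_mod_cast hD)]
      push_cast; linarith
    linarith
  refine ⟨⟨k2, hA, hA2⟩, ?_⟩
  -- the long gap
  set q := min (I (k2+1)) ((a+1) * B^(s+1)) with hq
  have hgap : I k2 + 2 * B^s ≤ q := by
    have h1 : c (I k2) = ((I k2 : ℝ) - a * B^(s+1)) / B^(s+1) := by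
      simp only [hc, cl] at hc0 hc1 ⊢
      push_cast at hc0 hc1 ⊢
      rcases lt_max_iff.1 hc0 with h | h
      · exact absurd h (lt_irrefl _)
      rw [max_eq_right h.le] at hc1 ⊢
      rcases min_lt_iff.1 hc1 with h2 | h2
      · exact absurd h2 (lt_irrefl _)
      rw [min_eq_right h2.le]
    have h2 : c (I (k2+1)) ≤ ((q : ℝ) - a * B^(s+1)) / B^(s+1) := by
      have hIk : I k2 < I (k2+1) := hI (Nat.lt_succ_self _)
      simp only [hc, cl, hq]
      push_cast
      apply max_le
      · apply div_nonneg _ hDr.le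
        rw [sub_nonneg]
        apply le_min
        · exact_mod_cast (hA.trans hIk).le
        · nlinarith
      · rcases le_total (I (k2+1) : ℝ) (((a:ℝ)+1) * B^(s+1)) with h | h
        · rw [min_eq_left h]; exact min_le_right _ _
        · rw [min_eq_right h]
          refine (min_le_left _ _).trans ?_
          rw [le_div_iff₀ hDr]; linarith
    have h3 : 2 / (B:ℝ) ≤ c (I (k2+1)) - c (I k2) := by
      rw [div_le_iff₀ hBr]
      have : 2 * Λ ≤ Λ * (c (I (k2+1)) - c (I k2)) * B := by nlinarith
      nlinarith
    have h4 : 2 / (B:ℝ) ≤ ((q:ℝ) - I k2) / B^(s+1) := by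
      calc 2 / (B:ℝ) ≤ c (I (k2+1)) - c (I k2) := h3
        _ ≤ ((q : ℝ) - a * B^(s+1)) / B^(s+1) - ((I k2 : ℝ) - a * B^(s+1)) / B^(s+1) := by
            rw [← h1]; linarith
        _ = _ := by ring
    rw [div_le_div_iff₀ hBr hDr, pow_succ] at h4
    have h5 : (2:ℝ) * B^s ≤ q - I k2 := by nlinarith
    have h6 : (I k2 : ℝ) + 2 * B^s ≤ q := by linarith
    exact_mod_cast h6
  have hBs : 0 < B^s := pow_pos hB s
  have hq1 : q ≤ I (k2+1) := min_le_left _ _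
  have hq2 : q ≤ (a+1) * B^(s+1) := min_le_right _ _
  have hdm := Nat.div_add_mod (I k2) (B^s)
  have hml := Nat.mod_lt (I k2) hBs
  have hup1 : (I k2 / B^s + 1) * B^s ≤ I k2 + B^s := by
    have : (I k2 / B^s + 1) * B^s = B^s * (I k2 / B^s) + B^s := by ring
    have := Nat.mul_div_le (I k2) (B^s)
    linarith
  have hup2 : (I k2 / B^s + 1 + 1) * B^s ≤ I k2 + 2 * B^s := by
    have : (I k2 / B^s + 1 + 1) * B^s = B^s * (I k2 / B^s) + 2 * B^s := by ring
    have := Nat.mul_div_le (I k2) (B^s)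
    linarith
  refine ⟨I k2 / B^s + 1, ?_, ?_⟩
  · rw [Nat.div_eq_iff hB]
    have e1 : a * B ≤ I k2 / B^s := by
      rw [Nat.le_div_iff_mul_le hBs]
      calc a * B * B^s = a * B^(s+1) := by ring
        _ ≤ _ := hA.le
    have e2 : I k2 / B^s + 1 < (a+1) * B := by
      by_contra hh
      have hh := not_lt.1 hh
      have := Nat.mul_le_mul_right (B^s) hh
      have e : (a+1) * B * B^s = (a+1) * B^(s+1) := by ring
      rw [e] at this
      omega
    constructor
    · omega
    · have : (a+1) * B = a * B + B := by ring
      omega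
  · rintro ⟨n, hn1, hn2⟩
    have g1 : I k2 < I n := by nlinarith
    have g2 : I n < I (k2+1) := by omega
    rw [hI.lt_iff_lt] at g1 g2
    omega

lemma var_lower_s6 (r : ℝ) (hr : 1 < r) (L b s a : ℕ) (hL : 0 < L) (hb : 0 < b) :
    ENNReal.ofReal 1 < varSeminorm r (wav ((L:ℝ) ^ (-(1/r))) L ((L*b)^(s+1)) a) := by
  set δ := (L:ℝ) ^ (-(1/r)) with hδ
  have hLr : (0:ℝ) < L := by exact_mod_cast hL
  have hδ0 : 0 < δ := Real.rpow_pos_of_pos hLr _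
  set D := (L*b)^(s+1) with hD
  have hD0 : 0 < D := by positivity
  set w := b * (L*b)^s with hw
  have hw0 : 0 < w := by positivity
  have hDw : D = L * w := by rw [hD, hw]; ring
  unfold varSeminorm
  have hm : StrictMono (fun j : ℕ => a * D + j * w) := by
    intro i j hij
    simp only
    nlinarith
  refine lt_of_lt_of_le ?_ (le_iSup₂_of_le L hL
    (le_iSup₂_of_le (fun j => a * D + j * w) (hm.strictMonoOn _) le_rfl))
  have hwr : (0:ℝ) < w := by exact_mod_cast hw0
  have hval : ∀ j ≤ L, wav δ L D a (a * D + j * w) = δ * (-1)^j := by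
    intro j hj
    have hjr : (j:ℝ) ≤ L := by exact_mod_cast hj
    have : cl D a (a * D + j * w) = j / L := by
      unfold cl
      have e : (((a * D + j * w : ℕ) : ℝ) - a * D) / D = j / L := by
        rw [hDw]; push_cast; field_simp; ring
      rw [e, min_eq_right ((div_le_one hLr).2 hjr), max_eq_right (by positivity)]
    unfold wav
    rw [this, ← Real.cos_nat_mul_pi]
    congr 2
    field_simp
  have hsum : ∀ j ∈ Finset.range L, ENNReal.ofReal |wav δ L D a (a * D + (j+1) * w)
      - wav δ L D a (a * D + j * w)| ^ r = ENNReal.ofReal ((2*δ)^r) := by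
    intro j hj
    have hj := Finset.mem_range.1 hj
    rw [hval (j+1) hj, hval j hj.le, ENNReal.ofReal_rpow_of_nonneg (abs_nonneg _) (by linarith)]
    congr 2
    have : δ * (-1)^(j+1) - δ * (-1)^j = (-1)^(j+1) * (2*δ) := by ring
    rw [this, abs_mul, abs_pow]
    simp [abs_of_pos hδ0]
  rw [Finset.sum_congr rfl hsum]
  have h2 : (2*δ)^r = 2^r / L := by
    rw [Real.mul_rpow (by norm_num) hδ0.le, hδ, ← Real.rpow_mul hLr.le]
    have : -(1/r) * r = -1 := by field_simp
    rw [this, Real.rpow_neg_one]; rfl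
  rw [h2, Finset.sum_const, Finset.card_range, nsmul_eq_mul, ← ENNReal.ofReal_natCast,
    ← ENNReal.ofReal_mul hLr.le, mul_div_cancel₀ _ hLr.ne',
    ENNReal.ofReal_rpow_of_nonneg (by positivity) (by positivity), ← Real.rpow_mul (by norm_num),
    mul_one_div_cancel (by linarith), Real.rpow_one]
  rw [ENNReal.ofReal_lt_ofReal_iff] <;> norm_num

lemma term_bound (p ρ lam l z : ℝ) (hp : 1 ≤ p) (hρ : 1 < ρ) (N : ℝ≥0∞)
    (hl0 : 0 < lam) (hl : lam ≤ l) (hz : 0 ≤ z) (hN : N ≤ ENNReal.ofReal z) :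
    (ENNReal.ofReal lam * N ^ (1/ρ)) ^ p ≤ ENNReal.ofReal ((l * z ^ (1/ρ)) ^ p) := by
  have hρ' : 0 ≤ 1/ρ := by positivity
  rw [← ENNReal.ofReal_rpow_of_nonneg (by have := Real.rpow_nonneg hz (1/ρ); nlinarith) (by linarith),
    ENNReal.ofReal_mul (by linarith), ← ENNReal.ofReal_rpow_of_nonneg hz hρ']
  gcongr

lemma consts (p ρ r C : ℝ) (hp : 1 ≤ p) (hρ : 1 < ρ) (hρr : ρ ≤ r) (hC : 0 < C) :
    ∃ (L b M : ℕ) (lam0 Y : ℝ), 0 < L ∧ 0 < b ∧ 0 < M ∧ 0 < lam0 ∧ 0 ≤ Y ∧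
      (2 * (L:ℝ) ^ (-(1/r))) ^ p ≤ (1/(2*C)) ^ p / 2 ∧
      lam0 ^ (1 - 1/ρ) * ((L:ℝ) ^ (-(1/r)) * Real.pi * L) ^ (1/ρ) ≤ 1/(2*C) ∧
      2 * ((L:ℝ) ^ (-(1/r)) * Real.pi * L) ≤ lam0 * (L * b : ℕ) ∧
      Y = (2 * (L:ℝ) ^ (-(1/r)) * (((L:ℝ) ^ (-(1/r)) * Real.pi * L) / lam0) ^ (1/ρ)) ^ p ∧
      Y * (L * b : ℕ) ≤ (1/(2*C)) ^ p / 2 * M := by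
  set e := 1/(2*C) with he
  have he0 : 0 < e := by positivity
  have hr : 0 < 1/r := by have : 0 < r := by linarith
                          positivity
  have ht : Filter.Tendsto (fun L : ℕ => (L:ℝ) ^ (-(1/r))) Filter.atTop (nhds 0) :=
    (tendsto_rpow_neg_atTop hr).comp tendsto_natCast_atTop_atTop
  obtain ⟨L, hL1, hL2⟩ := ((ht.eventually_lt_const (show (0:ℝ) < e/4 by positivity)).and
    (Filter.eventually_gt_atTop 0)).exists
  have hLr : (0:ℝ) < L := by exact_mod_cast hL2
  set δ := (L:ℝ) ^ (-(1/r)) with hδ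
  have hδ0 : 0 < δ := Real.rpow_pos_of_pos hLr _
  set Λ := δ * Real.pi * L with hΛ
  have hΛ0 : 0 < Λ := by have := Real.pi_pos; positivity
  have hκ : 0 < 1 - 1/ρ := by
    rw [sub_pos, div_lt_one (by linarith)]; exact hρ
  set q := e / Λ ^ (1/ρ) with hq
  have hΛp : 0 < Λ ^ (1/ρ) := Real.rpow_pos_of_pos hΛ0 _
  have hq0 : 0 < q := by positivity
  set lam0 := q ^ (1/(1-1/ρ)) with hlam
  have hlam0 : 0 < lam0 := Real.rpow_pos_of_pos hq0 _
  obtain ⟨b, hb⟩ := exists_nat_ge (2 * Λ / lam0)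
  set Y := (2 * δ * (Λ / lam0) ^ (1/ρ)) ^ p with hY
  have hY0 : 0 ≤ Y := by positivity
  have hep : 0 < e ^ p := Real.rpow_pos_of_pos he0 _
  obtain ⟨M, hM⟩ := exists_nat_ge (Y * (L * (b+1) : ℕ) / (e ^ p / 2))
  refine ⟨L, b+1, M+1, lam0, Y, hL2, by omega, by omega, hlam0, hY0, ?_, ?_, ?_, rfl, ?_⟩
  · have h1 : (2 * δ) ^ p ≤ (e/2) ^ p :=
      Real.rpow_le_rpow (by positivity) (by linarith) (by linarith)
    refine h1.trans ?_
    rw [Real.div_rpow he0.le (by norm_num)]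
    have : (2:ℝ) ≤ 2 ^ p := by
      calc (2:ℝ) = 2 ^ (1:ℝ) := by simp
        _ ≤ _ := Real.rpow_le_rpow_of_exponent_le (by norm_num) hp
    gcongr
  · rw [hlam, ← Real.rpow_mul hq0.le, one_div_mul_cancel hκ.ne', Real.rpow_one, hq,
      div_mul_cancel₀ _ hΛp.ne']
  · rw [div_le_iff₀ hlam0] at hb
    push_cast
    have h1 : (1:ℝ) ≤ L := by exact_mod_cast hL2
    have hbn : (0:ℝ) ≤ b := by positivity
    calc 2 * Λ ≤ b * lam0 := hb
      _ ≤ lam0 * (L * (b+1)) := by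
        rw [mul_comm]; gcongr; nlinarith
  · rw [div_le_iff₀ (by positivity)] at hM
    refine hM.trans ?_
    push_cast
    nlinarith

lemma count_extend {ι : Type} [Fintype ι] (e : ι ↪ ℤ) (S : Set ℤ) (h : ∀ i, e i ∈ S) :
    (Fintype.card ι : ℝ≥0∞) ≤ Measure.count S := by
  classical
  have : ((Finset.univ.map e : Finset ℤ) : Set ℤ) ⊆ S := by
    intro x hx
    simp only [Finset.coe_map, Set.mem_image] at hx
    obtain ⟨i, -, rfl⟩ := hx
    exact h i
  refine le_trans ?_ (measure_mono this)
  rw [Measure.count_apply_finset]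
  simp

lemma tsum_extend {ι : Type} [Fintype ι] (e : ι ↪ ℤ) (F : ι → ℕ → ℝ) (G : (ℕ → ℝ) → ℝ≥0∞)
    (hG : G 0 = 0) :
    ∑' x : ℤ, G (Function.extend e F 0 x) = ∑ i, G (F i) := by
  have h1 : ∀ i, G (F i) = G (Function.extend e F 0 (e i)) := by
    intro i; rw [e.injective.extend_apply]
  rw [Finset.sum_congr rfl (fun i _ => h1 i), ← tsum_fintype (L := .unconditional _)]
  rw [e.injective.tsum_eq (f := fun x => G (Function.extend e F 0 x))]
  intro x hx
  by_contra hh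
  apply hx
  simp only
  rw [Function.extend_apply' _ _ _ (by simpa using hh)]
  exact hG

lemma seq_zero (lam : ℝ) (hl : 0 < lam) (I : ℕ → ℕ) : seqJumpCount lam I 0 = 0 := by
  unfold seqJumpCount
  convert measure_empty (μ := Measure.count)
  rw [Set.eq_empty_iff_forall_notMem]
  intro k hk
  simp at hk
  linarith

open Classical in
lemma main_sum (p ρ C δ lam0 Y : ℝ) (L B M : ℕ) (hp : 1 ≤ p) (hρ : 1 < ρ) (hC : 0 < C)
    (hδ : 0 < δ) (hL : 0 < L) (hB : 0 < B) (hM : 0 < M) (hl0 : 0 < lam0) (hY0 : 0 ≤ Y)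
    (h1 : (2 * δ) ^ p ≤ (1/(2*C)) ^ p / 2)
    (h2 : lam0 ^ (1 - 1/ρ) * (δ * Real.pi * L) ^ (1/ρ) ≤ 1/(2*C))
    (h3 : 2 * (δ * Real.pi * L) ≤ lam0 * B)
    (hY : Y = (2 * δ * ((δ * Real.pi * L) / lam0) ^ (1/ρ)) ^ p)
    (h4 : Y * B ≤ (1/(2*C)) ^ p / 2 * M)
    (I : ℕ → ℕ) (hI : StrictMono I) (lam : ℝ) (hl : 0 < lam) :
    ∑ s ∈ Finset.range M, ∑ u ∈ Finset.range (B^M),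
      (ENNReal.ofReal lam * seqJumpCount lam I (wav δ L (B^(s+1)) (u / B^(s+1))) ^ (1/ρ)) ^ p
      ≤ ENNReal.ofReal ((1/(2*C)) ^ p * (M * B^M)) := by
  set e := 1/(2*C) with he
  have he0 : 0 < e := by positivity
  have hep : 0 < e ^ p := Real.rpow_pos_of_pos he0 _
  set Λ := δ * Real.pi * L with hΛ
  have hΛ0 : 0 < Λ := by
    have := Real.pi_pos
    have : (0:ℝ) < L := by exact_mod_cast hL
    positivity
  have hκ : 0 < 1 - 1/ρ := by
    rw [sub_pos, div_lt_one (by linarith)]; exact hρ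
  have hBr : (0:ℝ) < B := by exact_mod_cast hB
  rcases lt_or_ge lam lam0 with hlt | hge
  · have hb : ∀ s u, (ENNReal.ofReal lam *
        seqJumpCount lam I (wav δ L (B^(s+1)) (u / B^(s+1))) ^ (1/ρ)) ^ p
        ≤ ENNReal.ofReal (e ^ p) := by
      intro s u
      refine (term_bound p ρ lam lam (Λ / lam) hp hρ _ hl le_rfl (by positivity)
        (count_bound δ hδ.le L _ _ I hI lam hl)).trans ?_
      apply ENNReal.ofReal_le_ofReal
      apply Real.rpow_le_rpow (by positivity) _ (by linarith)
      refine le_trans ?_ h2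
      have : lam * (Λ / lam) ^ (1/ρ) = lam ^ (1-1/ρ) * Λ ^ (1/ρ) := by
        rw [Real.div_rpow hΛ0.le hl.le, Real.rpow_sub hl, Real.rpow_one]
        ring
      rw [this]
      gcongr
    refine (Finset.sum_le_sum fun s _ => Finset.sum_le_sum fun u _ => hb s u).trans ?_
    simp only [Finset.sum_const, Finset.card_range, nsmul_eq_mul]
    rw [ENNReal.ofReal_mul hep.le, ENNReal.ofReal_mul (by positivity), ENNReal.ofReal_natCast]
    have : ENNReal.ofReal ((B:ℝ)^M) = ((B^M : ℕ) : ℝ≥0∞) := by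
      rw [← ENNReal.ofReal_natCast]; push_cast; rfl
    rw [this]
    apply le_of_eq; ring
  · have hb : ∀ s u, (ENNReal.ofReal lam *
        seqJumpCount lam I (wav δ L (B^(s+1)) (u / B^(s+1))) ^ (1/ρ)) ^ p
        ≤ ENNReal.ofReal (e ^ p / 2) +
          (if goodAt I B s (u / B^(s+1)) then 1 else 0) * ENNReal.ofReal Y := by
      intro s u
      rcases lt_or_ge (2*δ) lam with hbig | hsm
      · rw [caught_zero δ hδ.le _ _ _ _ _ hbig, ENNReal.zero_rpow_of_pos (by positivity), mul_zero,
          ENNReal.zero_rpow_of_pos (by linarith)]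
        exact zero_le
      · by_cases hg : goodAt I B s (u / B^(s+1))
        · rw [if_pos hg, one_mul]
          refine le_trans ?_ le_add_self
          rw [hY]
          refine term_bound p ρ lam (2*δ) (Λ / lam0) hp hρ _ hl hsm (by positivity) ?_
          refine (count_bound δ hδ.le L _ _ I hI lam hl).trans ?_
          apply ENNReal.ofReal_le_ofReal
          gcongr
        · refine le_trans ?_ le_self_add
          have hN : seqJumpCount lam I (wav δ L (B^(s+1)) (u / B^(s+1))) ≤ ENNReal.ofReal 1 := by
            rw [ENNReal.ofReal_one]
            by_contra hh
            exact hg (good_of_count δ hδ L B s _ hL hB I hI lam lam0 hl0 hge h3 hh)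
          refine (term_bound p ρ lam (2*δ) 1 hp hρ _ hl hsm (by positivity) hN).trans ?_
          apply ENNReal.ofReal_le_ofReal
          rw [Real.one_rpow, mul_one]
          exact h1
    refine (Finset.sum_le_sum fun s _ => Finset.sum_le_sum fun u _ => hb s u).trans ?_
    simp only [Finset.sum_add_distrib, ← Finset.sum_mul, Finset.sum_boole]
    simp only [Finset.sum_const, Finset.card_range, nsmul_eq_mul]
    rw [← Nat.cast_sum]
    have hgs := good_sum I B M hB
    have hgs' : ((∑ s ∈ Finset.range M, ((Finset.range (B^M)).filter
        (fun u => goodAt I B s (u / B^(s+1)))).card : ℕ) : ℝ≥0∞) ≤ ((B * B^M : ℕ) : ℝ≥0∞) := by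
      exact_mod_cast hgs
    refine (add_le_add_right (mul_le_mul_left hgs' _) _).trans ?_
    rw [← ENNReal.ofReal_natCast M, ← ENNReal.ofReal_natCast (B^M),
      ← ENNReal.ofReal_natCast (B * B^M), ← ENNReal.ofReal_mul (by positivity),
      ← ENNReal.ofReal_mul (by positivity), ← ENNReal.ofReal_mul (by positivity),
      ← ENNReal.ofReal_add (by positivity) (by positivity)]
    apply ENNReal.ofReal_le_ofReal
    push_cast
    have hBM : (0:ℝ) < (B:ℝ)^M := by positivity
    have := mul_le_mul_of_nonneg_right h4 hBM.le
    linarith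

/-- Variational estimates cannot be dominated by sequential jump estimates uniformly
(Corollary 4.3 of Mirek–Słomian–Szarek). -/
theorem stmt6 (p ρ r : ℝ) (hp : 1 ≤ p) (hρ : 1 < ρ) (hρr : ρ ≤ r) :
    ¬ ∃ C : ℝ, 0 < C ∧ ∀ f : ℤ → ℕ → ℝ,
      weakLpZ p (fun x => varSeminorm r (f x))
      ≤ ENNReal.ofReal C *
        ⨆ (I : ℕ → ℕ) (_ : StrictMono I) (lam : ℝ) (_ : 0 < lam),
          lpZ p (fun x => ENNReal.ofReal lam * seqJumpCount lam I (f x) ^ (1/ρ)) := by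
  rintro ⟨C, hC, hall⟩
  obtain ⟨L, b, M, lam0, Y, hL, hb, hM, hl0, hY0, h1, h2, h3, hY, h4⟩ :=
    consts p ρ r C hp hρ hρr hC
  set δ := (L:ℝ) ^ (-(1/r)) with hδ
  have hLr : (0:ℝ) < L := by exact_mod_cast hL
  have hδ0 : 0 < δ := Real.rpow_pos_of_pos hLr _
  set B := L * b with hBdef
  have hB : 0 < B := Nat.mul_pos hL hb
  have hBr : (0:ℝ) < B := by exact_mod_cast hB
  have hMr : (0:ℝ) < M := by exact_mod_cast hM
  let F : Fin M × Fin (B^M) → ℕ → ℝ :=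
    fun i => wav δ L (B^((i.1:ℕ)+1)) ((i.2:ℕ) / B^((i.1:ℕ)+1))
  obtain ⟨e⟩ : Nonempty (Fin M × Fin (B^M) ↪ ℤ) :=
    ⟨finProdFinEquiv.toEmbedding.trans (Fin.valEmbedding.trans Nat.castEmbedding)⟩
  set X : ℝ := M * B^M with hX
  have hX0 : 0 < X := by positivity
  have hp0 : 0 < p := by linarith
  have hf := hall (Function.extend e F 0)
  have hlow : ENNReal.ofReal (X ^ (1/p)) ≤
      weakLpZ p (fun x => varSeminorm r (Function.extend e F 0 x)) := by
    unfold weakLpZ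
    refine le_iSup₂_of_le 1 one_pos ?_
    rw [ENNReal.ofReal_one, one_mul, ← ENNReal.ofReal_rpow_of_nonneg hX0.le (by positivity)]
    apply ENNReal.rpow_le_rpow _ (by positivity)
    refine le_trans (le_of_eq ?_) (count_extend e _ ?_)
    · rw [← ENNReal.ofReal_natCast]
      simp [hX]
    · intro i
      simp only [Set.mem_setOf_eq]
      rw [e.injective.extend_apply, ← ENNReal.ofReal_one]
      exact var_lower_s6 r (by linarith) L b _ _ hL hb
  have hup : (⨆ (I : ℕ → ℕ) (_ : StrictMono I) (lam : ℝ) (_ : 0 < lam),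
      lpZ p (fun x => ENNReal.ofReal lam *
        seqJumpCount lam I (Function.extend e F 0 x) ^ (1/ρ)))
      ≤ ENNReal.ofReal (1/(2*C) * X ^ (1/p)) := by
    refine iSup₂_le fun I hI => iSup₂_le fun lam hl => ?_
    unfold lpZ
    rw [tsum_extend e F (fun a => (ENNReal.ofReal lam * seqJumpCount lam I a ^ (1/ρ)) ^ p)
      (by rw [seq_zero lam hl, ENNReal.zero_rpow_of_pos (by positivity), mul_zero,
          ENNReal.zero_rpow_of_pos (by linarith)])]
    have hs := main_sum p ρ C δ lam0 Y L B M hp hρ hC hδ0 hL hB hM hl0 hY0 h1 h2 h3 hY h4 I hI lam hl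
    have hconv : 1/(2*C) * X ^ (1/p) = ((1/(2*C)) ^ p * X) ^ (1/p) := by
      rw [Real.mul_rpow (by positivity) hX0.le, ← Real.rpow_mul (by positivity),
        mul_one_div_cancel hp0.ne', Real.rpow_one]
    rw [hconv, ← ENNReal.ofReal_rpow_of_nonneg (by positivity) (by positivity)]
    apply ENNReal.rpow_le_rpow _ (by positivity)
    refine le_trans (le_of_eq ?_) hs
    rw [Fintype.sum_prod_type, Finset.sum_range]
    refine Finset.sum_congr rfl fun s _ => ?_
    rw [Finset.sum_range]
  have hfin := hlow.trans (hf.trans (mul_le_mul_right hup _))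
  rw [← ENNReal.ofReal_mul hC.le, ENNReal.ofReal_le_ofReal_iff (by positivity)] at hfin
  have hXp : 0 < X ^ (1/p) := Real.rpow_pos_of_pos hX0 _
  have : C * (1/(2*C) * X ^ (1/p)) = X ^ (1/p) / 2 := by field_simp
  linarith
end

section
/- Let 1 ≤ p < ∞ and 1 < ρ ≤ r < ∞ be fixed. There is NO constant C > 0 such that the estimate sup_{λ > 0} ‖λ · N_λ(f(·,t) : t ∈ ℕ)^{1/r}‖_{ℓ^{p,∞}(ℤ)} ≤ C · sup_{I ∈ 𝔖_∞(ℕ)} sup_{λ > 0} ‖λ · N_{λ,I}(f(·,t) : t ∈ ℕ)^{1/ρ}‖_{ℓ^p(ℤ)} holds uniformly for all measurable functions f : ℤ × ℕ → ℝ. -/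
open MeasureTheory ENNReal

namespace Stmt7

lemma geo (q : ℝ) (hq0 : 0 < q) (hq1 : q < 1) (S : ℕ) : ∀ (u : ℝ), 0 ≤ u →
    ∑ i ∈ Finset.range S, (if u * q ^ i ≤ 1 then u * q ^ i else 0) ≤ 1 / (1 - q) := by
  induction S with
  | zero => intro u hu; simp; linarith
  | succ n ih =>
    intro u hu
    by_cases h : u ≤ 1
    · calc ∑ i ∈ Finset.range (n+1), (if u * q ^ i ≤ 1 then u * q ^ i else 0)
          ≤ ∑ i ∈ Finset.range (n+1), q ^ i := by
            apply Finset.sum_le_sum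
            intro i _
            have : 0 < q ^ i := by positivity
            split_ifs
            · nlinarith
            · exact this.le
        _ ≤ 1 / (1 - q) := by
            have h1 : 0 < 1 - q := by linarith
            rw [le_div_iff₀ h1, geom_sum_mul_neg]
            have : 0 < q ^ (n+1) := by positivity
            linarith
    · rw [Finset.sum_range_succ']
      simp only [pow_zero, mul_one, if_neg h, add_zero]
      have := ih (u * q) (by positivity)
      simpa only [pow_succ', mul_assoc] using this

lemma tele (I : ℕ → ℕ) (hI : StrictMono I) (a b n : ℕ) :
    ∑ k ∈ Finset.range n, (if a ≤ I k ∧ I (k+1) ≤ b then I (k+1) - I k else 0)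
      ≤ min (I n) b - a := by
  induction n with
  | zero => simp
  | succ n ih =>
    rw [Finset.sum_range_succ]
    have h := hI (Nat.lt_succ_self n)
    simp only [Nat.succ_eq_add_one] at h
    split_ifs <;> omega

/-- inside intervals -/
def ins (M : ℕ) (I : ℕ → ℕ) (lam : ℝ) (i y k : ℕ) : Prop :=
  y / M ^ (i+1) * M ^ (i+1) ≤ I k ∧ I (k+1) ≤ (y / M ^ (i+1) + 1) * M ^ (i+1) ∧
    lam * (M:ℝ) ^ i ≤ 2 * ((I (k+1) - I k : ℕ) : ℝ)

open Classical in
/-- the number of inside intervals -/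
noncomputable def nn (M S : ℕ) (I : ℕ → ℕ) (lam : ℝ) (i y : ℕ) : ℕ :=
  ((Finset.range (M ^ S)).filter (ins M I lam i y)).card

/-- wave at level i in the interval containing y -/
noncomputable def wave (M : ℕ) (i y t : ℕ) : ℝ :=
  if y / M ^ (i+1) * M ^ (i+1) ≤ t ∧ t < (y / M ^ (i+1) + 1) * M ^ (i+1) then
    Real.cos (Real.pi * (t / (M:ℝ)^i)) / 2 else 0

lemma nn_le (M S : ℕ) (hM : 2 ≤ M) (I : ℕ → ℕ) (hI : StrictMono I) (lam : ℝ) (i y : ℕ) :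
    lam * nn M S I lam i y ≤ 2 * M := by
  classical
  have h1 : ∑ k ∈ (Finset.range (M ^ S)).filter (ins M I lam i y), (I (k+1) - I k)
      ≤ M ^ (i+1) := by
    calc _ ≤ ∑ k ∈ Finset.range (M^S), (if y / M ^ (i+1) * M ^ (i+1) ≤ I k ∧
            I (k+1) ≤ (y / M ^ (i+1) + 1) * M ^ (i+1) then I (k+1) - I k else 0) := by
          rw [Finset.sum_filter]
          apply Finset.sum_le_sum
          intro k _
          by_cases h : ins M I lam i y k
          · rw [if_pos h, if_pos ⟨h.1, h.2.1⟩]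
          · rw [if_neg h]; exact Nat.zero_le _
      _ ≤ _ := tele I hI _ _ _
      _ ≤ M ^ (i+1) := by
          rw [add_mul, one_mul]; omega
  have h2 : (nn M S I lam i y : ℝ) * (lam * (M:ℝ)^i) ≤
      ∑ k ∈ (Finset.range (M ^ S)).filter (ins M I lam i y), 2 * ((I (k+1) - I k : ℕ) : ℝ) := by
    rw [nn, ← nsmul_eq_mul]
    apply Finset.card_nsmul_le_sum
    intro k hk
    exact (Finset.mem_filter.1 hk).2.2.2
  rw [← Finset.mul_sum] at h2
  have h3 : (∑ k ∈ (Finset.range (M ^ S)).filter (ins M I lam i y), ((I (k+1) - I k : ℕ) : ℝ))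
      ≤ (M:ℝ) ^ (i+1) := by exact_mod_cast h1
  have hpos : (0:ℝ) < (M:ℝ)^i := by positivity
  have : (lam * nn M S I lam i y) * (M:ℝ)^i ≤ (2 * M) * (M:ℝ)^i := by
    rw [pow_succ] at h3; nlinarith
  exact le_of_mul_le_mul_right this hpos

lemma main_sum (M S : ℕ) (hM : 2 ≤ M) (I : ℕ → ℕ) (hI : StrictMono I) (lam ρ : ℝ)
    (hl : 0 < lam) (hρ : 1 < ρ) :
    ∑ i ∈ Finset.range S, ∑ y ∈ Finset.range (M^S), lam ^ ρ * nn M S I lam i y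
      ≤ 2 ^ ρ * (M:ℝ) ^ ρ * (1 / (1 - (M:ℝ)^(-(ρ-1)))) * (M:ℝ)^S := by
  classical
  have hM0 : (0:ℝ) < M := by positivity
  set q : ℝ := (M:ℝ)^(-(ρ-1)) with hq
  have hq0 : 0 < q := by positivity
  have hq1 : q < 1 := Real.rpow_lt_one_of_one_lt_of_neg (by exact_mod_cast hM) (by linarith)
  have hkey : ∀ k ∈ Finset.range (M^S), ∀ i ∈ Finset.range S,
      ∑ y ∈ Finset.range (M^S), (if ins M I lam i y k then lam ^ ρ else 0) ≤
      (2 ^ ρ * (M:ℝ) ^ ρ * (if 0 ≤ I k ∧ I (k+1) ≤ M^S then I (k+1) - I k else 0 : ℕ)) *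
       (if (((I (k+1) - I k : ℕ):ℝ) / M) ^ (ρ-1) * q ^ i ≤ 1 then
          (((I (k+1) - I k : ℕ):ℝ) / M) ^ (ρ-1) * q ^ i else 0) := by
    intro k hk i hi
    have hlk : 0 < I (k+1) - I k := Nat.sub_pos_of_lt (hI (Nat.lt_succ_self k))
    by_cases hex : ∃ y ∈ Finset.range (M^S), ins M I lam i y k
    · obtain ⟨y0, hy0, h0⟩ := hex
      set P := M ^ (i+1) with hP
      have hPpos : 0 < P := by positivity
      have hdvd : P ∣ M ^ S := pow_dvd_pow _ (by have := Finset.mem_range.1 hi; omega)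
      have hT : I (k+1) ≤ M ^ S := by
        refine h0.2.1.trans ?_
        have : y0 / P < M^S / P := Nat.div_lt_div_of_lt_of_dvd hdvd (Finset.mem_range.1 hy0)
        calc (y0 / P + 1) * P ≤ (M^S/P) * P := Nat.mul_le_mul_right _ this
          _ = M^S := Nat.div_mul_cancel hdvd
      have hlP : I (k+1) - I k ≤ P := by
        have h1 := h0.1; have h2 := h0.2.1
        rw [← hP, add_mul, one_mul] at h2
        rw [← hP] at h1
        omega
      rw [if_pos ⟨Nat.zero_le _, hT⟩]
      set l : ℝ := ((I (k+1) - I k : ℕ):ℝ) with hl'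
      have hl0 : 0 < l := by rw [hl']; exact_mod_cast hlk
      have hPr : (P:ℝ) = (M:ℝ)^(i+1) := by rw [hP]; push_cast; rfl
      have hlPr : l ≤ P := by rw [hl']; exact_mod_cast hlP
      have hPr0 : (0:ℝ) < P := by exact_mod_cast hPpos
      have hterm : (l / M) ^ (ρ-1) * q ^ i = (l / P) ^ (ρ-1) := by
        rw [hq, Real.rpow_neg hM0.le, inv_pow, ← Real.rpow_natCast, ← Real.rpow_mul hM0.le, mul_comm _ (i:ℝ),
          Real.rpow_mul hM0.le, Real.rpow_natCast, ← Real.inv_rpow (by positivity),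
          ← Real.mul_rpow (by positivity) (by positivity), hPr]
        congr 1
        rw [pow_succ]
        field_simp
      rw [hterm, if_pos (Real.rpow_le_one (by positivity) ((div_le_one hPr0).2 hlPr) (by linarith))]
      have hcard : ∑ y ∈ Finset.range (M^S), (if ins M I lam i y k then lam ^ ρ else 0)
          ≤ P * lam ^ ρ := by
        rw [← Finset.sum_filter, Finset.sum_const, nsmul_eq_mul]
        apply mul_le_mul_of_nonneg_right _ (by positivity)
        have hsub : (Finset.range (M^S)).filter (fun y => ins M I lam i y k) ⊆
            Finset.Ico (I k / P * P) (I k / P * P + P) := by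
          intro y hy
          have hy' := (Finset.mem_filter.1 hy).2
          have h1 : y / P * P ≤ I k := hy'.1
          have h2 : I (k+1) ≤ (y / P + 1) * P := hy'.2.1
          have h3 : I k / P = y / P := by
            apply le_antisymm
            · apply Nat.le_of_lt_succ
              rw [Nat.div_lt_iff_lt_mul hPpos]
              exact lt_of_lt_of_le (hI (Nat.lt_succ_self k)) h2
            · rwa [Nat.le_div_iff_mul_le hPpos]
          rw [h3, Finset.mem_Ico]
          have := Nat.div_add_mod y P
          have := Nat.mod_lt y hPpos
          rw [mul_comm (y/P) P]
          omega
        have := Finset.card_le_card hsub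
        rw [Nat.card_Ico, Nat.add_sub_cancel_left] at this
        exact_mod_cast this
      refine hcard.trans ?_
      have hlam : lam ≤ 2 * M * (l / P) := by
        have := h0.2.2
        rw [← hl'] at this
        rw [← mul_div_assoc, le_div_iff₀ hPr0, hPr, pow_succ]
        nlinarith
      have hlam2 : lam ^ ρ ≤ 2 ^ ρ * (M:ℝ)^ρ * (l/P) ^ ρ := by
        rw [← Real.mul_rpow (by positivity) (by positivity), ← Real.mul_rpow (by positivity) (by positivity)]
        exact Real.rpow_le_rpow hl.le hlam (by linarith)
      have hsplit : (l/P) ^ ρ = (l/P) ^ (ρ-1) * (l/P) := by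
        rw [← Real.rpow_add_one (by positivity)]; congr 1; ring
      rw [hsplit] at hlam2
      calc P * lam ^ ρ ≤ P * (2 ^ ρ * (M:ℝ)^ρ * ((l/P) ^ (ρ-1) * (l/P))) :=
            mul_le_mul_of_nonneg_left hlam2 hPr0.le
        _ = _ := by
            generalize (l/P) ^ (ρ-1) = w
            field_simp
    · push Not at hex
      rw [Finset.sum_eq_zero (fun y hy => if_neg (hex y hy))]
      apply mul_nonneg
      · positivity
      · split_ifs <;> positivity
  have hsw : ∑ i ∈ Finset.range S, ∑ y ∈ Finset.range (M^S), lam ^ ρ * nn M S I lam i y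
      = ∑ k ∈ Finset.range (M^S), ∑ i ∈ Finset.range S, ∑ y ∈ Finset.range (M^S),
        (if ins M I lam i y k then lam ^ ρ else 0) := by
    rw [Finset.sum_comm (s := Finset.range (M^S)) (t := Finset.range S)]
    apply Finset.sum_congr rfl
    intro i _
    rw [Finset.sum_comm]
    apply Finset.sum_congr rfl
    intro y _
    rw [← Finset.sum_filter, Finset.sum_const, nsmul_eq_mul, nn, mul_comm]
  rw [hsw]
  have hq2 : 0 < 1 - q := by linarith
  calc _ ≤ ∑ k ∈ Finset.range (M^S), (2 ^ ρ * (M:ℝ) ^ ρ *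
        (if 0 ≤ I k ∧ I (k+1) ≤ M^S then I (k+1) - I k else 0 : ℕ)) * (1 / (1 - q)) := by
        apply Finset.sum_le_sum
        intro k hk
        refine (Finset.sum_le_sum (hkey k hk)).trans ?_
        rw [← Finset.mul_sum]
        apply mul_le_mul_of_nonneg_left _ (by positivity)
        exact geo q hq0 hq1 S _ (by positivity)
    _ = 2 ^ ρ * (M:ℝ) ^ ρ * (1 / (1 - q)) * ((∑ k ∈ Finset.range (M^S),
          (if 0 ≤ I k ∧ I (k+1) ≤ M^S then I (k+1) - I k else 0) : ℕ) : ℝ) := by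
        push_cast
        rw [Finset.mul_sum]
        apply Finset.sum_congr rfl
        intros; ring
    _ ≤ _ := by
        apply mul_le_mul_of_nonneg_left _ (by positivity)
        have := tele I hI 0 (M^S) (M^S)
        have h2 : (∑ k ∈ Finset.range (M^S),
          (if 0 ≤ I k ∧ I (k+1) ≤ M^S then I (k+1) - I k else 0)) ≤ M ^ S := by omega
        exact_mod_cast h2

lemma G_bound (p ρ lam : ℝ) (hp : 1 ≤ p) (hρ : 1 < ρ) (hl : 0 < lam) (hl1 : lam ≤ 1) (M n : ℕ)
    (hn : lam * n ≤ 2 * M) :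
    (lam * ((n:ℝ) + 2) ^ (1/ρ)) ^ p ≤ 2 ^ p + 3 * (2 * M + 2) ^ p * (lam ^ ρ * n) := by
  set G := lam * ((n:ℝ) + 2) ^ (1/ρ) with hG
  have hG0 : 0 < G := by positivity
  have hGρ : G ^ ρ = lam ^ ρ * (n + 2) := by
    rw [hG, Real.mul_rpow (by positivity) (by positivity), ← Real.rpow_mul (by positivity),
      one_div_mul_cancel (by linarith), Real.rpow_one]
  have hrest : 0 ≤ 3 * (2 * (M:ℝ) + 2) ^ p * (lam ^ ρ * n) := by positivity
  by_cases h2 : G ≤ 2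
  · have := Real.rpow_le_rpow hG0.le h2 (by linarith : 0 ≤ p)
    linarith
  · push Not at h2
    have hlρ : lam ^ ρ ≤ lam := by
      calc lam ^ ρ ≤ lam ^ (1:ℝ) := Real.rpow_le_rpow_of_exponent_ge hl hl1 hρ.le
        _ = lam := Real.rpow_one _
    have hself : G ≤ G ^ ρ := by
      calc G = G ^ (1:ℝ) := (Real.rpow_one _).symm
        _ ≤ G ^ ρ := Real.rpow_le_rpow_of_exponent_le (by linarith) hρ.le
    have hn1 : (1:ℝ) ≤ n := by
      have : n ≠ 0 := by
        rintro rfl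
        have : G ^ ρ ≤ 2 := by rw [hGρ]; push_cast; linarith
        linarith
      exact_mod_cast Nat.one_le_iff_ne_zero.2 this
    have hGB : G ≤ 2 * M + 2 := by
      refine hself.trans ?_
      rw [hGρ]
      nlinarith
    have h1 : G ^ p ≤ (2 * M + 2) ^ p := Real.rpow_le_rpow hG0.le hGB (by linarith)
    have h3 : 1 ≤ G ^ ρ := by linarith
    have h4 : G ^ ρ ≤ 3 * (lam ^ ρ * n) := by
      rw [hGρ]
      have : 0 < lam ^ ρ := by positivity
      nlinarith
    have h5 : (0:ℝ) < (2 * M + 2) ^ p := by positivity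
    have h6 : (0:ℝ) < 2 ^ p := by positivity
    calc G ^ p ≤ (2 * M + 2) ^ p * 1 := by linarith
      _ ≤ (2 * M + 2) ^ p * (3 * (lam ^ ρ * n)) := by gcongr; linarith
      _ ≤ _ := by linarith

lemma wave_abs (M i y t : ℕ) : |wave M i y t| ≤ 1/2 := by
  unfold wave
  split_ifs
  · rw [abs_div, abs_two]; have := Real.abs_cos_le_one (Real.pi * (t / (M:ℝ)^i)); linarith
  · simp

lemma cap_exists (lam : ℝ) (hl : 0 < lam) (I : ℕ → ℕ) (a : ℕ → ℝ) (k : ℕ)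
    (h : ENNReal.ofReal lam ≤ ⨆ t ∈ Set.Ico (I k) (I (k+1)), ENNReal.ofReal |a t - a (I k)|) :
    ∃ t, I k ≤ t ∧ t < I (k+1) ∧ lam ≤ |a t - a (I k)| := by
  by_contra hcon
  push Not at hcon
  have : (⨆ t ∈ Set.Ico (I k) (I (k+1)), ENNReal.ofReal |a t - a (I k)|)
      = (Finset.Ico (I k) (I (k+1))).sup (fun t => ENNReal.ofReal |a t - a (I k)|) := by
    rw [Finset.sup_eq_iSup]; simp
  rw [this] at h
  refine absurd h (not_le.2 ?_)
  rw [Finset.sup_lt_iff (by simpa using hl)]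
  intro t ht
  rw [Finset.mem_Ico] at ht
  exact (ENNReal.ofReal_lt_ofReal_iff hl).2 (hcon t ht.1 ht.2)

lemma seq_big (M i y : ℕ) (I : ℕ → ℕ) (lam : ℝ) (hl : 1 < lam) :
    seqJumpCount lam I (wave M i y) = 0 := by
  unfold seqJumpCount
  rw [Measure.count_eq_zero_iff, Set.eq_empty_iff_forall_notMem]
  intro k hk
  obtain ⟨t, -, -, h⟩ := cap_exists lam (by linarith) I _ k hk
  have := abs_sub (wave M i y t) (wave M i y (I k))
  have := wave_abs M i y t
  have := wave_abs M i y (I k)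
  linarith

lemma uniq_k (I : ℕ → ℕ) (hI : StrictMono I) (a k k' : ℕ) (h1 : I k ≤ a) (h2 : a < I (k+1))
    (h3 : I k' ≤ a) (h4 : a < I (k'+1)) : k = k' := by
  have := hI.lt_iff_lt.1 (lt_of_le_of_lt h1 h4)
  have := hI.lt_iff_lt.1 (lt_of_le_of_lt h3 h2)
  omega

lemma seq_le (M S i y : ℕ) (hM : 2 ≤ M) (hi : i < S) (hy : y < M^S)
    (I : ℕ → ℕ) (hI : StrictMono I) (lam : ℝ) (hl : 0 < lam) :
    seqJumpCount lam I (wave M i y) ≤ ENNReal.ofReal ((nn M S I lam i y : ℝ) + 2) := by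
  classical
  set P := M ^ (i+1) with hP
  have hPpos : 0 < P := by positivity
  have hdvd : P ∣ M ^ S := pow_dvd_pow _ (by omega)
  have hbT : (y / P + 1) * P ≤ M ^ S := by
    have : y / P < M^S / P := Nat.div_lt_div_of_lt_of_dvd hdvd hy
    calc (y / P + 1) * P ≤ (M^S/P) * P := Nat.mul_le_mul_right _ this
      _ = M^S := Nat.div_mul_cancel hdvd
  set A : Finset ℕ := (Finset.range (M ^ S)).filter (ins M I lam i y) with hA
  have hcov : {k : ℕ | ENNReal.ofReal lam ≤
      ⨆ t ∈ Set.Ico (I k) (I (k+1)), ENNReal.ofReal |wave M i y t - wave M i y (I k)|} ⊆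
      (A : Set ℕ) ∪ ({k | I k ≤ y / P * P ∧ y / P * P < I (k+1)} ∪
        {k | I k ≤ (y / P + 1) * P ∧ (y / P + 1) * P < I (k+1)}) := by
    intro k hk
    obtain ⟨t, ht1, ht2, ht⟩ := cap_exists lam hl I _ k hk
    by_contra hcon
    simp only [Set.mem_union, Set.mem_ofPred_eq, not_or, not_and, not_lt] at hcon
    obtain ⟨c1, c2, c3⟩ := hcon
    have hlt : I k < I (k+1) := hI (Nat.lt_succ_self k)
    have hne : wave M i y t ≠ wave M i y (I k) := by
      intro h; rw [h] at ht; simp at ht; linarith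
    by_cases hIk : y / P * P ≤ I k ∧ I k < (y / P + 1) * P
    · have hend := c3 hIk.2.le
      apply c1
      have hw1 : wave M i y (I k) = Real.cos (Real.pi * (I k / (M:ℝ)^i)) / 2 := if_pos hIk
      have hw2 : wave M i y t = Real.cos (Real.pi * (t / (M:ℝ)^i)) / 2 :=
        if_pos ⟨hIk.1.trans ht1, ht2.trans_le hend⟩
      rw [hw1, hw2, ← sub_div, abs_div, abs_two] at ht
      have hcos : |Real.cos (Real.pi * (t / (M:ℝ)^i)) - Real.cos (Real.pi * (I k / (M:ℝ)^i))|
          ≤ |Real.pi * (t / (M:ℝ)^i) - Real.pi * (I k / (M:ℝ)^i)| := by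
        exact Real.abs_cos_sub_cos_le _ _
      have hMi : (0:ℝ) < (M:ℝ)^i := by positivity
      have heq : Real.pi * (t / (M:ℝ)^i) - Real.pi * (I k / (M:ℝ)^i) =
          Real.pi * ((t:ℝ) - I k) / (M:ℝ)^i := by ring
      have htI : (0:ℝ) ≤ (t:ℝ) - I k := by
        have : (I k : ℝ) ≤ t := by exact_mod_cast ht1
        linarith
      have hcast : ((I (k+1) - I k : ℕ) : ℝ) = (I (k+1) : ℝ) - I k := by
        rw [Nat.cast_sub hlt.le]
      have htl : (t:ℝ) ≤ I (k+1) := by exact_mod_cast ht2.le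
      have habs : |Real.pi * ((t:ℝ) - I k) / (M:ℝ)^i| = Real.pi * ((t:ℝ) - I k) / (M:ℝ)^i :=
        abs_of_nonneg (div_nonneg (mul_nonneg Real.pi_pos.le htI) hMi.le)
      rw [heq, habs] at hcos
      have h4 : lam ≤ Real.pi * ((t:ℝ) - I k) / (M:ℝ)^i / 2 := by linarith
      have h5 : lam * (M:ℝ)^i ≤ Real.pi * ((t:ℝ) - I k) / 2 := by
        rw [div_div, le_div_iff₀ (by positivity)] at h4; linarith
      have h6 : Real.pi * ((t:ℝ) - I k) ≤ 4 * ((t:ℝ) - I k) :=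
        mul_le_mul_of_nonneg_right Real.pi_le_four htI
      have hins : ins M I lam i y k := ⟨hIk.1, hend, by rw [hcast]; linarith⟩
      rw [hA, Finset.mem_coe, Finset.mem_filter]
      refine ⟨?_, hins⟩
      rw [Finset.mem_range]
      have := hI.le_apply (x := k)
      omega
    · have hw1 : wave M i y (I k) = 0 := if_neg hIk
      have htQ : y / P * P ≤ t ∧ t < (y / P + 1) * P := by
        by_contra h
        exact hne (by rw [hw1]; exact if_neg h)
      by_cases h : I k ≤ y / P * P
      · have := c2 h
        omega
      · push Not at h
        apply hIk
        exact ⟨h.le, by omega⟩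
  unfold seqJumpCount
  refine (measure_mono hcov).trans ?_
  refine (measure_union_le _ _).trans ?_
  have hsub : ∀ a : ℕ, Measure.count {k | I k ≤ a ∧ a < I (k+1)} ≤ 1 := by
    intro a
    rw [Measure.count_apply (MeasurableSet.of_discrete)]
    have : {k | I k ≤ a ∧ a < I (k+1)}.encard ≤ 1 := by
      rw [Set.encard_le_one_iff]
      intro k k' hk hk'
      exact uniq_k I hI a k k' hk.1 hk.2 hk'.1 hk'.2
    exact_mod_cast this
  have h1 : Measure.count (A : Set ℕ) = (nn M S I lam i y : ℝ≥0∞) := by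
    rw [Measure.count_apply_finset]; rfl
  have h2 := (measure_union_le (μ := Measure.count) {k | I k ≤ y / P * P ∧ y / P * P < I (k+1)}
    {k | I k ≤ (y / P + 1) * P ∧ (y / P + 1) * P < I (k+1)}).trans (add_le_add (hsub _) (hsub _))
  rw [h1, ENNReal.ofReal_add (by positivity) (by norm_num), ENNReal.ofReal_natCast]
  gcongr
  refine h2.trans ?_
  rw [ENNReal.ofReal_ofNat]
  norm_num

lemma jump_ge (K i y : ℕ) : (K : ℝ≥0∞) ≤ jumpCount 1 (wave (K+1) i y) := by
  unfold jumpCount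
  refine le_iSup₂_of_le K ?_ le_rfl
  have hM : 0 < K + 1 := by omega
  set P := (K+1) ^ (i+1) with hP
  have hL : 0 < (K+1)^i := by positivity
  have hval : ∀ j ≤ K, wave (K+1) i y (y / P * P + j * (K+1)^i) =
      (-1) ^ (y / P * (K+1) + j) / 2 := by
    intro j hj
    have hc : y / P * P ≤ y / P * P + j * (K+1)^i ∧
        y / P * P + j * (K+1)^i < (y / P + 1) * P := by
      refine ⟨by omega, ?_⟩
      rw [add_mul, one_mul]
      have : j * (K+1)^i < P := by
        rw [hP, pow_succ, mul_comm]
        exact Nat.mul_lt_mul_of_pos_left (by omega) hL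
      omega
    rw [wave, if_pos hc, ← Real.cos_nat_mul_pi]
    congr 2
    rw [mul_comm]
    congr 1
    rw [hP]
    push_cast
    have : ((K:ℝ)+1)^i ≠ 0 := by positivity
    rw [pow_succ]
    field_simp
    ring
  refine ⟨fun j => y / P * P + j * (K+1)^i, ?_, ?_⟩
  · intro a _ b _ hab
    have : a * (K+1)^i < b * (K+1)^i := Nat.mul_lt_mul_of_pos_right hab hL
    simp only
    omega
  · intro j hj
    simp only
    rw [hval j (by omega), hval (j+1) (by omega), ← add_assoc, pow_succ]
    rw [show ((-1:ℝ) ^ (y / P * (K+1) + j) * -1 / 2 - (-1) ^ (y / P * (K+1) + j) / 2)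
      = - (-1) ^ (y / P * (K+1) + j) by ring]
    simp

end Stmt7

/-- Jump estimates cannot be dominated by sequential jump estimates uniformly
(Corollary 4.3 of Mirek–Słomian–Szarek). -/
theorem stmt7 (p ρ r : ℝ) (hp : 1 ≤ p) (hρ : 1 < ρ) (hρr : ρ ≤ r) :
    ¬ ∃ C : ℝ, 0 < C ∧ ∀ f : ℤ → ℕ → ℝ,
      (⨆ (lam : ℝ) (_ : 0 < lam),
        weakLpZ p (fun x => ENNReal.ofReal lam * jumpCount lam (f x) ^ (1/r)))
      ≤ ENNReal.ofReal C *
        ⨆ (I : ℕ → ℕ) (_ : StrictMono I) (lam : ℝ) (_ : 0 < lam),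
          lpZ p (fun x => ENNReal.ofReal lam * seqJumpCount lam I (f x) ^ (1/ρ)) := by
  rintro ⟨C, hC, hmain⟩
  have hp0 : 0 < p := by linarith
  have hr0 : 0 < r := by linarith
  set α : ℝ := (2 ^ p * C ^ p + 1) ^ (1/p) with hα
  have hα0 : 0 < α := by positivity
  have hαp : α ^ p = 2 ^ p * C ^ p + 1 := by
    rw [hα, ← Real.rpow_mul (by positivity), one_div_mul_cancel hp0.ne', Real.rpow_one]
  obtain ⟨K, hK⟩ := exists_nat_gt (α ^ r)
  have hK1 : 1 ≤ K := by
    have : (0:ℝ) < K := lt_trans (by positivity) hK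
    exact_mod_cast this
  have hαK : α < (K:ℝ) ^ (1/r) := by
    have := Real.rpow_lt_rpow (by positivity) hK (by positivity : 0 < 1/r)
    rwa [← Real.rpow_mul hα0.le, mul_one_div_cancel hr0.ne', Real.rpow_one] at this
  set M : ℕ := K + 1 with hM
  have hM2 : 2 ≤ M := by omega
  set E : ℝ := 2 ^ ρ * (M:ℝ) ^ ρ * (1 / (1 - (M:ℝ)^(-(ρ-1)))) with hE
  set D : ℝ := 3 * (2 * M + 2) ^ p * E with hD
  obtain ⟨S, hS⟩ := exists_nat_gt (C ^ p * D)
  have hq1 : (M:ℝ)^(-(ρ-1)) < 1 :=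
    Real.rpow_lt_one_of_one_lt_of_neg (by exact_mod_cast hM2) (by linarith)
  have hE0 : 0 < E := by
    have : 0 < 1 - (M:ℝ)^(-(ρ-1)) := by linarith
    positivity
  have hD0 : 0 < D := by positivity
  set T : ℕ := M ^ S with hT
  have hT0 : 0 < T := by positivity
  obtain ⟨e⟩ : Nonempty (ℤ ≃ ℕ × ℕ) := ⟨Denumerable.equiv₂ ℤ (ℕ × ℕ)⟩
  set F : ℕ × ℕ → ℕ → ℝ := fun z t => if z.1 < S ∧ z.2 < T then Stmt7.wave M z.1 z.2 t else 0
    with hF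
  have hFpos : ∀ z : ℕ × ℕ, z.1 < S ∧ z.2 < T → F z = Stmt7.wave M z.1 z.2 := by
    intro z hz; funext t; simp only [hF]; rw [if_pos hz]
  have hFneg : ∀ z : ℕ × ℕ, ¬ (z.1 < S ∧ z.2 < T) → F z = fun _ => 0 := by
    intro z hz; funext t; simp only [hF]; rw [if_neg hz]
  have h := hmain (fun x => F (e x))
  have hmem : ∀ z : ℕ × ℕ, z ∈ Finset.range S ×ˢ Finset.range T ↔ z.1 < S ∧ z.2 < T := by
    intro z; simp
  -- lower bound
  have hlow : ENNReal.ofReal α * (ENNReal.ofReal (S * T)) ^ (1/p) ≤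
      ⨆ (lam : ℝ) (_ : 0 < lam),
        weakLpZ p (fun x => ENNReal.ofReal lam * jumpCount lam (F (e x)) ^ (1/r)) := by
    refine le_iSup₂_of_le 1 one_pos ?_
    unfold weakLpZ
    refine le_iSup₂_of_le α hα0 ?_
    gcongr
    have hsub : (((Finset.range S ×ˢ Finset.range T).map e.symm.toEmbedding : Finset ℤ) : Set ℤ) ⊆
        {x : ℤ | ENNReal.ofReal α < ENNReal.ofReal 1 * jumpCount 1 (F (e x)) ^ (1/r)} := by
      intro x hx
      rw [Finset.mem_coe, Finset.mem_map] at hx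
      obtain ⟨z, hz, rfl⟩ := hx
      rw [hmem] at hz
      change ENNReal.ofReal α < ENNReal.ofReal 1 * jumpCount 1 (F (e (e.symm z))) ^ (1/r)
      rw [Equiv.apply_symm_apply, hFpos z hz, ENNReal.ofReal_one, one_mul]
      calc ENNReal.ofReal α < ENNReal.ofReal ((K:ℝ) ^ (1/r)) :=
            (ENNReal.ofReal_lt_ofReal_iff (by positivity)).2 hαK
        _ = (K : ℝ≥0∞) ^ (1/r) := by
            rw [← ENNReal.ofReal_rpow_of_nonneg (by positivity) (by positivity),
              ENNReal.ofReal_natCast]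
        _ ≤ _ := ENNReal.rpow_le_rpow (Stmt7.jump_ge K z.1 z.2) (by positivity)
    refine le_trans (le_of_eq ?_) (measure_mono hsub)
    rw [Measure.count_apply_finset, Finset.card_map, Finset.card_product, Finset.card_range,
      Finset.card_range]
    rw [← Nat.cast_mul, ENNReal.ofReal_natCast]
  -- upper bound
  have hup : (⨆ (I : ℕ → ℕ) (_ : StrictMono I) (lam : ℝ) (_ : 0 < lam),
      lpZ p (fun x => ENNReal.ofReal lam * seqJumpCount lam I (F (e x)) ^ (1/ρ))) ≤
      (ENNReal.ofReal (2 ^ p * (S * T) + D * T)) ^ (1/p) := by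
    refine iSup₂_le fun I hI => iSup₂_le fun lam hl => ?_
    unfold lpZ
    apply ENNReal.rpow_le_rpow _ (by positivity)
    have hρ0 : 0 < ρ := by linarith
    rw [e.tsum_eq (fun z => (ENNReal.ofReal lam * seqJumpCount lam I (F z) ^ (1/ρ)) ^ p)]
    rw [tsum_eq_sum (s := Finset.range S ×ˢ Finset.range T)]
    swap
    · intro z hz
      rw [hmem] at hz
      have h0 : seqJumpCount lam I (F z) = 0 := by
        rw [hFneg z hz]
        unfold seqJumpCount
        rw [Measure.count_eq_zero_iff, Set.eq_empty_iff_forall_notMem]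
        intro k hk
        obtain ⟨t, -, -, h⟩ := Stmt7.cap_exists lam hl I _ k hk
        simp at h
        linarith
      rw [h0, ENNReal.zero_rpow_of_pos (by positivity), mul_zero, ENNReal.zero_rpow_of_pos hp0]
    by_cases hl1 : lam ≤ 1
    · have hterm : ∀ z ∈ Finset.range S ×ˢ Finset.range T,
          (ENNReal.ofReal lam * seqJumpCount lam I (F z) ^ (1/ρ)) ^ p ≤
          ENNReal.ofReal (2 ^ p + 3 * (2 * M + 2) ^ p *
            (lam ^ ρ * Stmt7.nn M S I lam z.1 z.2)) := by
        intro z hz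
        rw [hmem] at hz
        rw [hFpos z hz]
        have hs := Stmt7.seq_le M S z.1 z.2 hM2 hz.1 hz.2 I hI lam hl
        have hg := Stmt7.G_bound p ρ lam hp hρ hl hl1 M (Stmt7.nn M S I lam z.1 z.2)
          (Stmt7.nn_le M S hM2 I hI lam z.1 z.2)
        refine le_trans ?_ (ENNReal.ofReal_le_ofReal hg)
        rw [← ENNReal.ofReal_rpow_of_nonneg (by positivity) hp0.le,
          ENNReal.ofReal_mul hl.le,
          ← ENNReal.ofReal_rpow_of_nonneg (by positivity) (by positivity)]
        gcongr
      refine (Finset.sum_le_sum hterm).trans ?_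
      rw [← ENNReal.ofReal_sum_of_nonneg (fun z _ => by positivity)]
      apply ENNReal.ofReal_le_ofReal
      rw [Finset.sum_add_distrib, Finset.sum_const, Finset.card_product, Finset.card_range,
        Finset.card_range, ← Finset.mul_sum, Finset.sum_product, nsmul_eq_mul]
      have hms := Stmt7.main_sum M S hM2 I hI lam ρ hl hρ
      rw [← hE] at hms
      have hTr : (T:ℝ) = (M:ℝ)^S := by rw [hT]; push_cast; rfl
      rw [← hTr] at hms
      have hB : (0:ℝ) < 3 * (2 * M + 2) ^ p := by positivity
      have := mul_le_mul_of_nonneg_left hms hB.le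
      push_cast
      rw [hD]
      linarith
    · push Not at hl1
      rw [Finset.sum_eq_zero]
      · exact zero_le
      intro z hz
      rw [hmem] at hz
      rw [hFpos z hz, Stmt7.seq_big M _ _ I lam hl1, ENNReal.zero_rpow_of_pos (by positivity),
        mul_zero, ENNReal.zero_rpow_of_pos hp0]
  have hfin := (hlow.trans h).trans (mul_le_mul_right hup (ENNReal.ofReal C))
  have hTr0 : (0:ℝ) < T := by exact_mod_cast hT0
  have hX : (0:ℝ) ≤ S * T := by positivity
  have hY : (0:ℝ) ≤ 2 ^ p * (S * T) + D * T := by positivity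
  rw [ENNReal.ofReal_rpow_of_nonneg hX (by positivity), ENNReal.ofReal_rpow_of_nonneg hY (by positivity),
    ← ENNReal.ofReal_mul hα0.le, ← ENNReal.ofReal_mul hC.le,
    ENNReal.ofReal_le_ofReal_iff (by positivity)] at hfin
  have h2 := Real.rpow_le_rpow (by positivity) hfin hp0.le
  rw [Real.mul_rpow hα0.le (by positivity), Real.mul_rpow hC.le (by positivity),
    ← Real.rpow_mul hX, ← Real.rpow_mul hY, one_div_mul_cancel hp0.ne', Real.rpow_one,
    Real.rpow_one, hαp] at h2
  have h3 : (S:ℝ) * T ≤ (C ^ p * D) * T := by linarith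
  have h4 := le_of_mul_le_mul_right h3 hTr0
  linarith
end

section
/- For every fixed 1 ≤ p < ∞ there exists a function f : ℤ₊ × ℤ₊ → ℝ such that ‖V^r(f(·,n) : n ∈ ℤ₊)‖_{ℓ^p(ℤ₊)} = ∞ for every 2 ≤ r ≤ ∞, while sup_{λ > 0} ‖λ · N_λ(f(·,n) : n ∈ ℤ₊)^{1/2}‖_{ℓ^p(ℤ₊)} < ∞. (Explicitly, one may take f(x,1) = x^{-1/p} and f(x,n) = 0 for n ≥ 2.) In particular, the weak type space ℓ^{p,∞} in Bourgain's inversion inequality relating uniform jump estimates to weak type r-variational estimates cannot be replaced by ℓ^p. -/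
open MeasureTheory ENNReal

/-- The `r`-variation seminorm `V^r(a_n : n ∈ ℤ₊)`. -/
noncomputable def varP (r : ℝ) (a : ℕ+ → ℝ) : ℝ≥0∞ :=
  ⨆ (J : ℕ) (_ : 0 < J) (t : ℕ → ℕ+) (_ : StrictMonoOn t (Set.Iic J)),
    (∑ j ∈ Finset.range J, ENNReal.ofReal |a (t (j+1)) - a (t j)| ^ r) ^ (1/r)

/-- The `∞`-variation seminorm `V^∞(a_n : n ∈ ℤ₊) = sup_{s,t} |a_t - a_s|`. -/
noncomputable def varInfP (a : ℕ+ → ℝ) : ℝ≥0∞ :=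
  ⨆ (s : ℕ+) (t : ℕ+), ENNReal.ofReal |a t - a s|

/-- The `λ`-jump counting function `N_λ(a_n : n ∈ ℤ₊)`. -/
noncomputable def jumpP (lam : ℝ) (a : ℕ+ → ℝ) : ℝ≥0∞ :=
  ⨆ (J : ℕ) (_ : ∃ t : ℕ → ℕ+, StrictMonoOn t (Set.Iic J) ∧
      ∀ j < J, lam ≤ |a (t (j+1)) - a (t j)|), (J : ℝ≥0∞)

lemma s8_tsum (p : ℝ) (hp : 1 ≤ p) (v : ℕ+ → ℝ≥0∞)
    (hv : ∀ x : ℕ+, ENNReal.ofReal ((x:ℝ) ^ (-1/p)) ≤ v x) :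
    (∑' x : ℕ+, v x ^ p) ^ (1/p) = ∞ := by
  have hp0 : 0 < p := by linarith
  have h1 : ∑' x : ℕ+, v x ^ p = ∞ := by
    by_contra hne
    have hle : ∀ x : ℕ+, ENNReal.ofReal (1/(x:ℝ)) ≤ v x ^ p := by
      intro x
      have hx : (0:ℝ) < x := by exact_mod_cast x.pos
      calc ENNReal.ofReal (1/(x:ℝ)) = ENNReal.ofReal ((x:ℝ) ^ (-1/p)) ^ p := by
            rw [ENNReal.ofReal_rpow_of_pos (Real.rpow_pos_of_pos hx _), ← Real.rpow_mul hx.le,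
              div_mul_cancel₀ _ hp0.ne', Real.rpow_neg_one, one_div]
        _ ≤ _ := ENNReal.rpow_le_rpow (hv x) hp0.le
    have hne2 : ∑' x : ℕ+, ENNReal.ofReal (1/(x:ℝ)) ≠ ∞ :=
      ne_top_of_le_ne_top hne (ENNReal.tsum_le_tsum hle)
    rw [tsum_pnat_eq_tsum_succ (f := fun n : ℕ => ENNReal.ofReal (1/(n:ℝ)))] at hne2
    have hs := ENNReal.summable_toReal hne2
    have : Summable (fun n : ℕ => 1/(((n+1:ℕ)):ℝ)) := by
      refine hs.congr fun n => ?_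
      rw [ENNReal.toReal_ofReal (by positivity)]
    exact Real.not_summable_one_div_natCast ((summable_nat_add_iff 1).1 this)
  rw [h1, ENNReal.top_rpow_of_pos (by positivity)]

/-- The counterexample function. -/
noncomputable def s8f (p : ℝ) (x n : ℕ+) : ℝ := if n = 1 then (x:ℝ) ^ (-1/p) else 0

lemma s8_jump (p lam : ℝ) (hl : 0 < lam) (x : ℕ+) :
    jumpP lam (s8f p x) ≤ if lam ≤ (x:ℝ) ^ (-1/p) then 1 else 0 := by
  unfold jumpP
  refine iSup_le fun J => iSup_le ?_
  rintro ⟨t, ht, hj⟩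
  have hc : (0:ℝ) ≤ (x:ℝ) ^ (-1/p) := by positivity
  have hne : ∀ j, j < J → s8f p x (t (j+1)) = 0 := by
    intro j h
    have h2 : t j < t (j+1) := ht (by simp; omega) (by simp; omega) (by omega)
    have : t (j+1) ≠ 1 := fun h3 => by rw [h3] at h2; exact absurd h2 not_lt_one
    simp [s8f, this]
  have hJ : J ≤ 1 := by
    by_contra h
    have h1 := hj 1 (by omega)
    rw [hne 1 (by omega), hne 0 (by omega)] at h1
    simp at h1; linarith
  rcases Nat.eq_zero_or_pos J with h | h
  · simp [h]
  · have h1 := hj 0 h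
    rw [hne 0 h] at h1
    have h4 : lam ≤ (x:ℝ) ^ (-1/p) := by
      refine h1.trans ?_
      unfold s8f
      split_ifs
      · rw [zero_sub, abs_neg, abs_of_nonneg hc]
      · simpa using hc
    rw [if_pos h4]
    exact_mod_cast hJ

lemma s8_upper (p : ℝ) (hp : 1 ≤ p) (lam : ℝ) (hl : 0 < lam) :
    ∑' x : ℕ+, (ENNReal.ofReal lam * jumpP lam (s8f p x) ^ ((1:ℝ)/2)) ^ p ≤ 1 := by
  have hp0 : 0 < p := by linarith
  have hlp : 0 < lam ^ p := Real.rpow_pos_of_pos hl p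
  let g : ℕ → ℝ≥0∞ := fun n => if (n:ℝ) ≤ (lam ^ p)⁻¹ then ENNReal.ofReal (lam ^ p) else 0
  have hle : ∀ x : ℕ+, (ENNReal.ofReal lam * jumpP lam (s8f p x) ^ ((1:ℝ)/2)) ^ p ≤ g x := by
    intro x
    have hx : (0:ℝ) < x := by exact_mod_cast x.pos
    have h := s8_jump p lam hl x
    split_ifs at h with hc
    · have h5 : (x:ℝ) ≤ (lam ^ p)⁻¹ := by
        have := Real.rpow_le_rpow hl.le hc hp0.le
        rw [← Real.rpow_mul hx.le, div_mul_cancel₀ _ hp0.ne', Real.rpow_neg_one] at this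
        exact (le_inv_comm₀ hlp hx).1 this
      have h6 : ((x:ℕ):ℝ) ≤ (lam ^ p)⁻¹ := h5
      simp only [g, if_pos h6]
      rw [← ENNReal.ofReal_rpow_of_pos hl]
      refine ENNReal.rpow_le_rpow ?_ hp0.le
      calc _ ≤ ENNReal.ofReal lam * 1 := by
            gcongr
            exact ENNReal.rpow_le_one h (by norm_num)
        _ = _ := mul_one _
    · have h0 : jumpP lam (s8f p x) = 0 := le_antisymm h zero_le
      rw [h0, ENNReal.zero_rpow_of_pos (by norm_num), mul_zero, ENNReal.zero_rpow_of_pos hp0]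
      exact zero_le
  refine (ENNReal.tsum_le_tsum hle).trans ?_
  rw [tsum_pnat_eq_tsum_succ (f := g)]
  set N := ⌊(lam ^ p)⁻¹⌋₊ with hN
  rw [tsum_eq_sum (s := Finset.range N)]
  · calc ∑ n ∈ Finset.range N, g (n+1) ≤ ∑ n ∈ Finset.range N, ENNReal.ofReal (lam ^ p) := by
          refine Finset.sum_le_sum fun n _ => ?_
          simp only [g]; split_ifs <;> simp
      _ = ENNReal.ofReal (N * lam ^ p) := by
          rw [Finset.sum_const, Finset.card_range, nsmul_eq_mul, ENNReal.ofReal_mul (by positivity),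
            ENNReal.ofReal_natCast]
      _ ≤ 1 := by
          rw [ENNReal.ofReal_le_one]
          have : (N:ℝ) ≤ (lam ^ p)⁻¹ := Nat.floor_le (by positivity)
          calc _ ≤ (lam ^ p)⁻¹ * lam ^ p := by gcongr
            _ = 1 := inv_mul_cancel₀ hlp.ne'
  · intro n hn
    simp only [Finset.mem_range, not_lt] at hn
    refine if_neg fun h => ?_
    have := Nat.le_floor h
    omega

/-- Lemma 2.4 of Mirek–Słomian–Szarek: the weak type space in inequality (2.14)
cannot be replaced by the strong `ℓ^p` space. -/
theorem stmt8 (p : ℝ) (hp : 1 ≤ p) :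
    ∃ f : ℕ+ → ℕ+ → ℝ,
      (∀ r : ℝ, 2 ≤ r → (∑' x : ℕ+, varP r (f x) ^ p) ^ (1/p) = ∞) ∧
      ((∑' x : ℕ+, varInfP (f x) ^ p) ^ (1/p) = ∞) ∧
      (⨆ (lam : ℝ) (_ : 0 < lam),
        (∑' x : ℕ+, (ENNReal.ofReal lam * jumpP lam (f x) ^ ((1:ℝ)/2)) ^ p) ^ (1/p)) < ∞ := by
  have hp0 : 0 < p := by linarith
  refine ⟨s8f p, fun r hr => s8_tsum p hp _ fun x => ?_, s8_tsum p hp _ fun x => ?_, ?_⟩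
  · have hr0 : r ≠ 0 := by linarith
    have hc : (0:ℝ) ≤ (x:ℝ) ^ (-1/p) := by positivity
    unfold varP
    refine le_iSup_of_le 1 (le_iSup_of_le one_pos (le_iSup_of_le Nat.succPNat
      (le_iSup_of_le (Nat.succPNat_strictMono.strictMonoOn _) ?_)))
    have h1 : s8f p x (Nat.succPNat 0) = (x:ℝ) ^ (-1/p) := if_pos rfl
    have h2 : s8f p x (Nat.succPNat (0+1)) = 0 := if_neg (by decide)
    rw [Finset.sum_range_one, h1, h2, zero_sub, abs_neg, abs_of_nonneg hc, one_div,
      ENNReal.rpow_rpow_inv hr0]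
  · have hc : (0:ℝ) ≤ (x:ℝ) ^ (-1/p) := by positivity
    unfold varInfP
    refine le_iSup_of_le 2 (le_iSup_of_le 1 ?_)
    have h1 : s8f p x 1 = (x:ℝ) ^ (-1/p) := if_pos rfl
    have h2 : s8f p x 2 = 0 := if_neg (by decide)
    rw [h1, h2, sub_zero, abs_of_nonneg hc]
  · refine lt_of_le_of_lt (iSup_le fun lam => iSup_le fun hl => ?_) ENNReal.one_lt_top
    exact ENNReal.rpow_le_one (s8_upper p hp lam hl) (by positivity)
end

section
/- For every fixed 1 ≤ p < ∞ there exists a function f : ℤ₊ × ℤ₊ → ℝ such that sup_{N ∈ ℤ₊} sup_{I ∈ 𝔖_N(ℤ₊)} ‖O^r_{I,N}(f(·,n) : n ∈ ℤ₊)‖_{ℓ^p(ℤ₊)} = ∞ for every 2 ≤ r ≤ ∞, while sup_{λ > 0} ‖λ · N_λ(f(·,n) : n ∈ ℤ₊)^{1/2}‖_{ℓ^p(ℤ₊)} < ∞. Thus λ-jump estimates with parameter r = 2 do not imply r-oscillation estimates with r ≥ 2 in the ℓ^p sense. -/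
open MeasureTheory ENNReal

/-- The finite oscillation seminorm `O^r_{I,N}(a_n : n ∈ ℤ₊)`. -/
noncomputable def oscP (r : ℝ) (N : ℕ) (I : ℕ → ℕ+) (a : ℕ+ → ℝ) : ℝ≥0∞ :=
  (∑ j ∈ Finset.range N,
    (⨆ t ∈ Set.Ico (I j) (I (j+1)), ENNReal.ofReal |a t - a (I j)|) ^ r) ^ (1/r)

/-- The `∞`-oscillation seminorm `O^∞_{I,N}(a_n : n ∈ ℤ₊)`. -/
noncomputable def oscInfP (N : ℕ) (I : ℕ → ℕ+) (a : ℕ+ → ℝ) : ℝ≥0∞ :=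
  ⨆ j ∈ Finset.range N, ⨆ t ∈ Set.Ico (I j) (I (j+1)), ENNReal.ofReal |a t - a (I j)|

/-- The counterexample: a single jump of height `x^{-1/p}` between times `1` and `2`. -/
noncomputable def exF (p : ℝ) (x n : ℕ+) : ℝ := if n = 1 then 0 else ((x : ℕ) : ℝ) ^ (-(1 / p))

def exI (j : ℕ) : ℕ+ := ⟨2 * j + 1, by omega⟩

lemma exI_mono : StrictMono exI := fun a b h => by
  rw [← PNat.coe_lt_coe]; simp [exI]; omega

lemma harm_top : (∑' x : ℕ+, ENNReal.ofReal (((x : ℕ) : ℝ)⁻¹)) = ∞ := by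
  by_contra h
  have h1 := ENNReal.summable_toReal h
  have h2 : Summable (fun x : ℕ+ => ((x : ℕ) : ℝ)⁻¹) := by
    refine h1.congr fun x => ?_
    rw [ENNReal.toReal_ofReal (by positivity)]
  rw [summable_pnat_iff_summable_nat (f := fun n : ℕ => (n : ℝ)⁻¹)] at h2
  exact Real.not_summable_natCast_inv h2

lemma exF_pow (p : ℝ) (hp : 1 ≤ p) (x : ℕ+) :
    ENNReal.ofReal (((x : ℕ) : ℝ) ^ (-(1 / p))) ^ p = ENNReal.ofReal (((x : ℕ) : ℝ)⁻¹) := by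
  rw [ENNReal.ofReal_rpow_of_nonneg (by positivity) (by linarith), ← Real.rpow_mul (by positivity)]
  have : -(1 / p) * p = -1 := by field_simp
  rw [this, Real.rpow_neg_one]

lemma sup_lower (p : ℝ) (x : ℕ+) :
    ENNReal.ofReal (((x : ℕ) : ℝ) ^ (-(1 / p))) ≤
      ⨆ t ∈ Set.Ico (exI 0) (exI (0+1)), ENNReal.ofReal |exF p x t - exF p x (exI 0)| := by
  have h2 : (2 : ℕ+) ∈ Set.Ico (exI 0) (exI (0+1)) := by
    constructor
    · rw [← PNat.coe_le_coe]; simp [exI]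
    · rw [← PNat.coe_lt_coe]; simp [exI]
  refine le_trans ?_ (le_iSup₂ (f := fun t (_ : t ∈ Set.Ico (exI 0) (exI (0+1))) =>
    ENNReal.ofReal |exF p x t - exF p x (exI 0)|) 2 h2)
  have h0 : exI 0 = 1 := rfl
  have h21 : (2 : ℕ+) ≠ 1 := by decide
  rw [h0]
  simp only [exF, if_true, h21, if_false, sub_zero]
  exact ENNReal.ofReal_le_ofReal (le_abs_self _)

lemma top_of (p : ℝ) (hp : 1 ≤ p) (G : ℕ → (ℕ → ℕ+) → (ℕ+ → ℝ) → ℝ≥0∞)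
    (hG : ∀ x : ℕ+, ENNReal.ofReal (((x : ℕ) : ℝ) ^ (-(1 / p))) ≤ G 1 exI (exF p x)) :
    (⨆ (N : ℕ) (_ : 0 < N) (I : ℕ → ℕ+) (_ : StrictMonoOn I (Set.Iic N)),
          (∑' x : ℕ+, G N I (exF p x) ^ p) ^ (1/p)) = ∞ := by
  rw [eq_top_iff]
  refine le_trans ?_ (le_iSup₂_of_le 1 one_pos (le_iSup₂_of_le exI (exI_mono.strictMonoOn _) le_rfl))
  have : (∑' x : ℕ+, G 1 exI (exF p x) ^ p) = ∞ := by
    rw [eq_top_iff, ← harm_top]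
    refine ENNReal.tsum_le_tsum fun x => ?_
    rw [← exF_pow p hp]
    exact ENNReal.rpow_le_rpow (hG x) (by linarith)
  rw [this, ENNReal.top_rpow_of_pos (by positivity)]

lemma jump_le (p lam : ℝ) (hl : 0 < lam) (x : ℕ+) :
    jumpP lam (exF p x) ≤ if lam ≤ ((x : ℕ) : ℝ) ^ (-(1 / p)) then 1 else 0 := by
  refine iSup₂_le fun J hJ => ?_
  obtain ⟨t, ht, hj⟩ := hJ
  have hx : (0:ℝ) < ((x : ℕ) : ℝ) ^ (-(1 / p)) := by
    have : (0:ℝ) < ((x : ℕ) : ℝ) := by exact_mod_cast x.pos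
    positivity
  have key : ∀ i < J, lam ≤ ((x : ℕ) : ℝ) ^ (-(1 / p)) ∧ i = 0 := by
    intro i hi
    have h1 := hj i hi
    have hlt : t i < t (i+1) := ht (by simp; omega) (by simp; omega) (by omega)
    have hne : t (i+1) ≠ 1 := fun h => by rw [h] at hlt; exact (PNat.one_le _).not_gt hlt
    by_cases hi1 : t i = 1
    · simp only [exF, hi1, hne, if_true, if_false, sub_zero, abs_of_pos hx] at h1
      refine ⟨h1, ?_⟩
      by_contra h0
      have : t 0 < t i := ht (by simp) (by simp; omega) (by omega)
      rw [hi1] at this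
      exact (PNat.one_le _).not_gt this
    · simp only [exF, hi1, hne, if_false, sub_self, abs_zero] at h1
      linarith
  have hJ1 : J ≤ 1 := by
    by_contra h
    have := (key 1 (by omega)).2
    omega
  split_ifs with h
  · exact_mod_cast hJ1
  · have : J = 0 := by
      by_contra h'
      exact h (key 0 (by omega)).1
    simp [this]

lemma le_iff_aux (p : ℝ) (hp : 1 ≤ p) (lam : ℝ) (hl : 0 < lam) (x : ℕ+)
    (h : lam ≤ ((x : ℕ) : ℝ) ^ (-(1 / p))) : ((x : ℕ) : ℝ) * lam ^ p ≤ 1 := by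
  have hx : (0:ℝ) < ((x : ℕ) : ℝ) := by exact_mod_cast x.pos
  have h1 := Real.rpow_le_rpow hl.le h (by linarith : 0 ≤ p)
  rw [← Real.rpow_mul hx.le] at h1
  have : -(1 / p) * p = -1 := by field_simp
  rw [this, Real.rpow_neg_one] at h1
  calc _ ≤ ((x : ℕ) : ℝ) * ((x : ℕ) : ℝ)⁻¹ := by gcongr
    _ = 1 := by field_simp

lemma sum_le (p : ℝ) (hp : 1 ≤ p) (lam : ℝ) (hl : 0 < lam) :
    (∑' x : ℕ+, (ENNReal.ofReal lam * jumpP lam (exF p x) ^ ((1:ℝ)/2)) ^ p) ≤ 1 := by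
  have hp0 : 0 < p := by linarith
  have h1 : ∀ x : ℕ+, (ENNReal.ofReal lam * jumpP lam (exF p x) ^ ((1:ℝ)/2)) ^ p ≤
      if lam ≤ ((x : ℕ) : ℝ) ^ (-(1 / p)) then ENNReal.ofReal (lam ^ p) else 0 := by
    intro x
    have h := jump_le p lam hl x
    split_ifs at h ⊢ with hc
    · rw [← ENNReal.ofReal_rpow_of_pos hl]
      refine ENNReal.rpow_le_rpow ?_ hp0.le
      calc _ ≤ ENNReal.ofReal lam * 1 ^ ((1:ℝ)/2) := by gcongr
        _ = _ := by simp
    · rw [nonpos_iff_eq_zero.1 h, ENNReal.zero_rpow_of_pos (by norm_num), mul_zero,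
        ENNReal.zero_rpow_of_pos hp0]
  refine (ENNReal.tsum_le_tsum h1).trans ?_
  rw [ENNReal.tsum_eq_iSup_sum]
  refine iSup_le fun s => ?_
  rw [← Finset.sum_filter, Finset.sum_const, nsmul_eq_mul]
  set s' := s.filter (fun x : ℕ+ => lam ≤ ((x : ℕ) : ℝ) ^ (-(1 / p))) with hs'
  rcases s'.eq_empty_or_nonempty with he | hne
  · simp [he]
  · have hm := s'.max'_mem hne
    set m := s'.max' hne
    have hml := le_iff_aux p hp lam hl m (Finset.mem_filter.1 hm).2
    have hsub : s' ⊆ Finset.Icc 1 m := fun y hy =>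
      Finset.mem_Icc.2 ⟨PNat.one_le _, s'.le_max' y hy⟩
    have hc : s'.card ≤ (m : ℕ) := by
      have := Finset.card_le_card hsub
      rwa [PNat.card_Icc, PNat.one_coe, Nat.add_sub_cancel] at this
    calc (s'.card : ℝ≥0∞) * ENNReal.ofReal (lam ^ p)
        ≤ ((m : ℕ) : ℝ≥0∞) * ENNReal.ofReal (lam ^ p) := by gcongr
      _ = ENNReal.ofReal (((m : ℕ) : ℝ) * lam ^ p) := by
        rw [ENNReal.ofReal_mul (by positivity), ENNReal.ofReal_natCast]
      _ ≤ 1 := by rw [← ENNReal.ofReal_one]; exact ENNReal.ofReal_le_ofReal hml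

/-- λ-jump estimates with parameter `2` do not imply `r`-oscillation estimates,
`r ≥ 2`, in the `ℓ^p` sense (remark after Lemma 2.4 of Mirek–Słomian–Szarek). -/
theorem stmt9 (p : ℝ) (hp : 1 ≤ p) :
    ∃ f : ℕ+ → ℕ+ → ℝ,
      (∀ r : ℝ, 2 ≤ r →
        (⨆ (N : ℕ) (_ : 0 < N) (I : ℕ → ℕ+) (_ : StrictMonoOn I (Set.Iic N)),
          (∑' x : ℕ+, oscP r N I (f x) ^ p) ^ (1/p)) = ∞) ∧
      ((⨆ (N : ℕ) (_ : 0 < N) (I : ℕ → ℕ+) (_ : StrictMonoOn I (Set.Iic N)),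
          (∑' x : ℕ+, oscInfP N I (f x) ^ p) ^ (1/p)) = ∞) ∧
      (⨆ (lam : ℝ) (_ : 0 < lam),
        (∑' x : ℕ+, (ENNReal.ofReal lam * jumpP lam (f x) ^ ((1:ℝ)/2)) ^ p) ^ (1/p)) < ∞ := by
  refine ⟨exF p, fun r hr => ?_, ?_, ?_⟩
  · refine top_of p hp (oscP r) fun x => ?_
    rw [oscP, Finset.sum_range_one, ← ENNReal.rpow_mul, mul_one_div_cancel (by linarith),
      ENNReal.rpow_one]
    exact sup_lower p x
  · refine top_of p hp oscInfP fun x => ?_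
    exact (sup_lower p x).trans (le_iSup₂_of_le 0 (by simp) le_rfl)
  · refine lt_of_le_of_lt (iSup₂_le fun lam hl => ?_) ENNReal.one_lt_top
    calc _ ≤ (1 : ℝ≥0∞) ^ (1 / p) := ENNReal.rpow_le_rpow (sum_le p hp lam hl) (by positivity)
      _ = 1 := by simp
end

section
/- Let (X, 𝓑(X), μ) be a σ-finite measure space and 𝕀 ⊆ ℝ. Fix p ∈ [1, ∞] and 1 ≤ ρ < r ≤ ∞. Then there exists a constant C depending only on p, ρ, r such that for every measurable function f : X × 𝕀 → ℂ: sup_{I ∈ 𝔖_∞(𝕀)} ‖O^r_{I,∞}(f(·,t) : t ∈ 𝕀)‖_{L^{p,∞}(X)} ≤ C · sup_{I ∈ 𝔖_∞(𝕀)} sup_{λ > 0} ‖λ · N_{λ,I}(f(·,t) : t ∈ 𝕀)^{1/ρ}‖_{L^{p,∞}(X)}. -/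
open MeasureTheory ENNReal

/-- The oscillation seminorm `O^r_{I,∞}(a_t : t ∈ S)` for `r ∈ [1,∞]`
(for `r = ∞` the `ℓ^r` sum is replaced by a supremum). -/
noncomputable def oscE (r : ℝ≥0∞) (I : ℕ → ℝ) (S : Set ℝ) (a : ℝ → ℂ) : ℝ≥0∞ :=
  if r = ∞ then
    ⨆ (j : ℕ), ⨆ t ∈ Set.Ico (I j) (I (j+1)) ∩ S, ENNReal.ofReal ‖a t - a (I j)‖
  else
    (∑' j : ℕ, (⨆ t ∈ Set.Ico (I j) (I (j+1)) ∩ S,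
      ENNReal.ofReal ‖a t - a (I j)‖) ^ r.toReal) ^ (1/r.toReal)

/-- The sequential `λ`-jump counting function `N_{λ,I}(a_t : t ∈ S)`. -/
noncomputable def seqJumpR (lam : ℝ) (I : ℕ → ℝ) (S : Set ℝ) (a : ℝ → ℂ) : ℝ≥0∞ :=
  Measure.count {k : ℕ | ENNReal.ofReal lam ≤
    ⨆ t ∈ Set.Ico (I k) (I (k+1)) ∩ S, ENNReal.ofReal ‖a t - a (I k)‖}

/-- The weak `L^{p,∞}` quasi-norm of an `ℝ≥0∞`-valued function, `p ∈ [1,∞]`. -/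
noncomputable def weakLp {X : Type*} [MeasurableSpace X] (p : ℝ≥0∞) (μ : Measure X)
    (g : X → ℝ≥0∞) : ℝ≥0∞ :=
  if p = ∞ then essSup g μ
  else ⨆ (α : ℝ) (_ : 0 < α),
    ENNReal.ofReal α * μ {x | ENNReal.ofReal α < g x} ^ (1/p.toReal)

lemma count_eq_tsum_aux (s : Set ℕ) :
    (Measure.count s : ℝ≥0∞) = ∑' k, s.indicator (fun _ => (1 : ℝ≥0∞)) k := by
  rw [← lintegral_count, lintegral_indicator (MeasurableSet.of_discrete)]
  simp

lemma exists_dyadic_aux (a A : ℝ≥0∞) (hA : A ≠ ∞) (h0 : a ≠ 0) (h : a < A) :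
    ∃ n : ℕ, A * 2⁻¹ ^ (n + 1) ≤ a ∧ a ≤ A * 2⁻¹ ^ n := by
  have ht : Filter.Tendsto (fun n : ℕ => A * 2⁻¹ ^ n) Filter.atTop (nhds 0) := by
    have := ENNReal.Tendsto.const_mul (a := A)
      (ENNReal.tendsto_pow_atTop_nhds_zero_of_lt_one (r := 2⁻¹) (by simp)) (Or.inr hA)
    simpa using this
  have hex : ∃ n : ℕ, A * 2⁻¹ ^ n < a :=
    (ht.eventually_lt_const (pos_iff_ne_zero.2 h0)).exists
  classical
  have hs := Nat.find_spec hex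
  obtain ⟨m, hm⟩ : ∃ m, Nat.find hex = m + 1 := by
    apply Nat.exists_eq_succ_of_ne_zero
    intro h'
    rw [h'] at hs
    simp at hs
    exact absurd hs (not_lt.2 h.le)
  refine ⟨m, ?_, ?_⟩
  · rw [← hm]; exact hs.le
  · exact not_lt.1 (Nat.find_min hex (m := m) (by omega))

lemma key_aux (a : ℕ → ℝ≥0∞) (A c θ : ℝ≥0∞) (hA0 : A ≠ 0) (hA : A ≠ ∞)
    (ρ R : ℝ) (hρ : 1 ≤ ρ) (hR : ρ < R) (hc : c < 1)
    (hsum : c ^ ρ * (2 * θ) ^ ρ * ∑' n : ℕ, ((2 * θ) ^ ρ * 2⁻¹ ^ R) ^ n ≤ 1)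
    (hN : ∀ n : ℕ, (A * 2⁻¹ ^ n) * (Measure.count {k | A * 2⁻¹ ^ n ≤ a k}) ^ (1 / ρ)
      ≤ c * θ ^ n * A) :
    (∑' j, a j ^ R) ^ (1 / R) ≤ A := by
  have hρ0 : 0 < ρ := by linarith
  have hR0 : 0 < R := by linarith
  have hlt : ∀ j, a j < A := by
    intro j
    by_contra hj
    have h1 := hN 0
    simp only [pow_zero, mul_one] at h1
    rw [mul_comm c A] at h1
    have h2 := (ENNReal.mul_le_mul_iff_right hA0 hA).1 h1
    have h3 : (1 : ℝ≥0∞) ≤ Measure.count {k | A ≤ a k} := by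
      calc (1 : ℝ≥0∞) = Measure.count {j} := by simp
        _ ≤ _ := measure_mono (by simpa using hj)
    have h4 : (1 : ℝ≥0∞) ≤ (Measure.count {k | A ≤ a k}) ^ (1 / ρ) :=
      ENNReal.one_le_rpow h3 (by positivity)
    exact absurd (h4.trans h2) (not_le.2 hc)
  have hcnt : ∀ n : ℕ, (Measure.count {k | A * 2⁻¹ ^ n ≤ a k} : ℝ≥0∞)
      ≤ (c * (2 * θ) ^ n) ^ ρ := by
    intro n
    have h1 := hN n
    have h2 : (Measure.count {k | A * 2⁻¹ ^ n ≤ a k} : ℝ≥0∞) ^ (1 / ρ) ≤ c * (2 * θ) ^ n := by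
      have h3 : A * 2⁻¹ ^ n ≠ 0 := by simp [hA0]
      have h4 : A * 2⁻¹ ^ n ≠ ∞ := ENNReal.mul_ne_top hA (by finiteness)
      rw [← ENNReal.mul_le_mul_iff_right h3 h4]
      refine h1.trans (le_of_eq ?_)
      have h5 : (2⁻¹ : ℝ≥0∞) ^ n * 2 ^ n = 1 := by
        rw [← mul_pow, ENNReal.inv_mul_cancel (by simp) (by simp), one_pow]
      calc c * θ ^ n * A = c * θ ^ n * A * (2⁻¹ ^ n * 2 ^ n) := by rw [h5, mul_one]
        _ = _ := by rw [mul_pow]; ring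
    calc (Measure.count {k | A * 2⁻¹ ^ n ≤ a k} : ℝ≥0∞)
        = ((Measure.count {k | A * 2⁻¹ ^ n ≤ a k} : ℝ≥0∞) ^ (1 / ρ)) ^ ρ := by
          rw [← ENNReal.rpow_mul, one_div_mul_cancel hρ0.ne', ENNReal.rpow_one]
      _ ≤ _ := ENNReal.rpow_le_rpow h2 hρ0.le
  have hpt : ∀ j, a j ^ R ≤ ∑' n : ℕ, (A * 2⁻¹ ^ n) ^ R *
      ({k | A * 2⁻¹ ^ (n + 1) ≤ a k} : Set ℕ).indicator (fun _ => (1 : ℝ≥0∞)) j := by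
    intro j
    by_cases h0 : a j = 0
    · simp [h0, hR0]
    obtain ⟨n, hn1, hn2⟩ := exists_dyadic_aux (a j) A hA h0 (hlt j)
    refine le_trans ?_ (ENNReal.le_tsum n)
    rw [Set.indicator_of_mem (by exact hn1), mul_one]
    exact ENNReal.rpow_le_rpow hn2 hR0.le
  have hmain : ∑' j, a j ^ R ≤ A ^ R := by
    calc ∑' j, a j ^ R ≤ ∑' j, ∑' n : ℕ, (A * 2⁻¹ ^ n) ^ R *
          ({k | A * 2⁻¹ ^ (n + 1) ≤ a k} : Set ℕ).indicator (fun _ => (1 : ℝ≥0∞)) j :=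
          ENNReal.tsum_le_tsum hpt
      _ = ∑' n : ℕ, (A * 2⁻¹ ^ n) ^ R * Measure.count {k | A * 2⁻¹ ^ (n + 1) ≤ a k} := by
          rw [ENNReal.tsum_comm]
          refine tsum_congr fun n => ?_
          rw [ENNReal.tsum_mul_left, count_eq_tsum_aux]
      _ ≤ ∑' n : ℕ, (A * 2⁻¹ ^ n) ^ R * (c * (2 * θ) ^ (n + 1)) ^ ρ :=
          ENNReal.tsum_le_tsum fun n => by gcongr; exact hcnt (n + 1)
      _ = ∑' n : ℕ, A ^ R * (c ^ ρ * (2 * θ) ^ ρ) * ((2 * θ) ^ ρ * 2⁻¹ ^ R) ^ n := by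
          refine tsum_congr fun n => ?_
          have e : ∀ (x : ℝ≥0∞) (s : ℝ) (hs : 0 ≤ s), (x ^ n) ^ s = (x ^ s) ^ n := by
            intro x s hs
            rw [← ENNReal.rpow_natCast, ← ENNReal.rpow_natCast, ← ENNReal.rpow_mul,
              ← ENNReal.rpow_mul, mul_comm]
          rw [ENNReal.mul_rpow_of_nonneg _ _ hR0.le, ENNReal.mul_rpow_of_nonneg _ _ hρ0.le,
            pow_succ, ENNReal.mul_rpow_of_nonneg _ _ hρ0.le, e _ _ hR0.le, e _ _ hρ0.le, mul_pow]
          ring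
      _ = A ^ R * (c ^ ρ * (2 * θ) ^ ρ * ∑' n : ℕ, ((2 * θ) ^ ρ * 2⁻¹ ^ R) ^ n) := by
          rw [ENNReal.tsum_mul_left, mul_assoc]
      _ ≤ A ^ R := mul_le_of_le_one_right' hsum
  calc (∑' j, a j ^ R) ^ (1 / R) ≤ (A ^ R) ^ (1 / R) :=
        ENNReal.rpow_le_rpow hmain (by positivity)
    _ = A := by rw [← ENNReal.rpow_mul, mul_one_div_cancel hR0.ne', ENNReal.rpow_one]

/-- choice of the constants -/
lemma const_aux (ρ R : ℝ) (hρ : 1 ≤ ρ) (hR : ρ < R) :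
    ∃ c θ : ℝ, 0 < c ∧ c < 1 ∧ 1 < θ ∧
      ENNReal.ofReal c ^ ρ * (2 * ENNReal.ofReal θ) ^ ρ *
        ∑' n : ℕ, ((2 * ENNReal.ofReal θ) ^ ρ * 2⁻¹ ^ R) ^ n ≤ 1 := by
  have hρ0 : 0 < ρ := by linarith
  set ε : ℝ := (R - ρ) / (2 * ρ) with hε
  have hε0 : 0 < ε := div_pos (by linarith) (by linarith)
  have hθ : 1 < (2 : ℝ) ^ ε := Real.one_lt_rpow (by norm_num) hε0
  set q : ℝ≥0∞ := (2 * ENNReal.ofReal ((2 : ℝ) ^ ε)) ^ ρ * 2⁻¹ ^ R with hq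
  have e1 : 2 * ENNReal.ofReal ((2 : ℝ) ^ ε) = (2 : ℝ≥0∞) ^ (1 + ε) := by
    rw [← ENNReal.ofReal_rpow_of_pos (by norm_num), ENNReal.rpow_add _ _ (by simp) (by simp)]
    simp
  have hq1 : q < 1 := by
    rw [hq, e1, ← ENNReal.rpow_mul, ENNReal.inv_rpow, ← ENNReal.rpow_neg,
      ← ENNReal.rpow_add _ _ (by simp) (by simp)]
    apply ENNReal.rpow_lt_one_of_one_lt_of_neg (by norm_num)
    have : ε * ρ = (R - ρ) / 2 := by rw [hε]; field_simp
    nlinarith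
  set B : ℝ≥0∞ := (2 * ENNReal.ofReal ((2 : ℝ) ^ ε)) ^ ρ * ∑' n : ℕ, q ^ n with hB
  have hBt : B ≠ ∞ := by
    rw [hB, ENNReal.tsum_geometric]
    refine ENNReal.mul_ne_top (by finiteness) ?_
    rw [Ne, ENNReal.inv_eq_top]
    exact (tsub_pos_of_lt hq1).ne'
  have hb0 : 0 ≤ B.toReal := ENNReal.toReal_nonneg
  refine ⟨1 / (2 + B.toReal), 2 ^ ε, by positivity, ?_, hθ, ?_⟩
  · rw [div_lt_one (by positivity)]; linarith
  · rw [mul_assoc, ← hq, ← hB]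
    set c : ℝ := 1 / (2 + B.toReal) with hc
    have hc1 : c ≤ 1 := by rw [hc, div_le_one (by positivity)]; linarith
    have h1 : ENNReal.ofReal c ^ ρ ≤ ENNReal.ofReal c :=
      ENNReal.rpow_le_self_of_le_one (by simpa using hc1) hρ
    calc ENNReal.ofReal c ^ ρ * B ≤ ENNReal.ofReal c * B := by gcongr
      _ = ENNReal.ofReal (c * B.toReal) := by
          rw [ENNReal.ofReal_mul (by positivity), ENNReal.ofReal_toReal hBt]
      _ ≤ 1 := by
          rw [ENNReal.ofReal_le_one, hc, one_div_mul_eq_div, div_le_one (by positivity)]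
          linarith

lemma weakLp_mono_aux {X : Type*} [MeasurableSpace X] (p : ℝ≥0∞) (μ : Measure X)
    (g h : X → ℝ≥0∞) (hgh : ∀ x, g x ≤ h x) : weakLp p μ g ≤ weakLp p μ h := by
  unfold weakLp
  split_ifs with hp
  · exact essSup_mono_ae (Filter.Eventually.of_forall hgh)
  · refine iSup₂_mono fun α hα => ?_
    gcongr with x
    exact hgh x

lemma osc_inf_le_aux (R : ℝ) (hR : 0 < R) (I : ℕ → ℝ) (S : Set ℝ) (a : ℝ → ℂ) :
    oscE ∞ I S a ≤ oscE (ENNReal.ofReal R) I S a := by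
  unfold oscE
  rw [if_pos rfl, if_neg ENNReal.ofReal_ne_top, ENNReal.toReal_ofReal hR.le]
  refine iSup_le fun j => ?_
  set b : ℕ → ℝ≥0∞ := fun j => ⨆ t ∈ Set.Ico (I j) (I (j+1)) ∩ S,
      ENNReal.ofReal ‖a t - a (I j)‖ with hb
  change b j ≤ (∑' j, b j ^ R) ^ (1 / R)
  calc b j = (b j ^ R) ^ (1 / R) := by
        rw [← ENNReal.rpow_mul, mul_one_div_cancel hR.ne', ENNReal.rpow_one]
    _ ≤ _ := ENNReal.rpow_le_rpow (ENNReal.le_tsum j) (by positivity)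

/-- the finite `r` case for a single sequence -/
lemma main_aux (p : ℝ≥0∞) (hp : 1 ≤ p) (ρ R : ℝ) (hρ : 1 ≤ ρ) (hR : ρ < R) :
    ∃ C : ℝ, 0 < C ∧
      ∀ (X : Type) [MeasurableSpace X] (μ : Measure X)
      (S : Set ℝ) (f : X → ℝ → ℂ) (I : ℕ → ℝ) (M : ℝ≥0∞),
      (∀ lam : ℝ, 0 < lam →
        weakLp p μ (fun x => ENNReal.ofReal lam * seqJumpR lam I S (f x) ^ (1/ρ)) ≤ M) →
      weakLp p μ (fun x => oscE (ENNReal.ofReal R) I S (f x)) ≤ ENNReal.ofReal C * M := by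
  obtain ⟨c, θ, hc0, hc1, hθ, hsum⟩ := const_aux ρ R hρ hR
  have hρ0 : 0 < ρ := by linarith
  have hR0 : 0 < R := by linarith
  have hθ0 : 0 < θ := by linarith
  -- the bad sets cover
  have hcover : ∀ (X : Type) (S : Set ℝ) (f : X → ℝ → ℂ) (I : ℕ → ℝ) (α : ℝ), 0 < α →
      {x | ENNReal.ofReal α < oscE (ENNReal.ofReal R) I S (f x)} ⊆
        ⋃ n : ℕ, {x | ENNReal.ofReal (c * θ ^ n * α) <
          ENNReal.ofReal (α * 2⁻¹ ^ n) * seqJumpR (α * 2⁻¹ ^ n) I S (f x) ^ (1/ρ)} := by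
    intro X S f I α hα x hx
    by_contra hcon
    simp only [Set.mem_iUnion, Set.mem_ofPred_eq, not_exists, not_lt] at hcon
    rw [Set.mem_ofPred_eq] at hx
    refine absurd hx (not_lt.2 ?_)
    unfold oscE
    rw [if_neg ENNReal.ofReal_ne_top, ENNReal.toReal_ofReal hR0.le]
    refine key_aux _ (ENNReal.ofReal α) (ENNReal.ofReal c) (ENNReal.ofReal θ) (by simpa using hα)
      ENNReal.ofReal_ne_top ρ R hρ hR (by simpa using hc1) hsum ?_
    intro n
    have h2 : ENNReal.ofReal (α * 2⁻¹ ^ n) = ENNReal.ofReal α * 2⁻¹ ^ n := by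
      rw [ENNReal.ofReal_mul hα.le, ENNReal.ofReal_pow (by norm_num),
        ENNReal.ofReal_inv_of_pos (by norm_num)]
      simp
    have h3 : ENNReal.ofReal (c * θ ^ n * α)
        = ENNReal.ofReal c * ENNReal.ofReal θ ^ n * ENNReal.ofReal α := by
      rw [ENNReal.ofReal_mul (by positivity), ENNReal.ofReal_mul hc0.le, ENNReal.ofReal_pow hθ0.le]
    have h4 := hcon n
    unfold seqJumpR at h4
    rw [h3, h2] at h4
    exact h4
  by_cases hpt : p = ∞
  · refine ⟨1 / c, by positivity, ?_⟩
    intro X _ μ S f I M hM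
    unfold weakLp at hM ⊢
    simp only [if_pos hpt] at hM ⊢
    refine le_of_forall_gt_imp_ge_of_dense fun b hb => ?_
    rcases eq_or_ne b ∞ with rfl | hbt
    · exact le_top
    have hb0 : 0 < b.toReal := ENNReal.toReal_pos (pos_of_gt hb).ne' hbt
    have hb' : ENNReal.ofReal b.toReal = b := ENNReal.ofReal_toReal hbt
    refine essSup_le_of_ae_le b ?_
    rw [Filter.EventuallyLE, ae_iff]
    simp only [not_le]
    rw [← hb']
    refine measure_mono_null (hcover X S f I b.toReal hb0) (measure_iUnion_null fun n => ?_)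
    have h1 := hM (b.toReal * 2⁻¹ ^ n) (by positivity)
    have h2 : M ≤ ENNReal.ofReal (c * θ ^ n * b.toReal) := by
      calc M = ENNReal.ofReal c * (ENNReal.ofReal (1 / c) * M) := by
            rw [← mul_assoc, ← ENNReal.ofReal_mul hc0.le, mul_one_div_cancel hc0.ne']; simp
        _ ≤ ENNReal.ofReal c * b := by gcongr
        _ = ENNReal.ofReal (c * b.toReal) := by rw [ENNReal.ofReal_mul hc0.le, hb']
        _ ≤ _ := by
          apply ENNReal.ofReal_le_ofReal
          have : 1 ≤ θ ^ n := one_le_pow₀ hθ.le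
          have h5 : 0 < c * b.toReal := by positivity
          nlinarith
    have h3 := ENNReal.ae_le_essSup (μ := μ) (fun x => ENNReal.ofReal (b.toReal * 2⁻¹ ^ n) *
      seqJumpR (b.toReal * 2⁻¹ ^ n) I S (f x) ^ (1/ρ))
    have h4 := h3.mono (fun x hx => hx.trans (h1.trans h2))
    rw [ae_iff] at h4
    simpa only [not_le] using h4
  · have hP0 : 0 < p.toReal := ENNReal.toReal_pos (by positivity) hpt
    set P := p.toReal with hP
    set L : ℝ≥0∞ := ∑' n : ℕ, ((ENNReal.ofReal θ)⁻¹ ^ P) ^ n with hL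
    have hLt : L ≠ ∞ := by
      rw [hL, ENNReal.tsum_geometric, Ne, ENNReal.inv_eq_top]
      refine (tsub_pos_of_lt (ENNReal.rpow_lt_one ?_ hP0)).ne'
      rw [ENNReal.inv_lt_one]
      simpa using hθ
    have hL1 : 1 ≤ L := by
      refine le_trans ?_ (ENNReal.le_tsum 0)
      simp
    have hLP : L ^ (1 / P) ≠ ∞ := ENNReal.rpow_ne_top_of_nonneg (by positivity) hLt
    have hLP0 : L ^ (1 / P) ≠ 0 := by
      have := ENNReal.one_le_rpow hL1 (z := 1 / P) (by positivity)
      exact (lt_of_lt_of_le one_pos this).ne'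
    refine ⟨c⁻¹ * (L ^ (1 / P)).toReal,
      mul_pos (by positivity) (ENNReal.toReal_pos hLP0 hLP), ?_⟩
    intro X _ μ S f I M hM
    unfold weakLp at hM ⊢
    simp only [if_neg hpt] at hM ⊢
    refine iSup₂_le fun α hα => ?_
    have hA0 : ENNReal.ofReal α ≠ 0 := by simpa using hα
    have hAt : ENNReal.ofReal α ≠ ∞ := ENNReal.ofReal_ne_top
    have hE : ∀ n : ℕ, μ {x | ENNReal.ofReal (c * θ ^ n * α) <
          ENNReal.ofReal (α * 2⁻¹ ^ n) * seqJumpR (α * 2⁻¹ ^ n) I S (f x) ^ (1/ρ)} ≤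
          (M * (ENNReal.ofReal (c * α))⁻¹) ^ P * ((ENNReal.ofReal θ)⁻¹ ^ P) ^ n := by
      intro n
      have hβ : 0 < c * θ ^ n * α := by positivity
      have h1 := (le_iSup₂ (f := fun (β : ℝ) (_ : 0 < β) => ENNReal.ofReal β *
        μ {x | ENNReal.ofReal β < ENNReal.ofReal (α * 2⁻¹ ^ n) *
          seqJumpR (α * 2⁻¹ ^ n) I S (f x) ^ (1/ρ)} ^ (1 / P)) _ hβ).trans
        (hM (α * 2⁻¹ ^ n) (by positivity))
      set m := μ {x | ENNReal.ofReal (c * θ ^ n * α) <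
          ENNReal.ofReal (α * 2⁻¹ ^ n) * seqJumpR (α * 2⁻¹ ^ n) I S (f x) ^ (1/ρ)} with hm
      have h2 : m ^ (1 / P) ≤ M * (ENNReal.ofReal (c * α))⁻¹ * (ENNReal.ofReal θ)⁻¹ ^ n := by
        have h3 : m ^ (1 / P) ≤ M / ENNReal.ofReal (c * θ ^ n * α) := by
          rw [ENNReal.le_div_iff_mul_le (Or.inl (by simpa using hβ)) (Or.inl ENNReal.ofReal_ne_top),
            mul_comm]
          exact h1
        refine h3.trans (le_of_eq ?_)
        have h4 : c * θ ^ n * α = (c * α) * θ ^ n := by ring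
        rw [h4, ENNReal.ofReal_mul (by positivity), ENNReal.ofReal_pow hθ0.le, div_eq_mul_inv,
          ENNReal.mul_inv (Or.inr (by finiteness)) (Or.inl ENNReal.ofReal_ne_top), ENNReal.inv_pow,
          mul_assoc]
      calc m = (m ^ (1 / P)) ^ P := by
            rw [← ENNReal.rpow_mul, one_div_mul_cancel hP0.ne', ENNReal.rpow_one]
        _ ≤ (M * (ENNReal.ofReal (c * α))⁻¹ * (ENNReal.ofReal θ)⁻¹ ^ n) ^ P :=
            ENNReal.rpow_le_rpow h2 hP0.le
        _ = _ := by
            rw [ENNReal.mul_rpow_of_nonneg _ _ hP0.le]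
            congr 1
            rw [← ENNReal.rpow_natCast, ← ENNReal.rpow_natCast, ← ENNReal.rpow_mul,
              ← ENNReal.rpow_mul, mul_comm]
    have htot : μ {x | ENNReal.ofReal α < oscE (ENNReal.ofReal R) I S (f x)} ≤
        (M * (ENNReal.ofReal (c * α))⁻¹) ^ P * L := by
      refine (measure_mono (hcover X S f I α hα)).trans ((measure_iUnion_le _).trans ?_)
      rw [hL, ← ENNReal.tsum_mul_left]
      exact ENNReal.tsum_le_tsum hE
    calc _ ≤ ENNReal.ofReal α * ((M * (ENNReal.ofReal (c * α))⁻¹) ^ P * L) ^ (1 / P) := by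
          gcongr
      _ = ENNReal.ofReal α * (M * (ENNReal.ofReal (c * α))⁻¹ * L ^ (1 / P)) := by
          rw [ENNReal.mul_rpow_of_nonneg _ _ (by positivity), ← ENNReal.rpow_mul,
            mul_one_div_cancel hP0.ne', ENNReal.rpow_one]
      _ = (ENNReal.ofReal α * (ENNReal.ofReal α)⁻¹) *
            ((ENNReal.ofReal c)⁻¹ * L ^ (1 / P) * M) := by
          rw [ENNReal.ofReal_mul hc0.le, ENNReal.mul_inv (Or.inr hAt) (Or.inl ENNReal.ofReal_ne_top)]
          ring
      _ = _ := by
          rw [ENNReal.mul_inv_cancel hA0 hAt, one_mul, ENNReal.ofReal_mul (by positivity),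
            ENNReal.ofReal_toReal hLP, ENNReal.ofReal_inv_of_pos hc0]

/-- Lemma 4.2 of Mirek–Słomian–Szarek: weak type oscillation estimates follow from
uniform sequential jump estimates. -/
theorem stmt10 (p : ℝ≥0∞) (hp : 1 ≤ p) (ρ : ℝ) (r : ℝ≥0∞) (hρ : 1 ≤ ρ)
    (hρr : ENNReal.ofReal ρ < r) :
    ∃ C : ℝ, 0 < C ∧
      ∀ (X : Type) [MeasurableSpace X] (μ : Measure X), SigmaFinite μ →
      ∀ (S : Set ℝ) (f : X → ℝ → ℂ), Measurable (fun q : X × ℝ => f q.1 q.2) →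
      (⨆ (I : ℕ → ℝ) (_ : StrictMono I) (_ : ∀ n, I n ∈ S),
          weakLp p μ (fun x => oscE r I S (f x)))
        ≤ ENNReal.ofReal C *
          ⨆ (I : ℕ → ℝ) (_ : StrictMono I) (_ : ∀ n, I n ∈ S) (lam : ℝ) (_ : 0 < lam),
            weakLp p μ (fun x => ENNReal.ofReal lam * seqJumpR lam I S (f x) ^ (1/ρ)) := by
  have hρ0 : 0 < ρ := by linarith
  obtain ⟨R, hR, hle⟩ : ∃ R : ℝ, ρ < R ∧ ∀ (I : ℕ → ℝ) (S : Set ℝ) (a : ℝ → ℂ),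
      oscE r I S a ≤ oscE (ENNReal.ofReal R) I S a := by
    by_cases hr : r = ∞
    · subst hr
      exact ⟨ρ + 1, by linarith, fun I S a => osc_inf_le_aux _ (by linarith) I S a⟩
    · refine ⟨r.toReal, ?_, fun I S a => by rw [ENNReal.ofReal_toReal hr]⟩
      exact (ENNReal.ofReal_lt_iff_lt_toReal hρ0.le hr).1 hρr
  obtain ⟨C, hC, hmain⟩ := main_aux p hp ρ R hρ hR
  refine ⟨C, hC, ?_⟩
  intro X _ μ _ S f _
  refine iSup_le fun I => iSup_le fun hI => iSup_le fun hIS => ?_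
  refine (weakLp_mono_aux p μ _ _ (fun x => hle I S (f x))).trans ?_
  refine hmain X μ S f I _ fun lam hlam => ?_
  exact le_iSup_of_le I (le_iSup_of_le hI (le_iSup_of_le hIS (le_iSup₂_of_le lam hlam le_rfl)))
end
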